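/- arXiv:math/0206169 — 4 statements merged into one kernel-verified Lean document; each statement's English description precedes it below -/
import Mathlib

section
/- For every n ≥ 3, the number of odd involutions of length n containing the pattern 132 exactly once equals C(n−3, 2⌊(n−3)/4⌋), where C denotes the binomial coefficient. -/
open Finset

/-- The number of occurrences of the pattern `τ` (of length `k`) in the
permutation `π` (of length `n`): the number of strictly increasing index
sequences along which `π` is order-isomorphic to `τ`. -/
def occ {k n : ℕ} (τ : Equiv.Perm (Fin k)) (π : Equiv.Perm (Fin n)) : ℕ :=
  (Finset.univ.filter (fun f : Fin k → Fin n =>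
    (∀ a b : Fin k, a < b → f a < f b) ∧
    (∀ a b : Fin k, τ a < τ b ↔ π (f a) < π (f b)))).card

/-- The number of inversions of a permutation: pairs `i < j` with `π i > π j`. -/
def inversions {n : ℕ} (π : Equiv.Perm (Fin n)) : ℕ :=
  (Finset.univ.filter (fun p : Fin n × Fin n => p.1 < p.2 ∧ π p.2 < π p.1)).card

/-- The number of fixed points of a permutation. -/
def fixedPointCount {n : ℕ} (π : Equiv.Perm (Fin n)) : ℕ :=
  (Finset.univ.filter (fun j : Fin n => π j = j)).card

/-- The pattern `132` as a permutation of `Fin 3` (zero-indexed values `0,2,1`). -/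
def p132 : Equiv.Perm (Fin 3) := Equiv.swap 1 2

namespace OI

def Inv (n : ℕ) (f : ℕ → ℕ) : Prop := (∀ i, f (f i) = i) ∧ ∀ i, n ≤ i → f i = i
def Oc (f : ℕ → ℕ) (i j k : ℕ) : Prop := i < j ∧ j < k ∧ f i < f k ∧ f k < f j
def Once (f : ℕ → ℕ) : Prop :=
  ∃ i j k, Oc f i j k ∧ ∀ i' j' k', Oc f i' j' k' → i' = i ∧ j' = j ∧ k' = k
def Av (f : ℕ → ℕ) : Prop := ∀ i j k, ¬ Oc f i j k
def Spl (f : ℕ → ℕ) (n u : ℕ) : Prop := 2 * u ≤ n ∧ ∀ i, i < u → n ≤ f i + u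

open Classical in
noncomputable def kap (f : ℕ → ℕ) (n : ℕ) : ℕ := ((range (n + 1)).filter (fun u => Spl f n u)).card
def nu (f : ℕ → ℕ) (n : ℕ) : ℕ := ((range n).filter (fun i => i < f i)).card

def s (t n i : ℕ) : ℕ := if i < t then i else if i < n then i + 1 else i + 2
def sg (t n x : ℕ) : ℕ := if x ≤ t then x else if x ≤ n + 1 then x - 1 else x - 2

theorem s_sg {t n x : ℕ} (ht : t ≤ n) (h1 : x ≠ t) (h2 : x ≠ n + 1) : s t n (sg t n x) = x := by
  unfold s sg; split_ifs <;> omega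

theorem sg_s {t n x : ℕ} (ht : t ≤ n) : sg t n (s t n x) = x := by
  unfold s sg; split_ifs <;> omega

theorem s_ne1 {t n x : ℕ} : s t n x ≠ t := by
  unfold s; split_ifs <;> omega

theorem s_ne2 {t n x : ℕ} (ht : t ≤ n) : s t n x ≠ n + 1 := by
  unfold s; split_ifs <;> omega

theorem s_lt {t n x y : ℕ} : s t n x < s t n y ↔ x < y := by
  unfold s; split_ifs <;> omega

theorem s_inj {t n x y : ℕ} : s t n x = s t n y ↔ x = y := by
  unfold s; split_ifs <;> omega

theorem s_ge {t n x : ℕ} (h : n ≤ x) (ht : t ≤ n) : s t n x = x + 2 := by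
  unfold s; split_ifs <;> omega

theorem Inv.inj {n : ℕ} {f : ℕ → ℕ} (h : Inv n f) {i j : ℕ} (e : f i = f j) : i = j := by
  rw [← h.1 i, e, h.1]

theorem Inv.lt {n : ℕ} {f : ℕ → ℕ} (h : Inv n f) {i : ℕ} (hi : i < n) : f i < n := by
  by_contra hc
  have := h.2 _ (not_lt.1 hc)
  rw [h.1] at this
  omega

theorem Oc.bd {n : ℕ} {f : ℕ → ℕ} (h : Inv n f) {i j k : ℕ} (o : Oc f i j k) : k < n := by
  obtain ⟨h1, h2, h3, h4⟩ := o
  by_contra hc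
  have e := h.2 k (by omega)
  by_cases hj : j < n
  · have := h.lt hj; omega
  · have := h.2 j (by omega); omega

theorem Spl.surj {n u : ℕ} {f : ℕ → ℕ} (h : Inv n f) (hs : Spl f n u) {k : ℕ}
    (h1 : n ≤ k + u) (h2 : k < n) : f k < u := by
  have hu := hs.1
  have e : (range u).image f = Ico (n - u) n := by
    apply Finset.eq_of_subset_of_card_le
    · intro x hx
      obtain ⟨i, hi, rfl⟩ := mem_image.1 hx
      have hi := mem_range.1 hi
      have := hs.2 i hi
      have := h.lt (show i < n by omega)
      rw [mem_Ico]; omega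
    · rw [card_image_of_injective _ (fun a b => h.inj)]
      simp; omega
  have : k ∈ (range u).image f := by rw [e, mem_Ico]; omega
  obtain ⟨i, hi, rfl⟩ := mem_image.1 this
  rw [h.1]; exact mem_range.1 hi

theorem spl_of_A {n t : ℕ} {f : ℕ → ℕ} (h : Inv (n+2) f) (ht : t ≤ n) (hf : f (n+1) = t)
    (hA : ∀ i k, i < t → t < k → k ≤ n + 1 → f k < f i) : Spl f (n+2) (t+1) := by
  have hft : f t = n + 1 := by rw [← hf, h.1]
  constructor
  · have e : (range (t+1)).image f ⊆ Ioc t (n+1) := by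
      intro x hx
      obtain ⟨i, hi, rfl⟩ := mem_image.1 hx
      have hi := mem_range.1 hi
      have h2 := h.lt (show i < n + 2 by omega)
      rw [mem_Ioc]
      by_cases hit : i = t
      · subst hit; omega
      · have := hA i (n+1) (by omega) (by omega) le_rfl
        omega
    have := card_le_card e
    rw [card_image_of_injective _ (fun a b => h.inj)] at this
    simp at this; omega
  · intro i hi
    by_cases hit : i = t
    · subst hit; omega
    · have e : (Ioc t (n+1)).image f ⊆ range (f i) := by
        intro x hx
        obtain ⟨k, hk, rfl⟩ := mem_image.1 hx
        have hk := mem_Ioc.1 hk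
        exact mem_range.2 (hA i k (by omega) hk.1 hk.2)
      have := card_le_card e
      rw [card_image_of_injective _ (fun a b => h.inj)] at this
      simp at this; omega

structure Rel (n t : ℕ) (f g : ℕ → ℕ) : Prop where
  le : t ≤ n
  ft : f t = n + 1
  fn : f (n+1) = t
  fs : ∀ i, f (s t n i) = s t n (g i)

def rem (n : ℕ) (f : ℕ → ℕ) : ℕ → ℕ := fun i => sg (f (n+1)) n (f (s (f (n+1)) n i))

theorem rem_rel {n : ℕ} {f : ℕ → ℕ} (h : Inv (n+2) f) (ht : f (n+1) ≤ n) :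
    Rel n (f (n+1)) f (rem n f) ∧ Inv n (rem n f) := by
  generalize hh : f (n+1) = t at *
  have hft : f t = n + 1 := by rw [← hh, h.1]
  have fs : ∀ i, f (s t n i) = s t n (rem n f i) := by
    intro i
    unfold rem
    rw [hh, s_sg ht]
    · intro e
      have := h.inj (e.trans hh.symm)
      exact s_ne2 ht this
    · intro e
      have := h.inj (e.trans hft.symm)
      exact s_ne1 this
  refine ⟨⟨ht, hft, hh, fs⟩, ?_, ?_⟩
  · intro i
    have h1 := fs (rem n f i)
    rw [← fs i, h.1] at h1
    exact (s_inj.1 h1).symm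
  · intro i hi
    have h1 := fs i
    rw [s_ge hi ht, h.2 _ (by omega), ← s_ge hi ht] at h1
    exact (s_inj.1 h1).symm

def ins (n t : ℕ) (g : ℕ → ℕ) : ℕ → ℕ := fun x =>
  if x = t then n + 1 else if x = n + 1 then t else s t n (g (sg t n x))

theorem ins_rel {n t : ℕ} {g : ℕ → ℕ} (h : Inv n g) (ht : t ≤ n) :
    Rel n t (ins n t g) g ∧ Inv (n+2) (ins n t g) := by
  have h1 : ins n t g t = n + 1 := by simp [ins]
  have h2 : ins n t g (n+1) = t := by simp [ins]
  have fs : ∀ i, ins n t g (s t n i) = s t n (g i) := by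
    intro i
    simp only [ins, if_neg (s_ne1 (t := t) (n := n)), if_neg (s_ne2 (t := t) (n := n) ht), sg_s ht]
  refine ⟨⟨ht, h1, h2, fs⟩, ?_, ?_⟩
  · intro x
    by_cases hx : x = t
    · rw [hx, h1, h2]
    by_cases hx' : x = n + 1
    · rw [hx', h2, h1]
    rw [← s_sg ht hx hx', fs, fs, h.1]
  · intro x hx
    rw [← s_sg ht (show x ≠ t by omega) (show x ≠ n + 1 by omega), fs, h.2]
    unfold sg; split_ifs <;> omega

theorem Rel.uniq {n t : ℕ} {f f' g : ℕ → ℕ} (r : Rel n t f g) (r' : Rel n t f' g) : f = f' := by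
  funext x
  by_cases hx : x = t
  · rw [hx, r.ft, r'.ft]
  by_cases hx' : x = n + 1
  · rw [hx', r.fn, r'.fn]
  rw [← s_sg r.le hx hx', r.fs, r'.fs]

theorem Rel.uniq' {n t : ℕ} {f g g' : ℕ → ℕ} (r : Rel n t f g) (r' : Rel n t f g') : g = g' := by
  funext x
  have := r.fs x
  rw [r'.fs] at this
  exact (s_inj.1 this).symm

theorem Rel.spl {n t v : ℕ} {f g : ℕ → ℕ} (r : Rel n t f g) (hf : Inv (n+2) f) (hg : Inv n g) :
    Spl f (n+2) (v+1) ↔ t ≤ v ∧ Spl g n v := by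
  have ht := r.le
  constructor
  · intro hs
    have h1 := hs.surj hf (k := n+1) (by omega) (by omega)
    rw [r.fn] at h1
    refine ⟨by omega, by have := hs.1; omega, ?_⟩
    intro i hi
    have h3 := hs.1
    have h4 := hg.lt (show i < n by omega)
    have h2 := hs.2 (s t n i) (by unfold s; split_ifs <;> omega)
    rw [r.fs] at h2
    unfold s at h2; split_ifs at h2 <;> omega
  · rintro ⟨h1, hs⟩
    have h3 := hs.1
    refine ⟨by omega, ?_⟩
    intro x hx
    by_cases hxt : x = t
    · rw [hxt, r.ft]; omega
    have e := s_sg ht hxt (show x ≠ n + 1 by omega)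
    have hlt : sg t n x < v := by unfold sg; split_ifs <;> omega
    have h5 := hs.2 _ hlt
    rw [← e, r.fs]
    unfold s; split_ifs <;> omega

open Classical in
theorem Rel.kap {n t : ℕ} {f g : ℕ → ℕ} (r : Rel n t f g) (hf : Inv (n+2) f) (hg : Inv n g) :
    kap f (n+2) = ((((range (n + 1)).filter (fun u => Spl g n u))).filter (fun u => t ≤ u)).card + 1 := by
  unfold OI.kap
  rw [← card_image_of_injective (((range (n + 1)).filter (fun u => Spl g n u)).filter
    (fun u => t ≤ u)) Nat.succ_injective, ← card_insert_of_notMem (a := 0)]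
  · congr 1
    ext u
    simp only [mem_filter, mem_range, mem_insert, mem_image]
    constructor
    · rintro ⟨h1, h2⟩
      rcases u with _ | v
      · left; rfl
      · right
        have h3 := (r.spl hf hg).1 h2
        exact ⟨v, ⟨⟨by have := h2.1; omega, h3.2⟩, h3.1⟩, rfl⟩
    · rintro (rfl | ⟨v, ⟨⟨h1, h2⟩, h3⟩, rfl⟩)
      · exact ⟨by omega, by omega, by omega⟩
      · exact ⟨by simp; omega, (r.spl hf hg).2 ⟨h3, h2⟩⟩
  · simp

theorem Rel.nu {n t : ℕ} {f g : ℕ → ℕ} (r : Rel n t f g) :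
    nu f (n+2) = nu g n + 1 := by
  have ht := r.le
  unfold OI.nu
  rw [← card_image_of_injective ((range n).filter (fun i => i < g i)) (f := s t n)
    (fun a b => s_inj.1), ← card_insert_of_notMem (a := t)]
  · congr 1
    ext u
    simp only [mem_filter, mem_range, mem_insert, mem_image]
    constructor
    · rintro ⟨h1, h2⟩
      by_cases hu : u = t
      · left; exact hu
      right
      have hu' : u ≠ n + 1 := by
        rintro rfl
        rw [r.fn] at h2; omega
      have e := s_sg ht hu hu'
      rw [← e, r.fs, s_lt] at h2
      refine ⟨sg t n u, ⟨?_, h2⟩, e⟩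
      unfold sg; split_ifs <;> omega
    · rintro (rfl | ⟨v, ⟨h1, h2⟩, rfl⟩)
      · rw [r.ft]; omega
      · rw [r.fs, s_lt]
        refine ⟨?_, h2⟩
        unfold s; split_ifs <;> omega
  · simp only [mem_image, not_exists, not_and]
    intro x _
    exact s_ne1

theorem Rel.oc {n t : ℕ} {f g : ℕ → ℕ} (r : Rel n t f g) {i j k : ℕ} :
    Oc f (s t n i) (s t n j) (s t n k) ↔ Oc g i j k := by
  unfold Oc
  simp only [r.fs, s_lt]

theorem Rel.oc_ex {n t : ℕ} {f g : ℕ → ℕ} (r : Rel n t f g) (hf : Inv (n+2) f)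
    (hs : Spl f (n+2) (t+1)) {i j k : ℕ}
    (o : Oc f i j k) : ∃ i' j' k', i = s t n i' ∧ j = s t n j' ∧ k = s t n k' ∧ Oc g i' j' k' := by
  have ht := r.le
  have hk := o.bd hf
  obtain ⟨h1, h2, h3, h4⟩ := id o
  have hti : ∀ x, x ≤ t → n + 1 ≤ f x + t := fun x hx => by
    have := hs.2 x (by omega); omega
  have hsu : ∀ x, n + 1 ≤ x + t → x ≤ n + 1 → f x ≤ t := fun x hx hx' => by
    have := hs.surj hf (k := x) (by omega) (by omega); omega
  have bi := hf.lt (show i < n + 2 by omega)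
  have bj := hf.lt (show j < n + 2 by omega)
  have bk := hf.lt hk
  have it : i ≠ t := by rintro rfl; have := r.ft; omega
  have kt : k ≠ t := by rintro rfl; have := r.ft; omega
  have jt : j ≠ t := by
    rintro rfl
    have a1 := hti i (by omega)
    have a2 := hsu (f k) (by omega) (by omega)
    rw [hf.1] at a2; omega
  have kn : k ≠ n + 1 := by
    rintro rfl
    rw [r.fn] at h3 h4
    have a1 := hti (f i) (by omega)
    rw [hf.1] at a1
    have a2 := hsu j (by omega) (by omega)
    omega
  have e1 := s_sg ht it (show i ≠ n + 1 by omega)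
  have e2 := s_sg ht jt (show j ≠ n + 1 by omega)
  have e3 := s_sg ht kt kn
  refine ⟨_, _, _, e1.symm, e2.symm, e3.symm, ?_⟩
  rw [← r.oc, e1, e2, e3]; exact o

theorem Rel.av {n t : ℕ} {f g : ℕ → ℕ} (r : Rel n t f g) (hf : Inv (n+2) f)
    (hs : Spl f (n+2) (t+1)) : Av f ↔ Av g := by
  constructor
  · intro h i j k o
    exact h _ _ _ (r.oc.2 o)
  · intro h i j k o
    obtain ⟨i', j', k', -, -, -, o'⟩ := r.oc_ex hf hs o
    exact h _ _ _ o'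

theorem Rel.once {n t : ℕ} {f g : ℕ → ℕ} (r : Rel n t f g) (hf : Inv (n+2) f)
    (hs : Spl f (n+2) (t+1)) : Once f ↔ Once g := by
  constructor
  · rintro ⟨i, j, k, o, hu⟩
    obtain ⟨i', j', k', rfl, rfl, rfl, o'⟩ := r.oc_ex hf hs o
    refine ⟨i', j', k', o', ?_⟩
    intro a b c oo
    have := hu _ _ _ (r.oc.2 oo)
    simpa only [s_inj] using this
  · rintro ⟨i, j, k, o, hu⟩
    refine ⟨_, _, _, r.oc.2 o, ?_⟩
    intro a b c oo
    obtain ⟨i', j', k', rfl, rfl, rfl, o'⟩ := r.oc_ex hf hs oo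
    simpa only [s_inj] using hu _ _ _ o'

theorem exists_filter_card (S : Finset ℕ) : ∀ k, 1 ≤ k → k ≤ S.card →
    ∃ t ∈ S, (S.filter (fun u => t ≤ u)).card = k := by
  induction S using Finset.induction_on_min with
  | empty => intro k h1 h2; simp at h2; omega
  | insert a S ha ih =>
    intro k h1 h2
    have hn : a ∉ S := fun h => lt_irrefl _ (ha a h)
    rw [card_insert_of_notMem hn] at h2
    by_cases hk : k ≤ S.card
    · obtain ⟨t, ht, e⟩ := ih k h1 hk
      refine ⟨t, mem_insert_of_mem ht, ?_⟩
      rw [filter_insert, if_neg (by have := ha t ht; omega), e]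
    · refine ⟨a, mem_insert_self _ _, ?_⟩
      rw [filter_true_of_mem, card_insert_of_notMem hn]
      · omega
      · intro x hx
        rcases mem_insert.1 hx with rfl | hx
        · exact le_rfl
        · exact (ha x hx).le

structure Good (Q : ℕ → (ℕ → ℕ) → Prop) : Prop where
  inv : ∀ {n f}, Q n f → Inv n f
  rel : ∀ {n t f g}, Inv (n+2) f → Inv n g → Rel n t f g → Spl f (n+2) (t+1) → (Q (n+2) f ↔ Q n g)
  adm : ∀ {n f}, Q (n+2) f → 2 ≤ kap f (n+2) → Spl f (n+2) (f (n+1) + 1)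

noncomputable def cnt (Q : ℕ → (ℕ → ℕ) → Prop) (n k : ℕ) (q : ZMod 2) : ℕ :=
  {f | Q n f ∧ k ≤ kap f n ∧ (nu f n : ZMod 2) = q}.ncard

theorem Good.rem {Q : ℕ → (ℕ → ℕ) → Prop} (G : Good Q) {n : ℕ} {f : ℕ → ℕ} (h : Q (n+2) f)
    (hk : 2 ≤ OI.kap f (n+2)) : Rel n (f (n+1)) f (rem n f) ∧ Q n (rem n f) := by
  have hs := G.adm h hk
  have h1 := rem_rel (G.inv h) (by have := hs.1; omega)
  exact ⟨h1.1, (G.rel (G.inv h) h1.2 h1.1 hs).1 h⟩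

theorem Rel.kap_le {n t : ℕ} {f g : ℕ → ℕ} (r : Rel n t f g) (hf : Inv (n+2) f) (hg : Inv n g) :
    OI.kap f (n+2) ≤ OI.kap g n + 1 := by
  rw [r.kap hf hg]
  exact Nat.succ_le_succ (card_le_card (filter_subset _ _))

open Classical in
theorem Rel.t_eq {n t t' : ℕ} {f f' g : ℕ → ℕ} (r : Rel n t f g) (hf : Inv (n+2) f) (hg : Inv n g)
    (r' : Rel n t' f' g) (hf' : Inv (n+2) f') (h : Spl g n t)
    (e : OI.kap f (n+2) = OI.kap f' (n+2)) : t' ≤ t := by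
  by_contra hc
  rw [r.kap hf hg, r'.kap hf' hg] at e
  have : ((((range (n + 1)).filter (fun u => Spl g n u))).filter (fun u => t' ≤ u)) ⊂
      ((((range (n + 1)).filter (fun u => Spl g n u))).filter (fun u => t ≤ u)) := by
    rw [Finset.ssubset_iff_of_subset]
    · refine ⟨t, ?_, ?_⟩
      · simp only [mem_filter, mem_range]
        exact ⟨⟨by have := h.1; omega, h⟩, le_rfl⟩
      · simp only [mem_filter]; omega
    · intro x
      simp only [mem_filter]
      rintro ⟨h1, h2⟩
      exact ⟨h1, by omega⟩
  have := card_lt_card this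
  omega

theorem exact_count {Q : ℕ → (ℕ → ℕ) → Prop} (G : Good Q) (n k : ℕ) (hk : 1 ≤ k) (q : ZMod 2) :
    {f | Q (n+2) f ∧ kap f (n+2) = k + 1 ∧ (nu f (n+2) : ZMod 2) = q}.ncard = cnt Q n k (q - 1) := by
  unfold cnt
  refine Set.ncard_congr (fun f _ => rem n f) ?_ ?_ ?_
  · rintro f ⟨h1, h2, h3⟩
    obtain ⟨r, hq⟩ := G.rem h1 (by omega)
    have := r.kap_le (G.inv h1) (G.inv hq)
    refine ⟨hq, by omega, ?_⟩
    rw [r.nu] at h3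
    rw [← h3]; push_cast; ring
  · rintro f f' ⟨h1, h2, h3⟩ ⟨h1', h2', h3'⟩ e
    obtain ⟨r, hq⟩ := G.rem h1 (by omega)
    obtain ⟨r', hq'⟩ := G.rem h1' (by omega)
    have hs := G.adm h1 (by omega)
    have hs' := G.adm h1' (by omega)
    have e : OI.rem n f = OI.rem n f' := e
    rw [← e] at r' hq'
    have g1 := ((r.spl (G.inv h1) (G.inv hq)).1 hs).2
    have g2 := ((r'.spl (G.inv h1') (G.inv hq')).1 hs').2
    have a1 := r.t_eq (G.inv h1) (G.inv hq) r' (G.inv h1') g1 (by omega)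
    have a2 := r'.t_eq (G.inv h1') (G.inv hq) r (G.inv h1) g2 (by omega)
    have : f (n+1) = f' (n+1) := le_antisymm a2 a1
    rw [← this] at r'
    exact r.uniq r'
  · rintro g ⟨h1, h2, h3⟩
    classical
    obtain ⟨t, ht, hc⟩ := exists_filter_card ((range (n + 1)).filter (fun u => Spl g n u)) k hk
      (by unfold kap at h2; convert h2)
    simp only [mem_filter, mem_range] at ht
    obtain ⟨r, hi⟩ := ins_rel (G.inv h1) (show t ≤ n by omega)
    have hs := (r.spl hi (G.inv h1)).2 ⟨le_rfl, ht.2⟩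
    refine ⟨ins n t g, ⟨(G.rel hi (G.inv h1) r hs).2 h1, ?_, ?_⟩, ?_⟩
    · rw [r.kap hi (G.inv h1)]
      convert congrArg (· + 1) hc
    · rw [r.nu]; push_cast; rw [h3]; ring
    · have := (rem_rel hi (by rw [r.fn]; exact r.le)).1
      rw [r.fn] at this
      exact this.uniq' r

theorem inv_finite (n : ℕ) : {f | Inv n f}.Finite := by
  apply Set.Finite.of_finite_image (f := fun f => (fun i : Fin n => (f i : ℕ)))
  · refine Set.Finite.subset (Set.Finite.pi' (fun _ : Fin n => Set.finite_Iio n)) ?_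
    rintro _ ⟨f, hf, rfl⟩ i
    exact hf.lt i.2
  · intro f hf g hg e
    funext x
    by_cases hx : x < n
    · exact congrFun e ⟨x, hx⟩
    · rw [hf.2 x (by omega), hg.2 x (by omega)]

theorem cnt_step {Q : ℕ → (ℕ → ℕ) → Prop} (G : Good Q) (n k : ℕ) (q : ZMod 2) :
    cnt Q n k q = cnt Q n (k+1) q + {f | Q n f ∧ kap f n = k ∧ (nu f n : ZMod 2) = q}.ncard := by
  unfold cnt
  rw [← Set.ncard_union_eq ?_ ((inv_finite n).subset (fun f hf => G.inv hf.1))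
    ((inv_finite n).subset (fun f hf => G.inv hf.1))]
  · congr 1
    ext f
    simp only [Set.mem_union, Set.mem_ofPred_eq]
    constructor
    · rintro ⟨h1, h2, h3⟩
      by_cases h : kap f n = k
      · right; exact ⟨h1, h, h3⟩
      · left; exact ⟨h1, by omega, h3⟩
    · rintro (⟨h1, h2, h3⟩ | ⟨h1, h2, h3⟩) <;> exact ⟨h1, by omega, h3⟩
  · rw [Set.disjoint_left]
    rintro f ⟨_, h, _⟩ ⟨_, h', _⟩
    omega

theorem cnt_rec {Q : ℕ → (ℕ → ℕ) → Prop} (G : Good Q) (n k : ℕ) (hk : 1 ≤ k) (q : ZMod 2) :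
    cnt Q (n+2) (k+1) q = cnt Q (n+2) (k+2) q + cnt Q n k (q - 1) := by
  rw [cnt_step G, exact_count G n k hk]

theorem kap_bound (f : ℕ → ℕ) (n : ℕ) : 2 * kap f n ≤ n + 2 := by
  classical
  unfold kap
  have : ((range (n + 1)).filter (fun u => Spl f n u)) ⊆ range (n / 2 + 1) := by
    intro u
    simp only [mem_filter, mem_range]
    rintro ⟨h, h'⟩
    have := h'.1
    omega
  have := card_le_card this
  rw [card_range] at this
  have h2 : 2 * (n / 2 + 1) ≤ n + 2 := by omega
  refine le_trans ?_ h2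
  convert Nat.mul_le_mul_left 2 this

theorem spl_zero (f : ℕ → ℕ) (n : ℕ) : Spl f n 0 := ⟨by omega, by intro i hi; omega⟩

theorem kap_pos (f : ℕ → ℕ) (n : ℕ) : 1 ≤ kap f n := by
  classical
  unfold kap
  apply card_pos.2
  exact ⟨0, mem_filter.2 ⟨by simp, spl_zero f n⟩⟩

theorem kap_two {f : ℕ → ℕ} {n : ℕ} : 2 ≤ kap f n ↔ ∃ u, 1 ≤ u ∧ Spl f n u := by
  classical
  unfold kap
  constructor
  · intro h
    obtain ⟨a, ha, b, hb, hab⟩ := Finset.one_lt_card.1 (show 1 < _ from h)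
    simp only [mem_filter] at ha hb
    by_cases h0 : 1 ≤ a
    · exact ⟨a, h0, ha.2⟩
    · exact ⟨b, by omega, hb.2⟩
  · rintro ⟨u, h1, h2⟩
    apply Finset.one_lt_card.2
    refine ⟨0, mem_filter.2 ⟨by simp, spl_zero f n⟩, u, ?_, by omega⟩
    simp only [mem_filter, mem_range]
    exact ⟨by have := h2.1; omega, h2⟩

end OI

namespace OI

def Q1 (n : ℕ) (f : ℕ → ℕ) : Prop := Inv n f ∧ Once f
def Q2 (n : ℕ) (f : ℕ → ℕ) : Prop := Inv n f ∧ Av f ∧ ∃ u, n = 2 * u ∧ Spl f n u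

structure CS (r : ℕ) (f : ℕ → ℕ) : Prop where
  inv : Inv (2*r+3) f
  fr : f r = r
  f1 : f (r+1) = 2*r+2
  f2 : f (2*r+2) = r+1
  lo : ∀ i, i < r → r + 2 ≤ f i ∧ f i ≤ 2*r+1
  hi : ∀ i, r + 2 ≤ i → i ≤ 2*r+1 → f i < r

theorem once_struct {n t : ℕ} {f : ℕ → ℕ} (h : Inv (n+2) f) (ho : Once f) (hf : f (n+1) = t)
    (ht : t ≤ n) : Spl f (n+2) (t+1) ∨ ∃ r, n + 2 = 2*r+3 ∧ CS r f := by
  have hft : f t = n + 1 := by rw [← hf, h.1]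
  by_cases hA : ∀ i k, i < t → t < k → k ≤ n + 1 → f k < f i
  · left; exact spl_of_A h ht hf hA
  right
  push Not at hA
  obtain ⟨i, k, h1, h2, h3, h4⟩ := hA
  have hne : f i ≠ f k := fun e => by have := h.inj e; omega
  have hkn := h.lt (show k < n + 2 by omega)
  have hkne : f k ≠ n + 1 := fun e => by
    have := h.inj (e.trans hft.symm); omega
  obtain ⟨a, b, c, o, hu⟩ := ho
  have o1 : Oc f i t k := ⟨h1, h2, by omega, by omega⟩
  have o2 : Oc f (f i) (f k) (n+1) := ⟨by omega, by omega, by rw [h.1, hf]; exact h1, by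
    rw [h.1, hf]; exact h2⟩
  have u1 := hu _ _ _ o1
  have u2 := hu _ _ _ o2
  have hi : f i = i := by omega
  have hkt : f k = t := by omega
  have hk : k = n + 1 := by omega
  -- other pairs are decreasing
  have P : ∀ x y, x < t → t < y → y ≤ n + 1 → f x < f y → x = i ∧ y = n + 1 := by
    intro x y q1 q2 q3 q4
    have hyn := h.lt (show y < n + 2 by omega)
    have hyne : f y ≠ n + 1 := fun e => by
      have := h.inj (e.trans hft.symm); omega
    have := hu _ _ _ (⟨q1, q2, q4, by omega⟩ : Oc f x t y)
    omega
  have hA1 : ∀ x, x < t → x ≠ i → t < f x ∧ f x ≤ n := by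
    intro x q1 q2
    have b1 : f x ≠ t := fun e => by
      have := h.inj (e.trans hf.symm); omega
    have b2 : f x ≠ n + 1 := fun e => by
      have := h.inj (e.trans hft.symm); omega
    have b3 := h.lt (show x < n + 2 by omega)
    have b4 : ¬ f x < t := fun e => by
      have := P x (n+1) q1 (by omega) le_rfl (by omega)
      omega
    omega
  have hA2 : ∀ y, t < y → y ≤ n → f y < i := by
    intro y q1 q2
    by_contra hc
    have b1 : f y ≠ i := fun e => by
      have := h.inj (e.trans hi.symm); omega
    have := P i y h1 q1 (by omega) (by omega)
    omega
  have hti : t = i + 1 := by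
    by_contra hc
    have b1 := hA1 (i+1) (by omega) (by omega)
    have b2 := hA2 (f (i+1)) b1.1 b1.2
    rw [h.1] at b2; omega
  have c1 : (range i).image f ⊆ Ioc t n := by
    intro x hx
    obtain ⟨y, hy, rfl⟩ := mem_image.1 hx
    have hy := mem_range.1 hy
    have := hA1 y (by omega) (by omega)
    rw [mem_Ioc]; exact this
  have c2 : (Ioc t n).image f ⊆ range i := by
    intro x hx
    obtain ⟨y, hy, rfl⟩ := mem_image.1 hx
    have hy := mem_Ioc.1 hy
    exact mem_range.2 (hA2 y hy.1 hy.2)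
  have c1 := card_le_card c1
  have c2 := card_le_card c2
  rw [card_image_of_injective _ (fun a b => h.inj)] at c1 c2
  simp at c1 c2
  have hn : n = 2 * i + 1 := by omega
  subst hn
  subst hti
  refine ⟨i, rfl, h, hi, hft, hf, ?_, ?_⟩
  · intro x hx
    have := hA1 x (by omega) (by omega)
    omega
  · intro x q1 q2
    exact hA2 x (by omega) (by omega)

theorem CS.no_spl {r : ℕ} {f : ℕ → ℕ} (h : CS r f) : kap f (2*r+3) = 1 := by
  have := kap_pos f (2*r+3)
  by_contra hc
  obtain ⟨u, h1, h2⟩ := kap_two.1 (show 2 ≤ kap f (2*r+3) by omega)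
  have := h2.surj h.inv (k := 2*r+2) (by omega) (by omega)
  rw [h.f2] at this
  have := h2.1
  omega

theorem good1 : Good Q1 where
  inv h := h.1
  rel := by
    intro n t f g hf hg r hs
    unfold Q1
    rw [r.once hf hs]
    simp [hf, hg]
  adm := by
    intro n f h hk
    obtain ⟨u, h1, h2⟩ := kap_two.1 hk
    have h3 := h2.surj h.1 (k := n+1) (by omega) (by omega)
    have := h2.1
    rcases once_struct h.1 h.2 rfl (by omega) with h4 | ⟨r, hr, h4⟩
    · exact h4
    · have := h4.no_spl
      rw [← hr] at this
      omega

theorem good2 : Good Q2 where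
  inv h := h.1
  rel := by
    intro n t f g hf hg r hs
    unfold Q2
    rw [r.av hf hs]
    simp only [hf, hg, true_and]
    apply and_congr_right
    intro _
    constructor
    · rintro ⟨u, hu, h⟩
      obtain ⟨v, rfl⟩ : ∃ v, u = v + 1 := ⟨u - 1, by omega⟩
      exact ⟨v, by omega, ((r.spl hf hg).1 h).2⟩
    · rintro ⟨v, hv, h⟩
      have := ((r.spl hf hg).1 hs).2.1
      exact ⟨v + 1, by omega, (r.spl hf hg).2 ⟨by omega, h⟩⟩
  adm := by
    intro n f h hk
    obtain ⟨u, h1, h2⟩ := kap_two.1 hk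
    have h3 := h2.surj h.1 (k := n+1) (by omega) (by omega)
    have := h2.1
    refine spl_of_A h.1 (by omega) rfl ?_
    intro i k h4 h5 h6
    by_contra hc
    have hft : f (f (n+1)) = n + 1 := h.1.1 _
    have hne : f i ≠ f k := fun e => by have := h.1.inj e; omega
    have hkn := h.1.lt (show k < n + 2 by omega)
    have hkne : f k ≠ n + 1 := fun e => by
      have := h.1.inj (e.trans hft.symm); omega
    exact h.2.1 i (f (n+1)) k ⟨h4, h5, by omega, by omega⟩

structure HS (r : ℕ) (g : ℕ → ℕ) : Prop where
  inv : Inv (2*r) g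
  av : Av g
  lo : ∀ i, i < r → r ≤ g i ∧ g i < 2 * r
  hi : ∀ i, r ≤ i → i < 2 * r → g i < r

theorem q2_iff {r : ℕ} {g : ℕ → ℕ} : Q2 (2*r) g ↔ HS r g := by
  constructor
  · rintro ⟨h, ha, u, hu, hs⟩
    obtain rfl : u = r := by omega
    refine ⟨h, ha, ?_, ?_⟩
    · intro i hi
      have := hs.2 i hi
      have := h.lt (show i < 2 * u by omega)
      omega
    · intro i h1 h2
      exact hs.surj h (by omega) h2
  · rintro ⟨h, ha, h1, h2⟩
    refine ⟨h, ha, r, rfl, le_rfl, ?_⟩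
    intro i hi
    have := h1 i hi
    omega

theorem HS.nu {r : ℕ} {g : ℕ → ℕ} (h : HS r g) : nu g (2*r) = r := by
  have : (range (2*r)).filter (fun i => i < g i) = range r := by
    ext i
    simp only [mem_filter, mem_range]
    constructor
    · rintro ⟨h1, h2⟩
      by_contra hc
      have := h.hi i (by omega) h1
      omega
    · intro hi
      have := h.lo i hi
      omega
  unfold OI.nu
  rw [this, card_range]

theorem CS.nu {r : ℕ} {f : ℕ → ℕ} (h : CS r f) : nu f (2*r+3) = r + 1 := by
  have h1 := h.fr
  have h2 := h.f1
  have h3 := h.f2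
  have : (range (2*r+3)).filter (fun i => i < f i) = insert (r+1) (range r) := by
    ext i
    simp only [mem_filter, mem_range, mem_insert]
    constructor
    · rintro ⟨q1, q2⟩
      by_contra hc
      by_cases e1 : i = r
      · subst e1; omega
      by_cases e2 : i = 2*r+2
      · subst e2; omega
      have := h.hi i (by omega) (by omega)
      omega
    · rintro (rfl | hi)
      · omega
      · have := h.lo i hi
        omega
  unfold OI.nu
  rw [this, card_insert_of_notMem (by simp), card_range]

def s3 (r x : ℕ) : ℕ := if x < r then x else x + 2

theorem s3_lt {r x y : ℕ} : s3 r x < s3 r y ↔ x < y := by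
  unfold s3; split_ifs <;> omega

theorem CS.oc_ex {r : ℕ} {f : ℕ → ℕ} (h : CS r f) {i j k : ℕ} (o : Oc f i j k) :
    (i = r ∧ j = r + 1 ∧ k = 2*r+2) ∨ ∃ a b c, i = s3 r a ∧ j = s3 r b ∧ k = s3 r c ∧
      a < 2*r ∧ b < 2*r ∧ c < 2*r := by
  have hk := o.bd h.inv
  obtain ⟨h1, h2, h3, h4⟩ := id o
  have R : ∀ x, x < 2*r+3 → (x < r ∧ r + 2 ≤ f x ∧ f x ≤ 2*r+1) ∨ (x = r ∧ f x = r) ∨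
      (x = r+1 ∧ f x = 2*r+2) ∨ (x = 2*r+2 ∧ f x = r+1) ∨ (r + 2 ≤ x ∧ x ≤ 2*r+1 ∧ f x < r) := by
    intro x hx
    by_cases e1 : x < r
    · left; exact ⟨e1, h.lo x e1⟩
    by_cases e2 : x = r
    · right; left; exact ⟨e2, by rw [e2, h.fr]⟩
    by_cases e3 : x = r + 1
    · right; right; left; exact ⟨e3, by rw [e3, h.f1]⟩
    by_cases e4 : x = 2*r+2
    · right; right; right; left; exact ⟨e4, by rw [e4, h.f2]⟩
    right; right; right; right
    exact ⟨by omega, by omega, h.hi x (by omega) (by omega)⟩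
  have Ri := R i (by omega)
  have Rj := R j (by omega)
  have Rk := R k hk
  by_cases hh : i = r ∧ j = r + 1 ∧ k = 2*r+2
  · left; exact hh
  right
  have S : ∀ x, x < 2*r+2 → x ≠ r → x ≠ r + 1 → ∃ a, x = s3 r a ∧ a < 2*r := by
    intro x q1 q2 q3
    by_cases e : x < r
    · exact ⟨x, by unfold s3; rw [if_pos e], by omega⟩
    · exact ⟨x - 2, by unfold s3; rw [if_neg (by omega)]; omega, by omega⟩
  obtain ⟨a, ha⟩ := S i (by omega) (by omega) (by omega)
  obtain ⟨b, hb⟩ := S j (by omega) (by omega) (by omega)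
  obtain ⟨c, hc⟩ := S k (by omega) (by omega) (by omega)
  exact ⟨a, b, c, ha.1, hb.1, hc.1, ha.2, hb.2, hc.2⟩

theorem CS.once_iff {r : ℕ} {f g : ℕ → ℕ} (h : CS r f) (hg : Inv (2*r) g)
    (hs : ∀ x, x < 2*r → f (s3 r x) = s3 r (g x)) : Once f ↔ Av g := by
  have h1 := h.fr
  have h2 := h.f1
  have h3 := h.f2
  have o0 : Oc f r (r+1) (2*r+2) := ⟨by omega, by omega, by omega, by omega⟩
  have T : ∀ a b c, a < 2*r → b < 2*r → c < 2*r → (Oc f (s3 r a) (s3 r b) (s3 r c) ↔ Oc g a b c) := by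
    intro a b c ha hb hc
    unfold Oc
    rw [hs a ha, hs b hb, hs c hc]
    simp only [s3_lt]
  constructor
  · rintro ⟨i, j, k, o, hu⟩ a b c oo
    have hc := oo.bd hg
    obtain ⟨q1, q2, -, -⟩ := id oo
    have e1 := hu _ _ _ ((T a b c (by omega) (by omega) hc).2 oo)
    have e2 := hu _ _ _ o0
    have : s3 r a = r := by omega
    unfold s3 at this
    split_ifs at this <;> omega
  · intro ha
    refine ⟨_, _, _, o0, ?_⟩
    intro i j k o
    rcases h.oc_ex o with hh | ⟨a, b, c, rfl, rfl, rfl, h4, h5, h6⟩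
    · exact hh
    · exact absurd ((T a b c h4 h5 h6).1 o) (ha a b c)

def mid (r : ℕ) (g : ℕ → ℕ) : ℕ → ℕ := fun x =>
  if x < r then g x + 2 else if x = r then r else if x = r + 1 then 2*r+2
  else if x = 2*r+2 then r + 1 else if x < 2*r+2 then g (x-2) else x

def unm (r : ℕ) (f : ℕ → ℕ) : ℕ → ℕ := fun x =>
  if x < r then f x - 2 else if x < 2*r then f (x+2) else x

theorem mid_spec {r : ℕ} {g : ℕ → ℕ} (h : HS r g) : CS r (mid r g) ∧
    ∀ x, x < 2*r → mid r g (s3 r x) = s3 r (g x) := by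
  have m1 : ∀ x, x < r → mid r g x = g x + 2 := fun x hx => by unfold mid; rw [if_pos hx]
  have m2 : ∀ x, r ≤ x → x < 2*r → mid r g (x+2) = g x := fun x hx hx' => by
    unfold mid
    rw [if_neg (by omega), if_neg (by omega), if_neg (by omega), if_neg (by omega),
      if_pos (by omega)]; rfl
  have m3 : mid r g r = r := by simp [mid]
  have m4 : mid r g (r+1) = 2*r+2 := by simp [mid]
  have m5 : mid r g (2*r+2) = r+1 := by
    unfold mid
    rw [if_neg (by omega), if_neg (by omega), if_neg (by omega), if_pos rfl]
  have m6 : ∀ x, 2*r+3 ≤ x → mid r g x = x := fun x hx => by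
    unfold mid
    rw [if_neg (by omega), if_neg (by omega), if_neg (by omega), if_neg (by omega),
      if_neg (by omega)]
  refine ⟨⟨⟨?_, m6⟩, m3, m4, m5, ?_, ?_⟩, ?_⟩
  · intro x
    by_cases e1 : x < r
    · have := h.lo x e1
      rw [m1 x e1, m2 _ this.1 this.2, h.inv.1]
    by_cases e2 : x = r
    · rw [e2, m3, m3]
    by_cases e3 : x = r + 1
    · rw [e3, m4, m5]
    by_cases e4 : x = 2*r+2
    · rw [e4, m5, m4]
    by_cases e5 : 2*r+3 ≤ x
    · rw [m6 x e5, m6 x e5]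
    obtain ⟨y, rfl⟩ : ∃ y, x = y + 2 := ⟨x - 2, by omega⟩
    have := h.hi y (by omega) (by omega)
    rw [m2 y (by omega) (by omega), m1 _ this, h.inv.1]
  · intro x hx
    have := h.lo x hx
    rw [m1 x hx]; omega
  · intro x h1 h2
    obtain ⟨y, rfl⟩ : ∃ y, x = y + 2 := ⟨x - 2, by omega⟩
    rw [m2 y (by omega) (by omega)]
    exact h.hi y (by omega) (by omega)
  · intro x hx
    by_cases e1 : x < r
    · have := h.lo x e1
      simp only [s3, if_pos e1]
      rw [m1 x e1, if_neg (by omega)]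
    · have := h.hi x (by omega) hx
      simp only [s3, if_neg e1]
      rw [m2 x (by omega) hx, if_pos this]

theorem unm_spec {r : ℕ} {f : ℕ → ℕ} (h : CS r f) : Inv (2*r) (unm r f) ∧
    (∀ x, x < 2*r → f (s3 r x) = s3 r (unm r f x)) ∧ mid r (unm r f) = f ∧
    (∀ i, i < r → r ≤ unm r f i ∧ unm r f i < 2 * r) ∧
    ∀ i, r ≤ i → i < 2 * r → unm r f i < r := by
  have m1 : ∀ x, x < r → unm r f x = f x - 2 := fun x hx => by unfold unm; rw [if_pos hx]
  have m2 : ∀ x, r ≤ x → x < 2*r → unm r f x = f (x+2) := fun x hx hx' => by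
    unfold unm
    rw [if_neg (by omega), if_pos (by omega)]
  have m3 : ∀ x, 2*r ≤ x → unm r f x = x := fun x hx => by
    unfold unm
    rw [if_neg (by omega), if_neg (by omega)]
  refine ⟨⟨?_, m3⟩, ?_, ?_, ?_, ?_⟩
  · intro x
    by_cases e1 : x < r
    · have := h.lo x e1
      rw [m1 x e1, m2 _ (by omega) (by omega), show f x - 2 + 2 = f x by omega, h.inv.1]
    by_cases e2 : x < 2*r
    · have := h.hi (x+2) (by omega) (by omega)
      rw [m2 x (by omega) e2, m1 _ this, h.inv.1]; omega
    · rw [m3 x (by omega), m3 x (by omega)]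
  · intro x hx
    by_cases e1 : x < r
    · have := h.lo x e1
      simp only [s3, if_pos e1]
      rw [m1 x e1, if_neg (by omega)]; omega
    · have := h.hi (x+2) (by omega) (by omega)
      simp only [s3, if_neg e1]
      rw [m2 x (by omega) hx, if_pos this]
  · funext x
    unfold mid
    split_ifs with e1 e2 e3 e4 e5
    · have := h.lo x e1
      rw [m1 x e1]; omega
    · rw [e2, h.fr]
    · rw [e3, h.f1]
    · rw [e4, h.f2]
    · rw [m2 _ (by omega) (by omega), show x - 2 + 2 = x by omega]
    · rw [h.inv.2 x (by omega)]
  · intro x hx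
    have := h.lo x hx
    rw [m1 x hx]; omega
  · intro x h1 h2
    rw [m2 x h1 h2]
    exact h.hi _ (by omega) (by omega)

theorem mid_inj {r : ℕ} {g g' : ℕ → ℕ} (h : Inv (2*r) g) (h' : Inv (2*r) g')
    (e : mid r g = mid r g') : g = g' := by
  funext x
  by_cases e1 : x < r
  · have := congrFun e x
    simp only [mid, if_pos e1] at this
    omega
  by_cases e2 : x < 2*r
  · have := congrFun e (x+2)
    unfold mid at this
    rw [if_neg (by omega), if_neg (by omega), if_neg (by omega), if_neg (by omega),
      if_pos (by omega), if_neg (by omega), if_neg (by omega), if_neg (by omega), if_neg (by omega),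
      if_pos (by omega)] at this
    exact this
  · rw [h.2 x (by omega), h'.2 x (by omega)]

theorem base_mid (N : ℕ) (q : ZMod 2) :
    {f | Q1 (N+3) f ∧ kap f (N+3) = 1 ∧ (nu f (N+3) : ZMod 2) = q ∧ f (N+2) ≠ N+2}.ncard
      = cnt Q2 N 1 (q - 1) := by
  unfold cnt
  symm
  refine Set.ncard_congr (fun g _ => mid (N/2) g) ?_ ?_ ?_
  · rintro g ⟨h1, -, h3⟩
    obtain ⟨r, rfl⟩ : ∃ r, N = 2 * r := ⟨h1.2.2.choose, h1.2.2.choose_spec.1⟩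
    have hd : 2 * r / 2 = r := by omega
    rw [hd]
    rw [q2_iff] at h1
    obtain ⟨c, hs⟩ := mid_spec h1
    refine ⟨⟨c.inv, (c.once_iff h1.inv hs).2 h1.av⟩, c.no_spl, ?_, ?_⟩
    · rw [c.nu]
      rw [h1.nu] at h3
      push_cast; rw [h3]; ring
    · rw [c.f2]; omega
  · rintro g g' ⟨h1, -, h3⟩ ⟨h1', -, h3'⟩ e
    obtain ⟨r, rfl⟩ : ∃ r, N = 2 * r := ⟨h1.2.2.choose, h1.2.2.choose_spec.1⟩
    have hd : 2 * r / 2 = r := by omega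
    rw [hd] at e
    exact mid_inj h1.1 h1'.1 e
  · rintro f ⟨⟨h1, h2⟩, h3, h4, h5⟩
    have h6 := h1.lt (show N + 2 < N + 3 by omega)
    rcases once_struct (n := N+1) h1 h2 rfl (by show f (N+2) ≤ N+1; omega) with hs | ⟨r, hr, c⟩
    · have := kap_two.2 ⟨_, by omega, hs⟩
      exfalso
      change 2 ≤ kap f (N+3) at this
      omega
    · obtain rfl : N = 2 * r := by omega
      have hd : 2 * r / 2 = r := by omega
      obtain ⟨i, hs, hm, l1, l2⟩ := unm_spec c
      have hh : HS r (unm r f) := ⟨i, (c.once_iff i hs).1 h2, l1, l2⟩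
      refine ⟨unm r f, ⟨q2_iff.2 hh, kap_pos _ _, ?_⟩, by rw [hd]; exact hm⟩
      rw [hh.nu]
      rw [c.nu] at h4
      rw [← h4]; push_cast; ring

theorem fix_kap {n : ℕ} {f : ℕ → ℕ} (h : Inv (n+1) f) (hf : f n = n) : kap f (n+1) = 1 := by
  have := kap_pos f (n+1)
  by_contra hc
  obtain ⟨u, h1, h2⟩ := kap_two.1 (show 2 ≤ kap f (n+1) by omega)
  have := h2.surj h (k := n) (by omega) (by omega)
  have := h2.1
  omega

theorem base_fix (N : ℕ) (q : ZMod 2) :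
    {f | Q1 (N+3) f ∧ kap f (N+3) = 1 ∧ (nu f (N+3) : ZMod 2) = q ∧ f (N+2) = N+2}.ncard
      = cnt Q1 (N+2) 1 q := by
  unfold cnt
  congr 1
  ext f
  have hnu : f (N+2) = N+2 → nu f (N+3) = nu f (N+2) := by
    intro h
    unfold nu
    rw [range_add_one (n := N+2), filter_insert, if_neg (by omega)]
  constructor
  · rintro ⟨⟨h1, h2⟩, h3, h4, h5⟩
    refine ⟨⟨⟨h1.1, ?_⟩, h2⟩, kap_pos _ _, by rw [← hnu h5]; exact h4⟩
    intro i hi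
    rcases Nat.lt_or_ge i (N+3) with h | h
    · obtain rfl : i = N + 2 := by omega
      exact h5
    · exact h1.2 i h
  · rintro ⟨⟨h1, h2⟩, h3, h4⟩
    have h5 := h1.2 (N+2) le_rfl
    have h6 : Inv (N+3) f := ⟨h1.1, fun i hi => h1.2 i (by omega)⟩
    exact ⟨⟨h6, h2⟩, fix_kap h6 h5, by rw [hnu h5]; exact h4, h5⟩

theorem base1 (N : ℕ) (q : ZMod 2) :
    cnt Q1 (N+3) 1 q = cnt Q1 (N+3) 2 q + cnt Q1 (N+2) 1 q + cnt Q2 N 1 (q-1) := by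
  rw [cnt_step good1, ← base_fix, ← base_mid, add_assoc, ← Set.ncard_union_eq ?_
    ((inv_finite (N+3)).subset (fun f hf => hf.1.1))
    ((inv_finite (N+3)).subset (fun f hf => hf.1.1))]
  · congr 2
    ext f
    simp only [Set.mem_union, Set.mem_ofPred_eq]
    tauto
  · rw [Set.disjoint_left]
    rintro f ⟨_, _, _, h⟩ ⟨_, _, _, h'⟩
    exact h' h

theorem base2 (n : ℕ) (q : ZMod 2) : cnt Q2 (n+1) 1 q = cnt Q2 (n+1) 2 q := by
  unfold cnt
  congr 1
  ext f
  constructor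
  · rintro ⟨h1, h2, h3⟩
    refine ⟨h1, ?_, h3⟩
    obtain ⟨u, hu, hs⟩ := h1.2.2
    exact kap_two.2 ⟨u, by omega, hs⟩
  · rintro ⟨h1, h2, h3⟩
    exact ⟨h1, by omega, h3⟩

theorem base20 (q : ZMod 2) : cnt Q2 0 1 q = if q = 0 then 1 else 0 := by
  unfold cnt
  split_ifs with hq
  · rw [Set.ncard_eq_one]
    refine ⟨id, ?_⟩
    ext f
    constructor
    · rintro ⟨h1, -, -⟩
      funext x
      exact h1.1.2 x (by omega)
    · rintro rfl
      refine ⟨⟨⟨fun _ => rfl, fun _ _ => rfl⟩, ?_, 0, rfl, spl_zero _ _⟩, kap_pos _ _, ?_⟩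
      · rintro i j k ⟨h1, h2, h3, h4⟩
        simp only [id] at h3 h4; omega
      · rw [hq]; simp [nu]
  · have : {f | Q2 0 f ∧ 1 ≤ kap f 0 ∧ (nu f 0 : ZMod 2) = q} = ∅ := by
      rw [Set.eq_empty_iff_forall_notMem]
      rintro f ⟨h1, h2, h3⟩
      apply hq
      rw [← h3]; simp [nu]
    rw [this, Set.ncard_empty]

theorem cnt_zero {Q : ℕ → (ℕ → ℕ) → Prop} {n k : ℕ} (h : ∀ f, Q n f → kap f n < k) (q : ZMod 2) :
    cnt Q n k q = 0 := by
  unfold cnt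
  have : {f | Q n f ∧ k ≤ kap f n ∧ (nu f n : ZMod 2) = q} = ∅ := by
    rw [Set.eq_empty_iff_forall_notMem]
    rintro f ⟨h1, h2, h3⟩
    have := h f h1
    omega
  rw [this, Set.ncard_empty]

theorem q1_bound : ∀ (n : ℕ) (f : ℕ → ℕ), Q1 n f → 2 * kap f n + 1 ≤ n := by
  intro n
  induction n using Nat.strong_induction_on with
  | _ n ih =>
    intro f h
    have h3 : 3 ≤ n := by
      obtain ⟨i, j, k, o, -⟩ := h.2
      have := o.bd h.1
      obtain ⟨h1, h2, -, -⟩ := o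
      omega
    have := kap_pos f n
    by_cases hk : 2 ≤ kap f n
    · obtain ⟨m, rfl⟩ : ∃ m, n = m + 2 := ⟨n - 2, by omega⟩
      obtain ⟨r, hq⟩ := good1.rem h hk
      have h1 := r.kap_le h.1 hq.1
      have h2 := ih m (by omega) _ hq
      omega
    · omega

def e : ℕ → ℕ → ZMod 2 → ℕ
  | 0, h, q => if h = 0 ∧ q = 0 then 1 else 0
  | N+1, 0, q => e N 1 (q+1)
  | N+1, h+1, q => e N h q + e N (h+2) (q+1)

def w : ℕ → ℕ → ZMod 2 → ℕ
  | 0, h, q => if h = 0 ∧ q = 0 then 1 else 0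
  | N+1, 0, q => w N 0 q + w N 1 (q+1)
  | N+1, h+1, q => w N h q + w N (h+2) (q+1)

theorem w_e : ∀ N h q, w N h q = w N (h+1) q + e N h q := by
  intro N
  induction N with
  | zero =>
    intro h q
    simp [w, e]
  | succ N ih =>
    intro h q
    rcases h with _ | h
    · simp only [w, e]
      rw [ih 1 (q+1)]; ring
    · simp only [w, e]
      rw [ih h q, ih (h+2) (q+1)]; ring

theorem z2 (a : ZMod 2) : a + 1 + 1 = a := by revert a; decide

theorem z2' (a : ZMod 2) : a - 1 = a + 1 := by revert a; decide

theorem cnt2 : ∀ N k q, cnt Q2 (N+k) (k+1) q = e N k (q - k) := by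
  intro N
  induction N with
  | zero =>
    intro k q
    rcases k with _ | k
    · simp [base20, e]
    · rw [cnt_zero]
      · simp [e]
      · intro f _
        have := kap_bound f (0 + (k+1))
        omega
  | succ N ih =>
    intro k q
    rcases k with _ | k
    · have h := ih 1 q
      have hb := base2 N q
      simp only [e]
      rw [show N + 1 + 0 = N + 1 by ring, show (0:ℕ) + 1 = 1 by ring, hb, h]
      congr 1
      push_cast; rw [sub_zero, z2']
    · have h1 := ih (k+2) q
      have h2 := ih k (q-1)
      have h3 := cnt_rec good2 (N+k) (k+1) (by omega) q
      simp only [e]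
      rw [show N + 1 + (k+1) = N + k + 2 by ring, h3, h2]
      rw [show N + (k+2) = N + k + 2 by ring] at h1
      rw [h1, add_comm]
      congr 2
      · push_cast; ring
      · push_cast; rw [← z2' (q - (k+1))]; ring

theorem cnt1 : ∀ N k q, cnt Q1 (N+k+2) (k+1) q = w N (k+1) (q - k - 1) := by
  intro N
  induction N with
  | zero =>
    intro k q
    rw [cnt_zero]
    · simp [w]
    · intro f hf
      have := q1_bound _ f hf
      omega
  | succ N ih =>
    intro k q
    rcases k with _ | k
    · have h1 := ih 1 q
      have h2 := ih 0 q
      have h3 := cnt2 N 0 (q-1)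
      have h4 := base1 N q
      simp only [w]
      rw [show N + 1 + 0 + 2 = N + 3 by ring, show (0:ℕ) + 1 = 1 by ring, h4]
      rw [show N + 1 + 2 = N + 3 by ring] at h1
      rw [show N + 0 = N by ring, show (0:ℕ) + 1 = 1 by ring] at h2 h3
      rw [h1, h2, h3, w_e N 0]
      push_cast
      simp only [sub_zero, z2', z2]
      ring
    · have h1 := ih (k+2) q
      have h2 := ih k (q-1)
      have h3 := cnt_rec good1 (N+k+2) (k+1) (by omega) q
      simp only [w]
      rw [show N + 1 + (k+1) + 2 = N + k + 2 + 2 by ring, h3, h2]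
      rw [show N + (k+2) + 2 = N + k + 2 + 2 by ring] at h1
      rw [h1, add_comm]
      congr 2
      · push_cast; ring
      · push_cast; rw [← z2' (q - (k+1) - 1)]; ring

/-- closed form -/
def cf (N d : ℕ) (q : ZMod 2) : ℕ :=
  if (d : ZMod 2) = q then N.choose d else if d = 0 then 0 else N.choose (d - 1)

theorem cf_pascal (N d : ℕ) (q : ZMod 2) : cf (N+1) (d+1) q = cf N (d+1) q + cf N d (q+1) := by
  have : (((d+1 : ℕ) : ZMod 2) = q) ↔ ((d : ZMod 2) = q + 1) := by
    push_cast
    generalize (d : ZMod 2) = a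
    revert a q; decide
  unfold cf
  simp only [this]
  rw [if_neg (Nat.succ_ne_zero d), if_neg (Nat.succ_ne_zero d)]
  split_ifs with h1 h2
  · rw [Nat.choose_succ_succ]; ring
  · subst h2; simp
  · obtain ⟨c, rfl⟩ : ∃ c, d = c + 1 := ⟨d - 1, by omega⟩
    simp only [Nat.add_sub_cancel]
    rw [Nat.choose_succ_succ]; ring

theorem cf_sym (m : ℕ) (q : ZMod 2) : cf (2*m) (m+1) q = cf (2*m) m q := by
  have : (((m+1 : ℕ) : ZMod 2) = q) ↔ ¬ ((m : ZMod 2) = q) := by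
    push_cast
    generalize (m : ZMod 2) = a
    revert a q; decide
  unfold cf
  simp only [this]
  rw [if_neg (Nat.succ_ne_zero m)]
  split_ifs with h1 h2
  · simp
  · subst h2; simp
  · apply Nat.choose_symm_of_eq_add; omega

theorem w_cf : ∀ N h q, w (N+1) h q = if N + 1 < h then 0 else cf N ((N+1-h)/2) q := by
  intro N
  induction N with
  | zero =>
    intro h q
    rcases h with _ | _ | h
    · simp [w, cf, eq_comm]
    · simp [w, cf, eq_comm]
    · simp [w]
  | succ N ih =>
    intro h q
    rcases h with _ | h
    · rw [w, ih, ih, if_neg (by omega), if_neg (by omega), if_neg (by omega)]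
      obtain ⟨m, hm⟩ : ∃ m, N = 2*m ∨ N = 2*m+1 := ⟨N/2, by omega⟩
      rcases hm with rfl | rfl
      · rw [show (2*m+1-0)/2 = m by omega, show (2*m+1-1)/2 = m by omega,
          show (2*m+1+1-0)/2 = m+1 by omega, cf_pascal, cf_sym]
      · rw [show (2*m+1+1-0)/2 = m+1 by omega, show (2*m+1+1-1)/2 = m by omega,
          show (2*m+1+1+1-0)/2 = m+1 by omega, cf_pascal (2*m+1)]
    · rw [w, ih, ih]
      by_cases h1 : N + 1 < h
      · rw [if_pos h1, if_pos (by omega), if_pos (by omega)]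
      rw [if_neg h1, if_neg (show ¬ N + 1 + 1 < h + 1 by omega)]
      by_cases h2 : N + 1 < h + 2
      · rw [if_pos h2, show (N+1-h)/2 = 0 by omega, show (N+1+1-(h+1))/2 = 0 by omega]
        simp [cf]
      · rw [if_neg h2]
        obtain ⟨d, hd⟩ : ∃ d, (N+1-h)/2 = d+1 := ⟨(N+1-h)/2 - 1, by omega⟩
        rw [hd, show (N+1-(h+2))/2 = d by omega, show (N+1+1-(h+1))/2 = d+1 by omega, cf_pascal]

theorem final_count (m : ℕ) : cnt Q1 (m+3) 1 1 = m.choose (2 * (m/4)) := by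
  have h := cnt1 (m+1) 0 1
  rw [show m + 1 + 0 + 2 = m + 3 by ring, w_cf] at h
  rw [show (0:ℕ)+1 = 1 by ring] at h
  rw [h, if_neg (by omega), show (m+1-1)/2 = m/2 by simp]
  unfold cf
  have e : (1 : ZMod 2) - ((0:ℕ) : ZMod 2) - 1 = 0 := by decide
  rw [e]
  have : ((m/2 : ℕ) : ZMod 2) = 0 ↔ Even (m/2) := ZMod.natCast_eq_zero_iff_even
  simp only [this]
  split_ifs with h1 h2
  · obtain ⟨c, hc⟩ := h1
    congr 1; omega
  · rw [h2] at h1; exact absurd (by decide) h1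
  · obtain ⟨c, hc⟩ := Nat.not_even_iff_odd.1 h1
    congr 1; omega

end OI

namespace OI

def toF {n : ℕ} (π : Equiv.Perm (Fin n)) : ℕ → ℕ := fun i =>
  if h : i < n then (π ⟨i, h⟩ : ℕ) else i

theorem toF_lt {n : ℕ} (π : Equiv.Perm (Fin n)) (i : Fin n) : toF π i = π i := by
  simp [toF]

theorem toF_ge {n : ℕ} (π : Equiv.Perm (Fin n)) {i : ℕ} (h : n ≤ i) : toF π i = i := by
  simp [toF]; omega

theorem toF_inv {n : ℕ} (π : Equiv.Perm (Fin n)) (h : ∀ i, π (π i) = i) : Inv n (toF π) := by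
  refine ⟨?_, fun i hi => toF_ge π hi⟩
  intro i
  rcases Nat.lt_or_ge i n with hi | hi
  · have := toF_lt π ⟨i, hi⟩
    simp only at this
    rw [this, toF_lt, h]
  · rw [toF_ge π hi, toF_ge π hi]

theorem inversions_parity {n : ℕ} (π : Equiv.Perm (Fin n)) (h : ∀ i, π (π i) = i) :
    (inversions π : ZMod 2) = (nu (toF π) n : ZMod 2) := by
  unfold inversions
  rw [← Finset.card_filter_add_card_filter_not (fun p : Fin n × Fin n => π p.1 = p.2)]
  push_cast
  have h1 : ((((univ.filter (fun p : Fin n × Fin n => p.1 < p.2 ∧ π p.2 < π p.1)).filter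
      (fun p : Fin n × Fin n => ¬ π p.1 = p.2)).card : ℕ) : ZMod 2) = 0 := by
    rw [Finset.card_eq_sum_ones]
    push_cast
    refine Finset.sum_involution (fun p _ => (π p.2, π p.1)) ?_ ?_ ?_ ?_
    · intro p hp; decide
    · intro p hp _ e
      simp only [mem_filter] at hp
      exact hp.2 (congrArg Prod.snd e)
    · intro p hp
      simp only [mem_filter, mem_univ, true_and] at hp ⊢
      simp only [h]
      refine ⟨⟨hp.1.2, hp.1.1⟩, fun e => hp.2 e.symm⟩
    · intro p hp
      simp only [h]
  rw [h1, add_zero]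
  congr 1
  unfold nu
  refine Finset.card_bij (fun p _ => (p.1 : ℕ)) ?_ ?_ ?_
  · rintro ⟨a, b⟩ hp
    simp only [mem_filter, mem_univ, true_and] at hp
    simp only [mem_filter, mem_range]
    refine ⟨a.2, ?_⟩
    rw [toF_lt, hp.2]
    exact hp.1.1
  · rintro ⟨a, b⟩ hp ⟨a', b'⟩ hp' e
    simp only [mem_filter, mem_univ, true_and] at hp hp'
    have : a = a' := Fin.ext e
    subst this
    rw [← hp.2, ← hp'.2]
  · intro i hi
    simp only [mem_filter, mem_range] at hi
    have e := toF_lt π ⟨i, hi.1⟩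
    simp only at e
    have hlt : (⟨i, hi.1⟩ : Fin n) < π ⟨i, hi.1⟩ := by
      rw [Fin.lt_def, ← e]; exact hi.2
    refine ⟨(⟨i, hi.1⟩, π ⟨i, hi.1⟩), ?_, rfl⟩
    simp only [mem_filter, mem_univ, true_and, h, and_true]
    exact ⟨hlt, hlt⟩

theorem occ_iff {n : ℕ} (π : Equiv.Perm (Fin n)) (f : Fin 3 → Fin n) :
    ((∀ a b : Fin 3, a < b → f a < f b) ∧ (∀ a b : Fin 3, p132 a < p132 b ↔ π (f a) < π (f b))) ↔
    Oc (toF π) (f 0) (f 1) (f 2) := by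
  unfold Oc
  simp only [toF_lt, ← Fin.lt_def]
  have e0 : p132 0 = 0 := by decide
  have e1 : p132 1 = 2 := by decide
  have e2 : p132 2 = 1 := by decide
  constructor
  · rintro ⟨h1, h2⟩
    refine ⟨h1 0 1 (by decide), h1 1 2 (by decide), ?_, ?_⟩
    · exact (h2 0 2).1 (by decide)
    · exact (h2 2 1).1 (by decide)
  · rintro ⟨h1, h2, h3, h4⟩
    constructor
    · intro a b hab
      fin_cases a <;> fin_cases b <;> simp at hab ⊢ <;> first | assumption | exact h1.trans h2
    · intro a b
      have h5 := h3.trans h4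
      fin_cases a <;> fin_cases b <;> simp [e0, e1, e2, h3, h4, h5, h3.le, h4.le, h5.le]

theorem occ_once {n : ℕ} (π : Equiv.Perm (Fin n)) (h : ∀ i, π (π i) = i) :
    occ p132 π = 1 ↔ Once (toF π) := by
  unfold occ
  rw [Finset.card_eq_one]
  constructor
  · rintro ⟨f, hf⟩
    have hm : ∀ g : Fin 3 → Fin n, Oc (toF π) (g 0) (g 1) (g 2) ↔ g = f := by
      intro g
      rw [← occ_iff, ← Finset.mem_singleton, ← hf]; simp
    refine ⟨f 0, f 1, f 2, (hm f).2 rfl, ?_⟩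
    intro i j k o
    have hk := o.bd (toF_inv π h)
    obtain ⟨h1, h2, -, -⟩ := id o
    have := (hm ![⟨i, by omega⟩, ⟨j, by omega⟩, ⟨k, hk⟩]).1 o
    rw [← this]
    exact ⟨rfl, rfl, rfl⟩
  · rintro ⟨i, j, k, o, hu⟩
    have hk := o.bd (toF_inv π h)
    obtain ⟨h1, h2, -, -⟩ := id o
    refine ⟨![⟨i, by omega⟩, ⟨j, by omega⟩, ⟨k, hk⟩], ?_⟩
    ext g
    rw [Finset.mem_singleton, Finset.mem_filter, occ_iff]
    constructor
    · rintro ⟨-, o'⟩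
      have := hu _ _ _ o'
      funext x
      fin_cases x
      · exact Fin.ext this.1
      · exact Fin.ext this.2.1
      · exact Fin.ext this.2.2
    · rintro rfl
      exact ⟨mem_univ _, o⟩

theorem transfer (n : ℕ) : (Finset.univ.filter (fun π : Equiv.Perm (Fin n) =>
      (∀ i, π (π i) = i) ∧ occ p132 π = 1 ∧ Odd (inversions π))).card = cnt Q1 n 1 1 := by
  rw [← Set.ncard_coe_finset]
  unfold cnt
  have key : ∀ π : Equiv.Perm (Fin n), (∀ i, π (π i) = i) →
      ((occ p132 π = 1 ∧ Odd (inversions π)) ↔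
        (Once (toF π) ∧ (nu (toF π) n : ZMod 2) = 1)) := by
    intro π h
    rw [occ_once π h, ← inversions_parity π h, ZMod.natCast_eq_one_iff_odd]
  refine Set.ncard_congr (fun π _ => toF π) ?_ ?_ ?_
  · intro π hp
    simp only [coe_filter, mem_univ, true_and, Set.mem_ofPred_eq] at hp
    obtain ⟨h1, h2⟩ := (key π hp.1).1 hp.2
    exact ⟨⟨toF_inv π hp.1, h1⟩, kap_pos _ _, h2⟩
  · intro π π' _ _ e
    ext i
    rw [← toF_lt, ← toF_lt]
    exact congrFun e i
  · rintro f ⟨⟨h1, h2⟩, -, h3⟩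
    let π : Equiv.Perm (Fin n) := Function.Involutive.toPerm
      (fun i => (⟨f i, h1.lt i.2⟩ : Fin n)) (fun i => Fin.ext (h1.1 i))
    have hp : ∀ i, π (π i) = i := fun i => Fin.ext (h1.1 i)
    have e : toF π = f := by
      funext x
      rcases Nat.lt_or_ge x n with hx | hx
      · exact toF_lt π ⟨x, hx⟩
      · rw [toF_ge π hx, h1.2 x hx]
    refine ⟨π, ?_, e⟩
    simp only [coe_filter, mem_univ, true_and, Set.mem_ofPred_eq]
    refine ⟨hp, (key π hp).2 ?_⟩
    rw [e]; exact ⟨h2, h3⟩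

end OI

/-- For every n ≥ 3, the number of odd involutions of length n containing 132
exactly once equals C(n−3, 2⌊(n−3)/4⌋). -/
theorem odd_involutions_containing_132_once (n : ℕ) (hn : 3 ≤ n) :
    (Finset.univ.filter (fun π : Equiv.Perm (Fin n) =>
      (∀ i, π (π i) = i) ∧ occ p132 π = 1 ∧ Odd (inversions π))).card
      = Nat.choose (n - 3) (2 * ((n - 3) / 4)) := by
  rw [OI.transfer]
  obtain ⟨m, rfl⟩ : ∃ m, n = m + 3 := ⟨n - 3, by omega⟩
  exact OI.final_count m
end

section
/- For every n ≥ 1 and every s with 1 ≤ s ≤ n, the number of involutions of length n avoiding the pattern 132 and having exactly s right-to-left maxima equals: 0 if n is odd and s is even; C(n−1−s/2, n/2−1) − C(n−1−s/2, n/2) if n and s are both even; and C(n−1−(s−1)/2, ⌊n/2⌋) if s is odd, where C denotes the binomial coefficient. -/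
open Finset

/-- The number of right-to-left maxima of a permutation. -/
def rlMaxCount {n : ℕ} (π : Equiv.Perm (Fin n)) : ℕ :=
  (Finset.univ.filter (fun j : Fin n => ∀ i : Fin n, j < i → π i < π j)).card

namespace Inv132

def Good (n : ℕ) (f : ℕ → ℕ) : Prop :=
  (∀ i, f (f i) = i) ∧ (∀ i, n ≤ i → f i = i) ∧
  (∀ i j k, i < j → j < k → k < n → ¬ (f i < f k ∧ f k < f j))

def IsCut (n : ℕ) (f : ℕ → ℕ) (k : ℕ) : Prop :=
  k ≤ n ∧ ∀ i j, i < k → k ≤ j → j < n → f j < f i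

open Classical in
noncomputable def cuts (n : ℕ) (f : ℕ → ℕ) : Finset ℕ :=
  (Finset.range (n + 1)).filter (fun k => IsCut n f k)

lemma mem_cuts {n : ℕ} {f : ℕ → ℕ} {k : ℕ} : k ∈ cuts n f ↔ IsCut n f k := by
  unfold cuts IsCut
  simp only [Finset.mem_filter, Finset.mem_range]
  constructor
  · exact fun h => h.2
  · exact fun h => ⟨by omega, h⟩

lemma Good.lt {n : ℕ} {f : ℕ → ℕ} (h : Good n f) {i : ℕ} (hi : i < n) : f i < n := by
  by_contra hc
  have h1 := h.2.1 (f i) (by omega)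
  have h2 := h.1 i
  omega

lemma Good.inj {n : ℕ} {f : ℕ → ℕ} (h : Good n f) : Function.Injective f := by
  intro a b hab
  rw [← h.1 a, ← h.1 b, hab]

lemma cut_left {n : ℕ} {f : ℕ → ℕ} (h : Good n f) {k : ℕ} (hk : IsCut n f k) {i : ℕ}
    (hi : i < k) : n - k ≤ f i := by
  have h1 : (Finset.Ico k n).card ≤ (Finset.range (f i)).card := by
    apply Finset.card_le_card_of_injOn f
    · intro j hj
      simp only [Finset.coe_Ico, Set.mem_Ico] at hj
      simp only [Finset.coe_range, Set.mem_Iio]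
      exact hk.2 i j hi hj.1 hj.2
    · exact h.inj.injOn
  simpa using h1

lemma cut_right {n : ℕ} {f : ℕ → ℕ} (h : Good n f) {k : ℕ} (hk : IsCut n f k) {j : ℕ}
    (hj : k ≤ j) (hjn : j < n) : f j < n - k := by
  have h1 : (Finset.range k).card ≤ (Finset.Ico (f j + 1) n).card := by
    apply Finset.card_le_card_of_injOn f
    · intro i hi
      simp only [Finset.coe_range, Set.mem_Iio] at hi
      simp only [Finset.coe_Ico, Set.mem_Ico]
      exact ⟨hk.2 i j hi hj hjn, h.lt (by have := hk.1; omega)⟩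
    · exact h.inj.injOn
  have := h.lt hjn
  simp at h1
  omega

lemma cut_symm {n : ℕ} {f : ℕ → ℕ} (h : Good n f) {k : ℕ} (hk : IsCut n f k) :
    IsCut n f (n - k) := by
  have hkn := hk.1
  refine ⟨by omega, ?_⟩
  intro i j hi hj hjn
  have a1 : k ≤ f i := by
    by_contra hc
    have := cut_left h hk (i := f i) (by omega)
    rw [h.1] at this
    omega
  have a2 : f j < k := by
    by_contra hc
    have := cut_right h hk (j := f j) (by omega) (h.lt hjn)
    rw [h.1] at this
    omega
  omega

lemma zero_cut (n : ℕ) (f : ℕ → ℕ) : IsCut n f 0 := ⟨by omega, by intro i j h; omega⟩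
lemma self_cut (n : ℕ) (f : ℕ → ℕ) : IsCut n f n := ⟨le_rfl, by intro i j h; omega⟩

/-- Symmetric sets. -/
lemma sym_exists (N : ℕ) (r : ℕ) (hr : 1 ≤ r) : ∀ (c : ℕ) (K : Finset ℕ), K.card = r + 2 * c →
    (∀ k ∈ K, k ≤ N ∧ N - k ∈ K) →
    ∃ p ∈ K, 2 * p ≤ N ∧ (K.filter (fun k => p ≤ k ∧ k ≤ N - p)).card = r := by
  intro c
  induction c with
  | zero =>
    intro K hK hs
    have hne : K.Nonempty := by
      rw [← Finset.card_pos]; omega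
    have hm := K.min'_mem hne
    have hle : ∀ k ∈ K, K.min' hne ≤ k := fun k hk => K.min'_le k hk
    generalize K.min' hne = p at hm hle
    refine ⟨p, hm, ?_, ?_⟩
    · have h1 := hs p hm
      have h2 := hle _ h1.2
      omega
    · rw [Finset.filter_true_of_mem]
      · simpa using hK
      · intro k hk
        have h1 := hs k hk
        have h2 := hle _ h1.2
        have h3 := hle _ hk
        omega
  | succ c ih =>
    intro K hK hs
    have hne : K.Nonempty := by
      rw [← Finset.card_pos]; omega
    have hm := K.min'_mem hne
    have hle : ∀ k ∈ K, K.min' hne ≤ k := fun k hk => K.min'_le k hk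
    generalize K.min' hne = p at hm hle
    have hp := hs p hm
    have hp2 : p ≠ N - p := by
      intro he
      have : K ⊆ {p} := by
        intro k hk
        have h1 := hs k hk
        have h2 := hle _ h1.2
        have h3 := hle _ hk
        simp only [Finset.mem_singleton]; omega
      have := Finset.card_le_card this
      simp at this
      omega
    have hc : ((K.erase p).erase (N - p)).card = r + 2 * c := by
      rw [Finset.card_erase_of_mem, Finset.card_erase_of_mem hm]
      · omega
      · simp only [Finset.mem_erase]; exact ⟨fun h => hp2 h.symm, hp.2⟩
    obtain ⟨q, hq, hq2, hq3⟩ := ih _ hc (by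
      intro k hk
      simp only [Finset.mem_erase] at hk ⊢
      have h1 := hs k hk.2.2
      refine ⟨h1.1, by omega, by omega, h1.2⟩)
    simp only [Finset.mem_erase] at hq
    refine ⟨q, hq.2.2, hq2, ?_⟩
    rw [← hq3]
    congr 1
    ext k
    have := hle q hq.2.2
    simp only [Finset.mem_filter, Finset.mem_erase]
    constructor
    · rintro ⟨h1, h2, h3⟩
      exact ⟨⟨by omega, by omega, h1⟩, h2, h3⟩
    · rintro ⟨⟨_, _, h1⟩, h2⟩
      exact ⟨h1, h2⟩

lemma sym_parity (N : ℕ) (K : Finset ℕ) (hs : ∀ k ∈ K, k ≤ N ∧ N - k ∈ K) (p : ℕ)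
    (hp : 2 * p ≤ N) :
    ∃ c, K.card = (K.filter (fun k => p ≤ k ∧ k ≤ N - p)).card + 2 * c := by
  refine ⟨(K.filter (fun k => k < p)).card, ?_⟩
  have h1 : (K.filter (fun k => k < p)).card = (K.filter (fun k => N - p < k)).card := by
    apply Finset.card_bij (fun k _ => N - k)
    · intro k hk
      simp only [Finset.mem_filter] at hk ⊢
      exact ⟨(hs k hk.1).2, by omega⟩
    · intro a ha b hb hab
      simp only [Finset.mem_filter] at ha hb
      omega
    · intro b hb
      simp only [Finset.mem_filter] at hb
      have := hs b hb.1
      refine ⟨N - b, ?_, by omega⟩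
      simp only [Finset.mem_filter]
      exact ⟨this.2, by omega⟩
  have h2 : K = (K.filter (fun k => p ≤ k ∧ k ≤ N - p)) ∪
      ((K.filter (fun k => k < p)) ∪ (K.filter (fun k => N - p < k))) := by
    ext k
    simp only [Finset.mem_union, Finset.mem_filter]
    constructor
    · intro hk
      by_cases h1 : k < p
      · tauto
      · by_cases h2 : N - p < k
        · tauto
        · left; exact ⟨hk, by omega, by omega⟩
    · tauto
  conv_lhs => rw [h2]
  rw [Finset.card_union_of_disjoint, Finset.card_union_of_disjoint, ← h1]
  · ring
  · rw [Finset.disjoint_left]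
    intro a ha hb
    simp only [Finset.mem_filter] at ha hb
    omega
  · rw [Finset.disjoint_left]
    intro a ha hb
    simp only [Finset.mem_filter, Finset.mem_union] at ha hb
    omega

lemma sym_unique (N : ℕ) (K : Finset ℕ) (p q : ℕ) (hp : p ∈ K) (hpN : 2 * p ≤ N)
    (hpq : p < q) :
    (K.filter (fun k => q ≤ k ∧ k ≤ N - q)).card <
      (K.filter (fun k => p ≤ k ∧ k ≤ N - p)).card := by
  apply Finset.card_lt_card
  rw [Finset.ssubset_iff]
  refine ⟨p, ?_, ?_⟩
  · simp only [Finset.mem_filter]; omega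
  · intro k hk
    simp only [Finset.mem_filter, Finset.mem_insert] at hk ⊢
    rcases hk with rfl | hk
    · exact ⟨hp, by omega, by omega⟩
    · exact ⟨hk.1, by omega, by omega⟩

def up (p i : ℕ) : ℕ := if i < p then i else i + 1
def dn (p i : ℕ) : ℕ := if i < p then i else i - 1

def ins (n p : ℕ) (g : ℕ → ℕ) (i : ℕ) : ℕ :=
  if i = p then n + 1 else if i = n + 1 then p else if n + 1 < i then i else up p (g (dn p i))

def rem (n p : ℕ) (f : ℕ → ℕ) (i : ℕ) : ℕ :=
  if n ≤ i then i else dn p (f (up p i))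

lemma up_dn {p i : ℕ} (h : i ≠ p) : up p (dn p i) = i := by
  unfold up dn; split_ifs <;> omega
lemma dn_up {p i : ℕ} : dn p (up p i) = i := by
  unfold up dn; split_ifs <;> omega
lemma up_ne {p i : ℕ} : up p i ≠ p := by
  unfold up; split_ifs <;> omega
lemma up_lt {p i j : ℕ} : up p i < up p j ↔ i < j := by
  unfold up; split_ifs <;> omega
lemma up_bd {n p i : ℕ} (h : i < n) (hp : p ≤ n) : up p i < n + 1 := by
  unfold up; split_ifs <;> omega
lemma dn_bd {n p i : ℕ} (h : i < n + 1) (hi : i ≠ p) (hp : p ≤ n) : dn p i < n := by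
  unfold dn; split_ifs <;> omega
lemma dn_lt {p i j : ℕ} (hi : i ≠ p) (hj : j ≠ p) : dn p i < dn p j ↔ i < j := by
  unfold dn; split_ifs <;> omega

lemma ins_p (n p : ℕ) (g : ℕ → ℕ) : ins n p g p = n + 1 := by simp [ins]
lemma ins_last (n p : ℕ) (g : ℕ → ℕ) (hp : p ≤ n) : ins n p g (n + 1) = p := by
  unfold ins; rw [if_neg (by omega), if_pos rfl]
lemma ins_up (n p : ℕ) (g : ℕ → ℕ) (hp : p ≤ n) {i : ℕ} (hi : i < n) :
    ins n p g (up p i) = up p (g i) := by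
  have h1 := up_bd hi hp
  unfold ins
  rw [if_neg up_ne, if_neg (by omega), if_neg (by omega), dn_up]
lemma ins_big (n p : ℕ) (g : ℕ → ℕ) (hp : p ≤ n) {i : ℕ} (hi : n + 1 < i) :
    ins n p g i = i := by
  unfold ins; rw [if_neg (by omega), if_neg (by omega), if_pos hi]

lemma idx_cases {n p : ℕ} (hp : p ≤ n) (i : ℕ) :
    i = p ∨ i = n + 1 ∨ n + 1 < i ∨ ∃ a, a < n ∧ i = up p a := by
  by_cases h1 : i = p
  · tauto
  by_cases h2 : i = n + 1
  · tauto
  by_cases h3 : n + 1 < i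
  · tauto
  right; right; right
  exact ⟨dn p i, dn_bd (by omega) h1 hp, (up_dn h1).symm⟩

lemma ins_good {n p : ℕ} {g : ℕ → ℕ} (h : Good n g) (hp : IsCut n g p) (hp2 : 2 * p ≤ n) :
    Good (n + 2) (ins n p g) := by
  have hpn : p ≤ n := hp.1
  refine ⟨?_, ?_, ?_⟩
  · intro i
    rcases idx_cases hpn i with rfl | rfl | hi | ⟨a, ha, rfl⟩
    · rw [ins_p, ins_last _ _ _ hpn]
    · rw [ins_last _ _ _ hpn, ins_p]
    · rw [ins_big _ _ _ hpn hi, ins_big _ _ _ hpn hi]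
    · rw [ins_up _ _ _ hpn ha, ins_up _ _ _ hpn (h.lt ha), h.1]
  · intro i hi
    exact ins_big _ _ _ hpn (by omega)
  · rintro i j k hij hjk hkn ⟨h1, h2⟩
    have key : ∀ a, a < n → up p (g a) < n + 1 := fun a ha => up_bd (h.lt ha) hpn
    have hbig : ∀ a, a < n → p ≤ a → up p (g a) < n + 1 - p := by
      intro a ha hpa
      have := cut_right h hp hpa ha
      unfold up; split_ifs <;> omega
    have hsm : ∀ a, a < p → n + 1 - p ≤ up p (g a) := by
      intro a hpa
      have := cut_left h hp hpa
      unfold up; split_ifs <;> omega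
    rcases idx_cases hpn i with rfl | rfl | hi | ⟨a, ha, rfl⟩
    · rw [ins_p] at h1
      rcases idx_cases hpn k with rfl | rfl | hi | ⟨a, ha, rfl⟩
      · omega
      · rw [ins_last _ _ _ hpn] at h1; omega
      · omega
      · rw [ins_up _ _ _ hpn ha] at h1; have := key a ha; omega
    · omega
    · omega
    rw [ins_up _ _ _ hpn ha] at h1
    have ka := key a ha
    rcases idx_cases hpn k with rfl | rfl | hi | ⟨c, hc, rfl⟩
    · rw [ins_p] at h1 h2
      rcases idx_cases hpn j with rfl | rfl | hi | ⟨b, hb, rfl⟩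
      · omega
      · omega
      · omega
      · rw [ins_up _ _ _ hpn hb] at h2; have := key b hb; omega
    · rw [ins_last _ _ _ hpn] at h1 h2
      rcases idx_cases hpn j with rfl | rfl | hi | ⟨b, hb, rfl⟩
      · have := hsm a (by unfold up at hij; split_ifs at hij <;> omega)
        omega
      · omega
      · omega
      · rw [ins_up _ _ _ hpn hb] at h2
        have hab : a < b := up_lt.1 hij
        by_cases h3 : b < p
        · have := hsm a (by omega)
          omega
        · have h4 := cut_right (k := n - p) h (cut_symm h hp) (j := b)
          have h5 := cut_left (k := n - p) h (cut_symm h hp) (i := a)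
          have h6 := cut_left (k := n - p) h (cut_symm h hp) (i := b)
          unfold up at h1 h2
          split_ifs at h1 h2 <;> omega
    · omega
    · rw [ins_up _ _ _ hpn hc] at h1 h2
      rw [up_lt] at h1
      rcases idx_cases hpn j with rfl | rfl | hi | ⟨b, hb, rfl⟩
      · have := hp.2 a c (by unfold up at hij; split_ifs at hij <;> omega)
          (by unfold up at hjk; split_ifs at hjk <;> omega) hc
        omega
      · omega
      · omega
      · rw [ins_up _ _ _ hpn hb, up_lt] at h2
        exact h.2.2 a b c (up_lt.1 hij) (up_lt.1 hjk) hc ⟨h1, h2⟩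

lemma ins_inj {n p q : ℕ} {g h : ℕ → ℕ} (hg : Good n g) (hh : Good n h) (hp : p ≤ n) (hq : q ≤ n)
    (he : ins n p g = ins n q h) : p = q ∧ g = h := by
  have h1 : p = q := by
    have := congrFun he (n + 1)
    rwa [ins_last _ _ _ hp, ins_last _ _ _ hq] at this
  subst h1
  refine ⟨rfl, ?_⟩
  funext i
  by_cases hi : i < n
  · have := congrFun he (up p i)
    rw [ins_up _ _ _ hp hi, ins_up _ _ _ hp hi] at this
    have := congrArg (dn p) this
    rwa [dn_up, dn_up] at this
  · rw [hg.2.1 i (by omega), hh.2.1 i (by omega)]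

lemma last_cut {n : ℕ} {f : ℕ → ℕ} (h : Good (n + 1) f) : IsCut (n + 1) f (f n + 1) := by
  have h0 := h.lt (i := n) (by omega)
  have h1 := h.1 n
  refine ⟨by omega, ?_⟩
  intro i j hi hj hjn
  have hj2 := h.lt hjn
  have hjne : f j ≠ f (f n) := fun he => by have := h.inj he; omega
  rcases Nat.lt_or_ge i (f n) with hi2 | hi2
  · have := h.2.2 i (f n) j hi2 (by omega) hjn
    have hne : f i ≠ f j := fun he => by have := h.inj he; omega
    omega
  · have : i = f n := by omega
    subst this
    omega

lemma exists_ins {n : ℕ} {f : ℕ → ℕ} (h : Good (n + 2) f) (hf : f (n + 1) ≠ n + 1) :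
    ∃ p g, Good n g ∧ IsCut n g p ∧ 2 * p ≤ n ∧ f = ins n p g := by
  obtain ⟨p, hp⟩ : ∃ p, p = f (n + 1) := ⟨_, rfl⟩
  have hc := last_cut h
  rw [← hp] at hc hf
  have hp0 : p < n + 1 := by have := hc.1; omega
  have hfp : f p = n + 1 := by rw [hp, h.1]
  have hp2 : 2 * p ≤ n := by
    have := cut_right h hc (j := n + 1) (by omega) (by omega)
    rw [← hp] at this
    omega
  have hpn : p ≤ n := by omega
  -- values
  have val : ∀ a, a < n → f (up p a) ≠ p ∧ f (up p a) < n + 1 := by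
    intro a ha
    have hb := up_bd ha hpn
    have h1 : f (up p a) ≠ f (n + 1) := fun he => by have := h.inj he; omega
    have h2 : f (up p a) ≠ f p := fun he => up_ne (h.inj he)
    have h3 := h.lt (i := up p a) (by omega)
    rw [← hp] at h1
    exact ⟨h1, by omega⟩
  have hr : ∀ a, a < n → rem n p f a = dn p (f (up p a)) := by
    intro a ha; unfold rem; rw [if_neg (by omega)]
  have hg : Good n (rem n p f) := by
    refine ⟨?_, ?_, ?_⟩
    · intro i
      by_cases hi : i < n
      · have hv := val i hi
        rw [hr i hi, hr _ (dn_bd hv.2 hv.1 hpn), up_dn hv.1, h.1, dn_up]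
      · have : rem n p f i = i := by unfold rem; rw [if_pos (by omega)]
        rw [this, this]
    · intro i hi
      unfold rem; rw [if_pos (by omega)]
    · rintro i j k hij hjk hk ⟨h1, h2⟩
      rw [hr _ (by omega), hr _ hk, dn_lt (val _ (by omega)).1 (val _ (by omega)).1] at h1
      rw [hr _ (by omega), hr _ (by omega), dn_lt (val _ (by omega)).1 (val _ (by omega)).1] at h2
      have := up_bd hk hpn
      exact h.2.2 _ _ _ (up_lt.2 hij) (up_lt.2 hjk) (by omega) ⟨h1, h2⟩
  refine ⟨p, rem n p f, hg, ⟨hpn, ?_⟩, hp2, ?_⟩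
  · intro i j hi hj hjn
    rw [hr i (by omega), hr j hjn, dn_lt (val _ (by omega)).1 (val _ (by omega)).1]
    have := up_bd hjn hpn
    apply hc.2
    · unfold up; split_ifs; omega
    · unfold up; split_ifs <;> omega
    · omega
  · funext i
    rcases idx_cases hpn i with rfl | rfl | hi | ⟨a, ha, rfl⟩
    · rw [ins_p, hfp]
    · rw [ins_last _ _ _ hpn, hp]
    · rw [ins_big _ _ _ hpn hi, h.2.1 i (by omega)]
    · rw [ins_up _ _ _ hpn ha, hr a ha, up_dn (val a ha).1]

lemma ins_cut_iff {n p : ℕ} {g : ℕ → ℕ} (h : Good n g) (hp : IsCut n g p) (hp2 : 2 * p ≤ n)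
    (k : ℕ) : IsCut (n + 2) (ins n p g) k ↔
      k = 0 ∨ k = n + 2 ∨ ∃ q, k = q + 1 ∧ IsCut n g q ∧ p ≤ q ∧ q ≤ n - p := by
  have hpn : p ≤ n := hp.1
  have hG := ins_good h hp hp2
  constructor
  · intro hk
    by_cases hk0 : k = 0
    · tauto
    by_cases hkn : k = n + 2
    · tauto
    have hkle := hk.1
    right; right
    have hpk : p < k := by
      by_contra hc
      have := hk.2 0 p (by omega) (by omega) (by omega)
      rw [ins_p] at this
      have := hG.lt (i := 0) (by omega)
      omega
    have hks := cut_symm hG hk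
    have hpk2 : p < n + 2 - k := by
      by_contra hc
      have := hks.2 0 p (by omega) (by omega) (by omega)
      rw [ins_p] at this
      have := hG.lt (i := 0) (by omega)
      omega
    refine ⟨k - 1, by omega, ⟨by omega, ?_⟩, by omega, by omega⟩
    intro i j hi hj hjn
    have hb := up_bd hjn hpn
    have := hk.2 (up p i) (up p j) (by unfold up; split_ifs <;> omega)
      (by unfold up; split_ifs <;> omega) (by omega)
    rw [ins_up _ _ _ hpn (i := i) (by omega), ins_up _ _ _ hpn hjn, up_lt] at this
    exact this
  · rintro (rfl | rfl | ⟨q, rfl, hq, hpq, hqp⟩)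
    · exact zero_cut _ _
    · exact self_cut _ _
    · refine ⟨by omega, ?_⟩
      intro i j hi hj hjn
      rcases idx_cases hpn i with rfl | rfl | hi2 | ⟨a, ha, rfl⟩
      · rw [ins_p]
        have h1 := hG.lt hjn
        have : ins n i g j ≠ ins n i g i := fun he => by have := hG.inj he; omega
        rw [ins_p] at this
        omega
      · omega
      · omega
      · rw [ins_up _ _ _ hpn ha]
        have haq : a < q := by unfold up at hi; split_ifs at hi <;> omega
        rcases idx_cases hpn j with rfl | rfl | hj2 | ⟨b, hb, rfl⟩
        · omega
        · rw [ins_last _ _ _ hpn]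
          have := cut_left h hq haq
          unfold up; split_ifs <;> omega
        · omega
        · rw [ins_up _ _ _ hpn hb, up_lt]
          exact hq.2 a b haq (by unfold up at hj; split_ifs at hj <;> omega) hb

lemma ins_cuts_card {n p : ℕ} {g : ℕ → ℕ} (h : Good n g) (hp : IsCut n g p) (hp2 : 2 * p ≤ n) :
    (cuts (n + 2) (ins n p g)).card =
      ((cuts n g).filter (fun k => p ≤ k ∧ k ≤ n - p)).card + 2 := by
  have : cuts (n + 2) (ins n p g) = insert 0 (insert (n + 2)
      (((cuts n g).filter (fun k => p ≤ k ∧ k ≤ n - p)).image (· + 1))) := by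
    ext k
    rw [mem_cuts, ins_cut_iff h hp hp2]
    simp only [Finset.mem_insert, Finset.mem_image, Finset.mem_filter, mem_cuts]
    constructor
    · rintro (h | h | ⟨q, h1, h2⟩)
      · tauto
      · tauto
      · right; right; exact ⟨q, h2, h1.symm⟩
    · rintro (h | h | ⟨q, h1, h2⟩)
      · tauto
      · tauto
      · right; right; exact ⟨q, h2.symm, h1⟩
  rw [this, Finset.card_insert_of_notMem, Finset.card_insert_of_notMem,
    Finset.card_image_of_injective _ (add_left_injective 1)]
  · simp only [Finset.mem_image, Finset.mem_filter, not_exists, not_and]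
    intro x hx; omega
  · simp only [Finset.mem_insert, Finset.mem_image, Finset.mem_filter, not_or, not_exists, not_and]
    refine ⟨by omega, ?_⟩
    intro x hx; omega

lemma cuts_sym {n : ℕ} {g : ℕ → ℕ} (h : Good n g) : ∀ k ∈ cuts n g, k ≤ n ∧ n - k ∈ cuts n g := by
  intro k hk
  rw [mem_cuts] at hk
  exact ⟨hk.1, mem_cuts.2 (cut_symm h hk)⟩

lemma cuts_card_two {n : ℕ} {f : ℕ → ℕ} (h : Good (n + 1) f) :
    (cuts (n + 1) f).card = 2 ↔ f n = n := by
  constructor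
  · intro hc
    by_contra hne
    have h1 := last_cut h
    have h2 := h1.1
    have : ({0, f n + 1, n + 1} : Finset ℕ) ⊆ cuts (n + 1) f := by
      intro k hk
      simp only [Finset.mem_insert, Finset.mem_singleton] at hk
      rw [mem_cuts]
      rcases hk with rfl | rfl | rfl
      · exact zero_cut _ _
      · exact h1
      · exact self_cut _ _
    have := Finset.card_le_card this
    rw [Finset.card_insert_of_notMem, Finset.card_pair] at this
    · omega
    · omega
    · simp only [Finset.mem_insert, Finset.mem_singleton]; omega
  · intro hf
    have : cuts (n + 1) f = {0, n + 1} := by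
      ext k
      simp only [Finset.mem_insert, Finset.mem_singleton, mem_cuts]
      constructor
      · intro hk
        have := hk.1
        by_contra hc
        have h2 := hk.2 0 n (by omega) (by omega) (by omega)
        have := h.lt (i := 0) (by omega)
        omega
      · rintro (rfl | rfl)
        · exact zero_cut _ _
        · exact self_cut _ _
    rw [this, Finset.card_pair (by omega)]

/-! Extending permutations. -/

def ext {n : ℕ} (π : Equiv.Perm (Fin n)) (i : ℕ) : ℕ := if h : i < n then π ⟨i, h⟩ else i

lemma ext_fin {n : ℕ} (π : Equiv.Perm (Fin n)) (i : Fin n) : ext π i = π i := by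
  simp [ext]

lemma ext_inj {n : ℕ} : Function.Injective (ext (n := n)) := by
  intro π σ h
  ext i
  have := congrFun h i
  rwa [ext_fin, ext_fin] at this

lemma occ_zero {n : ℕ} (π : Equiv.Perm (Fin n)) :
    occ p132 π = 0 ↔ ∀ i j k : Fin n, i < j → j < k → ¬ (π i < π k ∧ π k < π j) := by
  unfold occ
  rw [Finset.card_eq_zero, Finset.filter_eq_empty_iff]
  have e0 : p132 0 = 0 := by decide
  have e1 : p132 1 = 2 := by decide
  have e2 : p132 2 = 1 := by decide
  constructor
  · rintro h i j k hij hjk ⟨h1, h2⟩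
    have h3 := h1.trans h2
    apply h (Finset.mem_univ ![i, j, k])
    constructor
    · intro a b hab
      fin_cases a <;> fin_cases b <;> simp at hab ⊢ <;> first | assumption | exact hij.trans hjk
    · intro a b
      fin_cases a <;> fin_cases b <;> simp [e0, e1, e2, h1, h2, h3, h1.le, h2.le, h3.le]
  · rintro h f - ⟨h1, h2⟩
    apply h (f 0) (f 1) (f 2) (h1 0 1 (by decide)) (h1 1 2 (by decide))
    exact ⟨(h2 0 2).1 (by decide), (h2 2 1).1 (by decide)⟩

lemma ext_good {n : ℕ} (π : Equiv.Perm (Fin n)) :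
    Good n (ext π) ↔ (∀ i, π (π i) = i) ∧ occ p132 π = 0 := by
  rw [occ_zero]
  constructor
  · rintro ⟨h1, h2, h3⟩
    refine ⟨?_, ?_⟩
    · intro i
      have := h1 i
      rw [ext_fin, ext_fin] at this
      exact Fin.ext this
    · intro i j k hij hjk
      have := h3 i j k hij hjk k.2
      rwa [ext_fin, ext_fin, ext_fin] at this
  · rintro ⟨h1, h2⟩
    refine ⟨?_, ?_, ?_⟩
    · intro i
      by_cases hi : i < n
      · have := ext_fin π ⟨i, hi⟩
        simp only at this
        rw [this, ext_fin, h1]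
      · simp [ext, hi]
    · intro i hi
      simp [ext, hi]
    · intro i j k hij hjk hk
      have := h2 ⟨i, by omega⟩ ⟨j, by omega⟩ ⟨k, hk⟩ hij hjk
      simp only [ext, hk, show j < n by omega, show i < n by omega, dif_pos]
      exact this

lemma ext_surj {n : ℕ} {f : ℕ → ℕ} (h : Good n f) : ∃ π : Equiv.Perm (Fin n), ext π = f := by
  refine ⟨⟨fun i => ⟨f i, h.lt i.2⟩, fun i => ⟨f i, h.lt i.2⟩, ?_, ?_⟩, ?_⟩
  · intro i; simp [h.1]
  · intro i; simp [h.1]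
  · funext i
    by_cases hi : i < n
    · simp [ext, hi]
    · simp [ext, hi, h.2.1 i (by omega)]

lemma good_finite (n : ℕ) : {f | Good n f}.Finite := by
  apply (Set.finite_range (ext (n := n))).subset
  intro f hf
  exact ext_surj hf

lemma ext_rlmax {n : ℕ} (π : Equiv.Perm (Fin n)) (h : Good n (ext π)) :
    (cuts n (ext π)).card = rlMaxCount π + 1 := by
  have : cuts n (ext π) = insert 0 ((Finset.univ.filter
      (fun j : Fin n => ∀ i : Fin n, j < i → π i < π j)).image (fun j : Fin n => (j : ℕ) + 1)) := by
    ext k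
    simp only [mem_cuts, Finset.mem_insert, Finset.mem_image, Finset.mem_filter,
      Finset.mem_univ, true_and]
    constructor
    · intro hk
      have hkn := hk.1
      by_cases hk0 : k = 0
      · tauto
      right
      refine ⟨⟨k - 1, by omega⟩, ?_, by simp; omega⟩
      intro i hi
      have hi' : k - 1 < (i : ℕ) := hi
      have := hk.2 (k - 1) i (by omega) (by omega) i.2
      rw [ext_fin] at this
      simp only [ext, show k - 1 < n by omega, dif_pos] at this
      exact this
    · rintro (rfl | ⟨j, hj, rfl⟩)
      · exact zero_cut _ _
      · refine ⟨j.2, ?_⟩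
        intro i l hi hl hln
        have h1 := hj ⟨l, hln⟩ (by rw [Fin.lt_def]; simp; omega)
        have h1' : ext π l < ext π j := by
          have := ext_fin π ⟨l, hln⟩
          simp only at this
          rw [this, ext_fin]; exact h1
        rcases Nat.lt_or_ge i j with hij | hij
        · have := h.2.2 i j l hij (by omega) hln
          have hne : ext π i ≠ ext π l := fun he => by have := h.inj he; omega
          omega
        · have : i = j := by omega
          rw [this]; exact h1'
  rw [this, Finset.card_insert_of_notMem, Finset.card_image_of_injective]
  · rfl
  · intro a b hab
    simp only at hab
    exact Fin.ext (by omega)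
  · simp

noncomputable def cnt (n s : ℕ) : ℕ := {f | Good n f ∧ (cuts n f).card = s + 1}.ncard

lemma bridge (n s : ℕ) : (Finset.univ.filter (fun π : Equiv.Perm (Fin n) =>
      (∀ i, π (π i) = i) ∧ occ p132 π = 0 ∧ rlMaxCount π = s)).card = cnt n s := by
  classical
  unfold cnt
  rw [← Finset.card_image_of_injective _ (ext_inj (n := n)), ← Set.ncard_coe_finset]
  congr 1
  ext f
  simp only [Finset.coe_image, Set.mem_image, Finset.coe_filter, Finset.mem_univ, true_and,
    Set.mem_ofPred_eq]
  constructor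
  · rintro ⟨π, ⟨h1, h2, h3⟩, rfl⟩
    have hg := (ext_good π).2 ⟨h1, h2⟩
    exact ⟨hg, by rw [ext_rlmax π hg, h3]⟩
  · rintro ⟨hg, h3⟩
    obtain ⟨π, rfl⟩ := ext_surj hg
    have := (ext_good π).1 hg
    rw [ext_rlmax π hg] at h3
    exact ⟨π, ⟨this.1, this.2, by omega⟩, rfl⟩

noncomputable def cntB (n r : ℕ) : ℕ :=
  {f | Good n f ∧ ∃ c, (cuts n f).card = r + 2 * c}.ncard

lemma cnt_eq_cntB (n r : ℕ) (hr : 1 ≤ r) : cnt (n + 2) (r + 1) = cntB n r := by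
  unfold cnt cntB
  symm
  have hex : ∀ g, (Good n g ∧ ∃ c, (cuts n g).card = r + 2 * c) →
      ∃ p, p ∈ cuts n g ∧ 2 * p ≤ n ∧
        ((cuts n g).filter (fun k => p ≤ k ∧ k ≤ n - p)).card = r := by
    rintro g ⟨hg, c, hc⟩
    exact sym_exists n r hr c _ hc (cuts_sym hg)
  choose! P hP using hex
  apply Set.ncard_congr (fun g _ => ins n (P g) g)
  · intro g hg
    obtain ⟨h1, h2, h3⟩ := hP g hg
    rw [mem_cuts] at h1
    refine ⟨ins_good hg.1 h1 h2, ?_⟩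
    rw [ins_cuts_card hg.1 h1 h2, h3]
  · intro g g' hg hg' he
    obtain ⟨h1, h2, h3⟩ := hP g hg
    obtain ⟨h1', h2', h3'⟩ := hP g' hg'
    exact (ins_inj hg.1 hg'.1 (by omega) (by omega) he).2
  · rintro f ⟨hf, hc⟩
    have hne : f (n + 1) ≠ n + 1 := by
      intro he
      have : (cuts (n + 2) f).card = 2 := (cuts_card_two hf).2 he
      omega
    obtain ⟨p, g, hg, hp, hp2, rfl⟩ := exists_ins hf hne
    rw [ins_cuts_card hg hp hp2] at hc
    have hm : Good n g ∧ ∃ c, (cuts n g).card = r + 2 * c := by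
      refine ⟨hg, ?_⟩
      obtain ⟨c, hc'⟩ := sym_parity n _ (cuts_sym hg) p hp2
      exact ⟨c, by omega⟩
    refine ⟨g, hm, ?_⟩
    obtain ⟨h1, h2, h3⟩ := hP g hm
    have : P g = p := by
      rcases Nat.lt_trichotomy (P g) p with hlt | heq | hlt
      · have := sym_unique n _ _ _ h1 h2 hlt; omega
      · exact heq
      · have := sym_unique n _ _ _ (mem_cuts.2 hp) hp2 hlt; omega
    simp only [this]

lemma cntB_rec (n r : ℕ) : cntB n (r + 1) = cnt n r + cntB n (r + 3) := by
  unfold cntB cnt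
  rw [← Set.ncard_union_eq ?_ ((good_finite n).subset (fun f hf => hf.1))
    ((good_finite n).subset (fun f hf => hf.1))]
  · congr 1
    ext f
    simp only [Set.mem_ofPred_eq, Set.mem_union]
    constructor
    · rintro ⟨h, c, hc⟩
      cases c with
      | zero => left; exact ⟨h, by omega⟩
      | succ c => right; exact ⟨h, c, by omega⟩
    · rintro (⟨h, hc⟩ | ⟨h, c, hc⟩)
      · exact ⟨h, 0, by omega⟩
      · exact ⟨h, c + 1, by omega⟩
  · rw [Set.disjoint_left]
    rintro f ⟨h, hc⟩ ⟨h', c, hc'⟩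
    omega

lemma cnt_rec (n s : ℕ) : cnt (n + 2) (s + 2) = cnt n s + cnt (n + 2) (s + 4) := by
  rw [cnt_eq_cntB n (s + 1) (by omega), cntB_rec, cnt_eq_cntB n (s + 3) (by omega)]

lemma cuts_pos (n : ℕ) (f : ℕ → ℕ) : 1 ≤ (cuts n f).card := by
  rw [Nat.succ_le_iff, Finset.card_pos]
  exact ⟨0, mem_cuts.2 (zero_cut n f)⟩

lemma good_succ (n : ℕ) (f : ℕ → ℕ) : Good n f ↔ Good (n + 1) f ∧ f n = n := by
  constructor
  · intro h
    refine ⟨⟨h.1, fun i hi => h.2.1 i (by omega), ?_⟩, h.2.1 n le_rfl⟩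
    intro i j k hij hjk hk
    rcases Nat.lt_or_ge k n with hk2 | hk2
    · exact h.2.2 i j k hij hjk hk2
    · have := h.2.1 k hk2
      have := h.lt (i := j) (by omega)
      omega
  · rintro ⟨h, hn⟩
    refine ⟨h.1, ?_, fun i j k hij hjk hk => h.2.2 i j k hij hjk (by omega)⟩
    intro i hi
    rcases Nat.lt_or_ge n i with h2 | h2
    · exact h.2.1 i h2
    · have : i = n := by omega
      rw [this, hn]

lemma cnt_one (n : ℕ) : cnt (n + 1) 1 = cnt (n + 2) 2 + cnt (n + 2) 3 := by
  rw [cnt_eq_cntB n 1 le_rfl, cnt_eq_cntB n 2 (by omega)]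
  unfold cnt cntB
  rw [← Set.ncard_union_eq ?_ ((good_finite n).subset (fun f hf => hf.1))
    ((good_finite n).subset (fun f hf => hf.1))]
  · congr 1
    ext f
    simp only [Set.mem_ofPred_eq, Set.mem_union]
    constructor
    · rintro ⟨h, hc⟩
      have hg := (good_succ n f).2 ⟨h, (cuts_card_two h).1 hc⟩
      have := cuts_pos n f
      rcases Nat.even_or_odd' (cuts n f).card with ⟨c, hc | hc⟩
      · right; exact ⟨hg, c - 1, by omega⟩
      · left; exact ⟨hg, c, by omega⟩
    · intro h
      have hg : Good n f := by tauto
      have := (good_succ n f).1 hg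
      exact ⟨this.1, (cuts_card_two this.1).2 this.2⟩
  · rw [Set.disjoint_left]
    rintro f ⟨h, c, hc⟩ ⟨h', c', hc'⟩
    omega

lemma cnt_big (n s : ℕ) (h : n < s) : cnt n s = 0 := by
  unfold cnt
  convert Set.ncard_empty (ℕ → ℕ)
  ext f
  simp only [Set.mem_ofPred_eq, Set.mem_empty_iff_false, iff_false, not_and]
  intro _ hc
  have : (cuts n f).card ≤ (Finset.range (n + 1)).card := by
    apply Finset.card_le_card
    intro k hk
    rw [mem_cuts] at hk
    have := hk.1
    simp only [Finset.mem_range]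
    omega
  simp at this
  omega

lemma cnt_zero (n : ℕ) : cnt (n + 1) 0 = 0 := by
  unfold cnt
  convert Set.ncard_empty (ℕ → ℕ)
  ext f
  simp only [Set.mem_ofPred_eq, Set.mem_empty_iff_false, iff_false, not_and]
  intro _ hc
  have : ({0, n + 1} : Finset ℕ) ⊆ cuts (n + 1) f := by
    intro k hk
    simp only [Finset.mem_insert, Finset.mem_singleton] at hk
    rw [mem_cuts]
    rcases hk with rfl | rfl
    · exact zero_cut _ _
    · exact self_cut _ _
  have := Finset.card_le_card this
  rw [Finset.card_pair (by omega)] at this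
  omega

lemma cnt_zero_zero : cnt 0 0 = 1 := by
  rw [← bridge]
  decide

/-- Closed form. -/
def Closed (n s : ℕ) : Prop :=
  (∀ m a, n = 2 * m + 1 → s = 2 * a → cnt n s = 0) ∧
  (∀ m a, n = 2 * m + 2 → s = 2 * a → s ≤ n →
    (cnt n s : ℤ) = Nat.choose (n - 1 - a) m - Nat.choose (n - 1 - a) (m + 1)) ∧
  (∀ a, s = 2 * a + 1 → s ≤ n → cnt n s = Nat.choose (n - 1 - a) (n / 2))

lemma closed_step (n : ℕ) (h : ∀ s, Closed n s) : ∀ d s, n + 2 < s + d → Closed (n + 2) (s + 2) := by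
  intro d
  induction d using Nat.strong_induction_on with
  | _ d ih =>
  intro s hd
  have hrec := cnt_rec n s
  by_cases hbig : n < s
  · have := cnt_big (n + 2) (s + 2) (by omega)
    exact ⟨fun _ _ _ _ => this, fun _ _ _ _ _ => by omega, fun _ _ _ => by omega⟩
  have hI : Closed (n + 2) (s + 4) := ih (d - 1) (by omega) (s + 2) (by omega)
  have hn := h s
  refine ⟨?_, ?_, ?_⟩
  · intro m a hm ha
    rw [hrec, hn.1 (m - 1) (a - 1) (by omega) (by omega), hI.1 m (a + 1) hm (by omega)]
  · intro m a hm ha hs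
    rw [hrec]
    push_cast
    obtain ⟨b, rfl⟩ : ∃ b, a = b + 1 := ⟨a - 1, by omega⟩
    have hnm : n = 2 * m := by omega
    have hsb : s = 2 * b := by omega
    subst hnm hsb
    rcases Nat.eq_zero_or_pos m with rfl | hm0
    · obtain rfl : b = 0 := by omega
      rw [cnt_big (0 + 2) _ (by omega)]
      simp [cnt_zero_zero]
    obtain ⟨m, rfl⟩ : ∃ k, m = k + 1 := ⟨m - 1, by omega⟩
    rw [hn.2.1 m b (by omega) rfl (by omega)]
    by_cases hlast : b = m + 1
    · subst hlast
      rw [cnt_big (2 * (m + 1) + 2) _ (by omega)]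
      have e1 : 2 * (m + 1) - 1 - (m + 1) = m := by omega
      have e2 : 2 * (m + 1) + 1 - (m + 1 + 1) = m + 1 := by omega
      rw [e1, e2]
      simp
    · rw [hI.2.1 (m + 1) (b + 2) (by omega) (by omega) (by omega)]
      obtain ⟨q, hq⟩ : ∃ q, 2 * m + 1 - b = q + 1 := ⟨2 * m - b, by omega⟩
      have e1 : 2 * (m + 1) - 1 - b = q + 1 := by omega
      have e2 : 2 * (m + 1) + 2 - 1 - (b + 2) = q + 1 := by omega
      have e3 : 2 * (m + 1) + 1 - (b + 1) = q + 2 := by omega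
      rw [e1, e2, e3, Nat.choose_succ_succ (q + 1) m, Nat.choose_succ_succ (q + 1) (m + 1)]
      push_cast
      simp only [Nat.succ_eq_add_one]
      ring
  · intro a ha hs
    rw [hrec]
    obtain ⟨b, rfl⟩ : ∃ b, a = b + 1 := ⟨a - 1, by omega⟩
    have hsb : s = 2 * b + 1 := by omega
    subst hsb
    rw [hn.2.2 b rfl (by omega)]
    by_cases hlast : 2 * b + 1 + 4 ≤ n + 2
    · rw [hI.2.2 (b + 2) (by omega) hlast]
      have e1 : n - 1 - b = (n + 2 - 1 - (b + 2)) := by omega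
      have e2 : n + 2 - 1 - (b + 1) = (n + 2 - 1 - (b + 2)) + 1 := by omega
      have e3 : (n + 2) / 2 = n / 2 + 1 := by omega
      rw [e1, e2, e3, Nat.choose_succ_succ]
    · rw [cnt_big (n + 2) _ (by omega)]
      have e1 : n - 1 - b = n / 2 := by omega
      have e2 : n + 2 - 1 - (b + 1) = (n + 2) / 2 := by omega
      rw [e1, e2]
      simp

lemma closed_zero (s : ℕ) : Closed 0 s :=
  ⟨fun _ _ _ => by omega, fun _ _ _ => by omega, fun _ _ _ => by omega⟩

lemma closed_s0 (n : ℕ) : Closed (n + 1) 0 := by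
  refine ⟨fun _ _ _ _ => cnt_zero n, ?_, fun _ _ => by omega⟩
  intro m a hm ha _
  obtain rfl : a = 0 := by omega
  obtain rfl : n = 2 * m + 1 := by omega
  rw [cnt_zero]
  have : (2 * m + 1).choose (m + 1) = (2 * m + 1).choose m := Nat.choose_symm_half m
  have e : 2 * m + 1 + 1 - 1 - 0 = 2 * m + 1 := by omega
  rw [e, this]
  simp

lemma closed_s1 (n : ℕ) (h : ∀ s, Closed n s) : Closed (n + 1) 1 := by
  refine ⟨fun _ _ _ => by omega, fun _ _ _ => by omega, ?_⟩
  intro a ha _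
  obtain rfl : a = 0 := by omega
  have h2 := closed_step n h (n + 3) 0 (by omega)
  have h3 := closed_step n h (n + 3) 1 (by omega)
  have hc := cnt_one n
  rcases Nat.even_or_odd' n with ⟨m, rfl | rfl⟩
  · have a2 := h2.2.1 m 1 rfl rfl (by omega)
    rcases Nat.eq_zero_or_pos m with rfl | hm
    · have := cnt_big 2 3 (by omega)
      simp at a2 hc ⊢
      omega
    have a3 := h3.2.2 1 rfl (by omega)
    have e1 : 2 * m + 2 - 1 - 1 = 2 * m := by omega
    have e2 : (2 * m + 2) / 2 = m + 1 := by omega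
    have e3 : 2 * m + 1 - 1 - 0 = 2 * m := by omega
    have e4 : (2 * m + 1) / 2 = m := by omega
    rw [e1] at a2 a3
    rw [e2] at a3
    rw [e3, e4]
    simp only [Nat.zero_add, Nat.reduceAdd] at a2 a3
    omega
  · have a2 := h2.1 (m + 1) 1 (by omega) rfl
    have a3 := h3.2.2 1 rfl (by omega)
    have e1 : 2 * m + 1 + 2 - 1 - 1 = 2 * m + 1 := by omega
    have e2 : (2 * m + 1 + 2) / 2 = m + 1 := by omega
    have e3 : 2 * m + 1 + 1 - 1 - 0 = 2 * m + 1 := by omega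
    have e4 : (2 * m + 1 + 1) / 2 = m + 1 := by omega
    rw [e1, e2] at a3
    rw [e3, e4]
    simp only [Nat.zero_add, Nat.reduceAdd] at a2 a3
    omega

lemma closed_all (n : ℕ) : ∀ s, Closed n s := by
  induction n using Nat.strong_induction_on with
  | _ n ih =>
  intro s
  rcases n with _ | n
  · exact closed_zero s
  rcases s with _ | _ | s
  · exact closed_s0 n
  · exact closed_s1 n (ih n (by omega))
  · rcases n with _ | n
    · have := cnt_big 1 (s + 2) (by omega)
      exact ⟨fun _ _ _ _ => this, fun _ _ _ _ _ => by omega, fun _ _ _ => by omega⟩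
    · exact closed_step n (ih n (by omega)) (n + 3) s (by omega)

end Inv132

/-- The number of 132-avoiding involutions of length n with exactly s
right-to-left maxima (1 ≤ s ≤ n). -/
theorem involutions_avoiding_132_rlmax (n s : ℕ) (hn : 1 ≤ n) (hs1 : 1 ≤ s) (hsn : s ≤ n)
    (N : ℕ)
    (hN : N = (Finset.univ.filter (fun π : Equiv.Perm (Fin n) =>
      (∀ i, π (π i) = i) ∧ occ p132 π = 0 ∧ rlMaxCount π = s)).card) :
    (Odd n → Even s → N = 0) ∧
    (Even n → Even s →
      (N : ℤ) = Nat.choose (n - 1 - s / 2) (n / 2 - 1) - Nat.choose (n - 1 - s / 2) (n / 2)) ∧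
    (Odd s → N = Nat.choose (n - 1 - (s - 1) / 2) (n / 2)) := by
  rw [Inv132.bridge] at hN
  subst hN
  have h := Inv132.closed_all n s
  refine ⟨?_, ?_, ?_⟩
  · rintro ⟨m, hm⟩ ⟨a, ha⟩
    exact h.1 m a hm (by omega)
  · rintro ⟨m, hm⟩ ⟨a, ha⟩
    rw [h.2.1 (m - 1) a (by omega) (by omega) hsn]
    have e1 : s / 2 = a := by omega
    have e2 : n / 2 - 1 = m - 1 := by omega
    have e3 : n / 2 = m - 1 + 1 := by omega
    rw [e1, e2, e3]
  · rintro ⟨a, ha⟩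
    rw [h.2.2 a ha hsn]
    have e1 : (s - 1) / 2 = a := by omega
    rw [e1]
end

section
/- For every k ≥ 1 and every l with 0 ≤ l < k, the number of involutions of length 2k avoiding the pattern 132 and having exactly 2l+1 right-to-left maxima equals the number of involutions of length 2k+1 avoiding 132 and having exactly 2l+3 right-to-left maxima. -/
open Finset

namespace RLB

def SupN (n : ℕ) (f : Equiv.Perm ℕ) : Prop := ∀ i, n ≤ i → f i = i
def AvF (f : Equiv.Perm ℕ) : Prop :=
  ∀ i j k, i < j → j < k → f i < f k → f k < f j → False
def RLn (n : ℕ) (f : Equiv.Perm ℕ) : ℕ :=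
  ((range n).filter (fun j => ∀ i < n, j < i → f i < f j)).card
def SA (n : ℕ) : Set (Equiv.Perm ℕ) := {f | SupN n f ∧ AvF f}
def STT (n : ℕ) : Set (Equiv.Perm ℕ) := {f | SupN n f ∧ (∀ i, f (f i) = i) ∧ AvF f}
def SI (n r : ℕ) : Set (Equiv.Perm ℕ) :=
  {f | SupN n f ∧ (∀ i, f (f i) = i) ∧ AvF f ∧ RLn n f = r}

theorem SupN.lt {n : ℕ} {f : Equiv.Perm ℕ} (h : SupN n f) {i : ℕ} (hi : i < n) : f i < n := by
  by_contra hc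
  have := h (f i) (by omega)
  have := f.injective this
  omega

theorem SupN.symm {n : ℕ} {f : Equiv.Perm ℕ} (h : SupN n f) : SupN n f.symm := by
  intro i hi
  rw [Equiv.symm_apply_eq, h i hi]

theorem finite_sup (n : ℕ) : {f | SupN n f}.Finite := by
  have e := (Equiv.Perm.subtypeEquivSubtypePerm (fun i : ℕ => i < n))
  have : Finite {i : ℕ // i < n} := Finite.of_equiv (Fin n) Fin.equivSubtype
  have h := Finite.of_equiv _ e
  rw [← Set.finite_coe_iff]
  refine Finite.of_injective (fun f : {f | SupN n f} =>
    (⟨f.1, fun a ha => f.2 a (by omega)⟩ : {f : Equiv.Perm ℕ // ∀ a, ¬ a < n → f a = a})) ?_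
  intro a b h
  simpa [Subtype.ext_iff] using h

instance (n : ℕ) : Finite (SA n) := ((finite_sup n).subset (fun _ h => h.1)).to_subtype
instance (n : ℕ) : Finite (STT n) := ((finite_sup n).subset (fun _ h => h.1)).to_subtype
instance (n r : ℕ) : Finite (SI n r) := ((finite_sup n).subset (fun _ h => h.1)).to_subtype

/-- structural splitting around the position of the maximum -/
theorem split_max {n a : ℕ} {f : Equiv.Perm ℕ} (hs : SupN (n + 1) f) (hv : AvF f)
    (ha : f a = n) : a ≤ n ∧ (∀ i < a, n - a ≤ f i ∧ f i < n) ∧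
      (∀ i, a < i → i ≤ n → f i < n - a) := by
  have han : a ≤ n := by
    by_contra hc
    have := hs a (by omega)
    omega
  have hlt : ∀ i, i ≤ n → i ≠ a → f i < n := by
    intro i hi hia
    have h1 := hs.lt (i := i) (by omega)
    have h2 : f i ≠ n := fun h => hia (f.injective (h.trans ha.symm))
    omega
  have key : ∀ i < a, ∀ j, a < j → j ≤ n → f j < f i := by
    intro i hi j hj hjn
    by_contra hc
    have h1 : f i ≠ f j := fun h => by have := f.injective h; omega
    exact hv i a j hi hj (by omega) (by have := hlt j hjn (by omega); omega)
  refine ⟨han, fun i hi => ⟨?_, hlt i (by omega) (by omega)⟩, ?_⟩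
  · have : ((Ioc a n).image f).card ≤ (range (f i)).card := by
      apply card_le_card
      intro x hx
      simp only [mem_image, mem_Ioc, mem_range] at hx ⊢
      obtain ⟨j, hj, rfl⟩ := hx
      exact key i hi j hj.1 hj.2
    rw [card_image_of_injective _ f.injective] at this
    simpa using this
  · intro j hj hjn
    have : ((Iic a).image f).card ≤ (Ioc (f j) n).card := by
      apply card_le_card
      intro x hx
      simp only [mem_image, mem_Iic, mem_Ioc] at hx ⊢
      obtain ⟨i, hi, rfl⟩ := hx
      rcases Nat.lt_or_ge i a with h | h
      · exact ⟨key i h j hj hjn, (hlt i (by omega) (by omega)).le⟩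
      · have : i = a := by omega
        subst this
        have := hlt j hjn (by omega)
        omega
    rw [card_image_of_injective _ f.injective] at this
    simp at this
    have := hlt j hjn (by omega)
    omega

/-- restriction to a block -/
theorem exists_block (f : Equiv.Perm ℕ) (p q s : ℕ)
    (h : ∀ i, (p ≤ i ∧ i < p + s) ↔ (q ≤ f i ∧ f i < q + s)) :
    ∃ g : Equiv.Perm ℕ, SupN s g ∧ ∀ i < s, f (p + i) = q + g i := by
  have h2 : ∀ v, (q ≤ v ∧ v < q + s) ↔ (p ≤ f.symm v ∧ f.symm v < p + s) := by
    intro v; rw [h]; simp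
  refine ⟨⟨fun i => if i < s then f (p + i) - q else i,
    fun v => if v < s then f.symm (q + v) - p else v, ?_, ?_⟩, ?_, ?_⟩
  · intro i
    by_cases hi : i < s
    · have h1 := (h (p + i)).1 (by omega)
      have : f (p + i) - q < s := by omega
      have h3 : q + (f (p + i) - q) = f (p + i) := by omega
      simp [hi, this, h3]
    · simp [hi]
  · intro i
    by_cases hi : i < s
    · have h1 := (h2 (q + i)).1 (by omega)
      have : f.symm (q + i) - p < s := by omega
      have h3 : p + (f.symm (q + i) - p) = f.symm (q + i) := by omega
      simp [hi, this, h3]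
    · simp [hi]
  · intro i hi
    simp [hi]
  · intro i hi
    have h1 := (h (p + i)).1 (by omega)
    simp [hi]; omega

theorem AvF_block {f g : Equiv.Perm ℕ} {p q s : ℕ} (hf : AvF f) (hs : SupN s g)
    (h : ∀ i < s, f (p + i) = q + g i) : AvF g := by
  intro i j k hij hjk h1 h2
  by_cases hk : k < s
  · refine hf (p + i) (p + j) (p + k) (by omega) (by omega) ?_ ?_ <;>
    rw [h _ (by omega), h _ (by omega)] <;> omega
  · have := hs k (by omega)
    by_cases hj : j < s
    · have := hs.lt hj; omega
    · have := hs j (by omega); omega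

theorem AvF_iff {n : ℕ} {f : Equiv.Perm ℕ} (hs : SupN n f) : AvF f ↔
    ∀ i j k, i < j → j < k → k < n → f i < f k → f k < f j → False := by
  constructor
  · intro h i j k h1 h2 _; exact h i j k h1 h2
  · intro h i j k hij hjk h1 h2
    by_cases hk : k < n
    · exact h i j k hij hjk hk h1 h2
    · have := hs k (by omega)
      by_cases hj : j < n
      · have := hs.lt hj; omega
      · have := hs j (by omega); omega

/-- combination for 132-avoiders -/
theorem exists_comb (a b : ℕ) (α β : Equiv.Perm ℕ) (hα : SupN a α) (hβ : SupN b β) :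
    ∃ f : Equiv.Perm ℕ, SupN (a + b + 1) f ∧ (∀ i < a, f i = b + α i) ∧ f a = a + b ∧
      (∀ i < b, f (a + 1 + i) = β i) := by
  have A1 : ∀ i < a, α i < a := fun i => hα.lt
  have A2 : ∀ i < a, α.symm i < a := fun i => hα.symm.lt
  have B1 : ∀ i < b, β i < b := fun i => hβ.lt
  have B2 : ∀ i < b, β.symm i < b := fun i => hβ.symm.lt
  refine ⟨⟨fun i => if i < a then b + α i else if i = a then a + b else
      if i < a + b + 1 then β (i - (a + 1)) else i,
    fun v => if v < b then β.symm v + (a + 1) else if v < a + b then α.symm (v - b) else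
      if v = a + b then a else v, ?_, ?_⟩, ?_, ?_, ?_, ?_⟩
  · intro i
    by_cases h1 : i < a
    · have := A1 i h1
      simp [h1]; omega
    by_cases h2 : i = a
    · simp [h2]
    by_cases h3 : i < a + b + 1
    · have := B1 (i - (a + 1)) (by omega)
      simp [h1, h2, h3, this]; omega
    · simp [h1, h2, h3]; grind
  · intro v
    by_cases h1 : v < b
    · have := B2 v h1
      simp [h1]; grind
    by_cases h2 : v < a + b
    · have := A2 (v - b) (by omega)
      simp [h1, h2, this]; omega
    by_cases h3 : v = a + b
    · simp [h3]
    · simp [h1, h2, h3]; grind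
  · intro i hi; simp; grind
  · intro i hi; simp [hi]
  · simp
  · intro i hi; simp; grind

theorem comb_mem {a b : ℕ} {α β f : Equiv.Perm ℕ} (hα : SupN a α) (hβ : SupN b β)
    (hvα : AvF α) (hvβ : AvF β) (hs : SupN (a + b + 1) f) (h1 : ∀ i < a, f i = b + α i)
    (h2 : f a = a + b) (h3 : ∀ i < b, f (a + 1 + i) = β i) : AvF f := by
  rw [AvF_iff hs]
  intro i j k hij hjk hk hik hkj
  have A1 : ∀ i < a, α i < a := fun i => hα.lt
  have B1 : ∀ i < b, β i < b := fun i => hβ.lt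
  have h3' : ∀ i, a < i → i < a + b + 1 → f i = β (i - (a + 1)) ∧ f i < b := by
    intro i hi hi'
    have := h3 (i - (a + 1)) (by omega)
    rw [show a + 1 + (i - (a + 1)) = i by omega] at this
    rw [this]
    exact ⟨rfl, B1 _ (by omega)⟩
  have h1' : ∀ i < a, f i = b + α i ∧ α i < a := fun i hi => ⟨h1 i hi, A1 i hi⟩
  rcases lt_trichotomy k a with hka | hka | hka
  · have := h1' i (by omega)
    have := h1' j (by omega)
    have := h1' k (by omega)
    exact hvα i j k hij hjk (by omega) (by omega)
  · subst hka
    have := h1' j (by omega)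
    omega
  · have hk3 := h3' k hka hk
    rcases lt_trichotomy i a with hia | hia | hia
    · have := h1' i hia
      omega
    · subst hia; omega
    · have := h3' i hia (by omega)
      have := h3' j (by omega) (by omega)
      exact hvβ (i - (a + 1)) (j - (a + 1)) (k - (a + 1)) (by omega) (by omega)
        (by omega) (by omega)

theorem SupN.ext {s : ℕ} {f g : Equiv.Perm ℕ} (hf : SupN s f) (hg : SupN s g)
    (h : ∀ i < s, f i = g i) : f = g := by
  ext i
  by_cases hi : i < s
  · exact h i hi
  · rw [hf i (by omega), hg i (by omega)]

theorem card_SA_succ (n : ℕ) : Nat.card (SA (n + 1)) =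
    ∑ p ∈ antidiagonal n, Nat.card (SA p.1) * Nat.card (SA p.2) := by
  have key : ∀ x : (Σ p : antidiagonal n, SA p.1.1 × SA p.1.2), ∃ f : SA (n + 1),
      (∀ i < x.1.1.1, f.1 i = x.1.1.2 + x.2.1.1 i) ∧ f.1 x.1.1.1 = n ∧
      (∀ i < x.1.1.2, f.1 (x.1.1.1 + 1 + i) = x.2.2.1 i) := by
    rintro ⟨⟨⟨a, b⟩, hab⟩, ⟨α, hα⟩, ⟨β, hβ⟩⟩
    obtain ⟨f, hs, h1, h2, h3⟩ := exists_comb a b α β hα.1 hβ.1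
    have hab : a + b = n := by simpa using hab
    subst hab
    exact ⟨⟨f, hs, comb_mem hα.1 hβ.1 hα.2 hβ.2 hs h1 h2 h3⟩, h1, h2, h3⟩
  choose F hF using key
  have hbij : Function.Bijective F := by
    constructor
    · intro x y hxy
      have hx := hF x
      have hy := hF y
      rw [← hxy] at hy
      clear hF
      generalize F x = f at hx hy
      clear hxy F
      obtain ⟨⟨⟨a, b⟩, hab⟩, ⟨α, hα⟩, ⟨β, hβ⟩⟩ := x
      obtain ⟨⟨⟨a', b'⟩, hab'⟩, ⟨α', hα'⟩, ⟨β', hβ'⟩⟩ := y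
      have h1 : a + b = n := by simpa using hab
      have h2 : a' + b' = n := by simpa using hab'
      have haa : a = a' := f.1.injective (hx.2.1.trans hy.2.1.symm)
      subst haa
      have hbb : b = b' := by omega
      subst hbb
      have e1 : α = α' := hα.1.ext hα'.1 (by
        intro i hi
        have := hx.1 i hi
        have := hy.1 i hi
        simp only at *
        omega)
      have e2 : β = β' := hβ.1.ext hβ'.1 (by
        intro i hi
        have := hx.2.2 i hi
        have := hy.2.2 i hi
        simp only at *
        omega)
      subst e1 e2
      rfl
    · rintro ⟨f, hs, hv⟩
      obtain ⟨a, ha⟩ := f.surjective n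
      obtain ⟨han, hl, hr⟩ := split_max hs hv ha
      have hout : ∀ i, n < i → f i = i := fun i hi => hs i (by omega)
      obtain ⟨α, hα, hα'⟩ := exists_block f 0 (n - a) a (by
        intro i
        have := hl i
        have := hr i
        have := hout i
        constructor
        · grind
        · intro h
          by_contra hc
          rcases eq_or_ne i a with h' | h'
          · subst h'; omega
          · by_cases i ≤ n
            · have := hr i (by omega) (by omega); omega
            · have := hout i (by omega); omega)
      obtain ⟨β, hβ, hβ'⟩ := exists_block f (a + 1) 0 (n - a) (by
        intro i
        have := hl i
        have := hr i
        have := hout i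
        constructor
        · intro h
          have := hr i (by omega) (by omega); omega
        · intro h
          by_contra hc
          rcases lt_trichotomy i a with h' | h' | h'
          · have := hl i h'; omega
          · subst h'; omega
          · have := hout i (by omega); omega)
      refine ⟨⟨⟨(a, n - a), by simp; omega⟩, ⟨α, hα, AvF_block hv hα hα'⟩,
        ⟨β, hβ, AvF_block hv hβ hβ'⟩⟩, ?_⟩
      have h := hF ⟨⟨(a, n - a), by simp; omega⟩, ⟨α, hα, AvF_block hv hα hα'⟩,
        ⟨β, hβ, AvF_block hv hβ hβ'⟩⟩
      simp only at h
      apply Subtype.ext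
      apply SupN.ext (F _).2.1 hs
      intro i hi
      simp only
      rcases lt_trichotomy i a with h' | h' | h'
      · rw [h.1 i h', ← hα' i h', zero_add]
      · rw [h', h.2.1, ha]
      · have e1 := h.2.2 (i - (a + 1)) (by omega)
        have e2 := hβ' (i - (a + 1)) (by omega)
        rw [show a + 1 + (i - (a + 1)) = i by omega] at e1 e2
        rw [e1, e2, zero_add]
  rw [← Nat.card_eq_of_bijective F hbij, Nat.card_sigma]
  simp only [Nat.card_prod]
  exact Finset.sum_coe_sort (antidiagonal n) (fun p => Nat.card (SA p.1) * Nat.card (SA p.2))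

theorem card_SA_zero : Nat.card (SA 0) = 1 := by
  rw [Nat.card_eq_one_iff_unique]
  refine ⟨⟨fun a b => Subtype.ext (a.2.1.ext b.2.1 (by simp))⟩, ⟨⟨1, ?_, ?_⟩⟩⟩
  · intro i _; rfl
  · intro i j k h1 h2 h3 h4; simp at h3 h4; omega

theorem exists_inv (m s : ℕ) (L M : Equiv.Perm ℕ) (hL : SupN m L) (hM : SupN s M)
    (hi : ∀ i, M (M i) = i) :
    ∃ f : Equiv.Perm ℕ, SupN (2 * m + s + 2) f ∧ (∀ i, f (f i) = i) ∧
      (∀ i < m, f i = (m + 1 + s) + L i) ∧ f m = 2 * m + s + 1 ∧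
      (∀ i < s, f (m + 1 + i) = m + 1 + M i) ∧
      (∀ i < m, f (m + 1 + s + i) = L.symm i) ∧ f (2 * m + s + 1) = m := by
  have A1 : ∀ i < m, L i < m := fun i => hL.lt
  have A2 : ∀ i < m, L.symm i < m := fun i => hL.symm.lt
  have B1 : ∀ i < s, M i < s := fun i => hM.lt
  have hinv : Function.Involutive (fun i => if i < m then (m + 1 + s) + L i else
      if i = m then 2 * m + s + 1 else
      if i < m + 1 + s then m + 1 + M (i - (m + 1)) else
      if i < 2 * m + s + 1 then L.symm (i - (m + 1 + s)) else
      if i = 2 * m + s + 1 then m else i) := by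
    intro i
    by_cases h1 : i < m
    · have := A1 i h1
      have e1 : ¬ (m + 1 + s + L i < m) := by omega
      have e2 : ¬ (m + 1 + s + L i = m) := by omega
      have e3 : (m + 1 + s + L i < 2 * m + s + 1) := by omega
      simp [h1, e1, e2, e3]
    by_cases h2 : i = m
    · simp [h2]; grind
    by_cases h3 : i < m + 1 + s
    · have := B1 (i - (m + 1)) (by omega)
      simp [h1, h2, h3, this, hi]; grind
    by_cases h4 : i < 2 * m + s + 1
    · have := A2 (i - (m + 1 + s)) (by omega)
      simp [h1, h2, h3, h4, this]; omega
    by_cases h5 : i = 2 * m + s + 1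
    · simp [h5]; grind
    · simp [h1, h2, h3, h4, h5]
  refine ⟨hinv.toPerm _, ?_, ?_, ?_, ?_, ?_, ?_, ?_⟩
  · intro i hi; simp [Function.Involutive.toPerm]; grind
  · exact hinv
  · intro i hi; simp [Function.Involutive.toPerm, hi]
  · simp [Function.Involutive.toPerm]
  · intro i hi; simp [Function.Involutive.toPerm, hi]; grind
  · intro i hi; simp [Function.Involutive.toPerm]; grind
  · simp [Function.Involutive.toPerm]; grind

theorem RL_le (n : ℕ) (f : Equiv.Perm ℕ) : RLn n f ≤ n := by
  have := card_filter_le (range n) (fun j => ∀ i < n, j < i → f i < f j)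
  rwa [card_range] at this

theorem RL_pos (n : ℕ) (f : Equiv.Perm ℕ) : 1 ≤ RLn (n + 1) f := by
  rw [RLn, Nat.succ_le_iff, card_pos]
  exact ⟨n, by simp; intros; omega⟩

theorem RL_eq_one_iff {n : ℕ} {f : Equiv.Perm ℕ} (hs : SupN (n + 1) f)
    (hi : ∀ i, f (f i) = i) : RLn (n + 1) f = 1 ↔ f n = n := by
  constructor
  · intro h
    rw [RLn, card_eq_one] at h
    obtain ⟨x, hx⟩ := h
    have h1 : n ∈ ({x} : Finset ℕ) := by
      rw [← hx]; simp; intros; omega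
    have h2 : f n ∈ ({x} : Finset ℕ) := by
      rw [← hx]
      simp only [mem_filter, mem_range]
      refine ⟨hs.lt (by omega), fun i h3 h4 => ?_⟩
      rw [hi]
      have := hs.lt h3
      have : f i ≠ n := fun h => by rw [← h, hi] at h4; omega
      omega
    simp at h1 h2; omega
  · intro h
    rw [RLn, card_eq_one]
    refine ⟨n, ?_⟩
    ext j
    simp only [mem_filter, mem_range, mem_singleton]
    constructor
    · rintro ⟨h1, h2⟩
      by_contra hc
      have := h2 n (by omega) (by omega)
      have := hs.lt h1
      omega
    · rintro rfl
      exact ⟨by omega, by intros; omega⟩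

theorem card_SI_one (n : ℕ) : Nat.card (SI (n + 1) 1) = Nat.card (STT n) := by
  have : SI (n + 1) 1 = STT n := by
    ext f
    constructor
    · rintro ⟨h1, h2, h3, h4⟩
      rw [RL_eq_one_iff h1 h2] at h4
      refine ⟨fun i hi => ?_, h2, h3⟩
      rcases hi.eq_or_lt with h | h
      · rw [← h, h4]
      · exact h1 i h
    · rintro ⟨h1, h2, h3⟩
      have h1' : SupN (n + 1) f := fun i hi => h1 i (by omega)
      exact ⟨h1', h2, h3, (RL_eq_one_iff h1' h2).2 (h1 n le_rfl)⟩
  rw [this]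

theorem card_STT (n N : ℕ) (h : n < N) :
    Nat.card (STT n) = ∑ r ∈ range N, Nat.card (SI n r) := by
  have hb : Function.Bijective (fun x : (Σ r : Fin N, SI n r) =>
      (⟨x.2.1, x.2.2.1, x.2.2.2.1, x.2.2.2.2.1⟩ : STT n)) := by
    constructor
    · rintro ⟨⟨r, hr⟩, f, hf⟩ ⟨⟨r', hr'⟩, f', hf'⟩ he
      replace he : f = f' := congrArg Subtype.val he
      subst he
      have := hf.2.2.2
      have := hf'.2.2.2
      simp only at *
      subst r r'
      rfl
    · rintro ⟨f, h1, h2, h3⟩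
      have := RL_le n f
      exact ⟨⟨⟨RLn n f, by omega⟩, f, h1, h2, h3, rfl⟩, rfl⟩
  rw [← Nat.card_eq_of_bijective _ hb, Nat.card_sigma,
    ← Fin.sum_univ_eq_sum_range (fun r => Nat.card (SI n r))]

theorem inv_mem {m s : ℕ} {L M f : Equiv.Perm ℕ} (hL : SupN m L) (hM : SupN s M)
    (hvL : AvF L) (hvM : AvF M) (hs : SupN (2 * m + s + 2) f)
    (h1 : ∀ i < m, f i = (m + 1 + s) + L i) (h2 : f m = 2 * m + s + 1)
    (h3 : ∀ i < s, f (m + 1 + i) = m + 1 + M i)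
    (h4 : ∀ i < m, f (m + 1 + s + i) = L.symm i) (h5 : f (2 * m + s + 1) = m) :
    AvF f ∧ RLn (2 * m + s + 2) f = RLn s M + 2 := by
  have h1' : ∀ i < m, f i = (m + 1 + s) + L i ∧ L i < m := fun i hi => ⟨h1 i hi, hL.lt hi⟩
  have h3' : ∀ i, m < i → i < m + 1 + s → f i = m + 1 + M (i - (m + 1)) ∧
      M (i - (m + 1)) < s := by
    intro i hi hi'
    have := h3 (i - (m + 1)) (by omega)
    rw [show m + 1 + (i - (m + 1)) = i by omega] at this
    exact ⟨this, hM.lt (by omega)⟩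
  have h4' : ∀ i, m + 1 + s ≤ i → i < 2 * m + s + 1 → f i = L.symm (i - (m + 1 + s)) ∧
      L.symm (i - (m + 1 + s)) < m := by
    intro i hi hi'
    have := h4 (i - (m + 1 + s)) (by omega)
    rw [show m + 1 + s + (i - (m + 1 + s)) = i by omega] at this
    exact ⟨this, hL.symm.lt (by omega)⟩
  have hvL' : AvF L.symm := by
    intro i j k hij hjk hik hkj
    refine hvL (L.symm i) (L.symm k) (L.symm j) hik hkj ?_ ?_ <;> simp <;> omega
  constructor
  · rw [AvF_iff hs]
    intro i j k hij hjk hk hik hkj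
    rcases lt_trichotomy k m with hk1 | hk1 | hk1
    · have := h1' i (by omega)
      have := h1' j (by omega)
      have := h1' k (by omega)
      exact hvL i j k hij hjk (by omega) (by omega)
    · subst hk1
      have := h1' j (by omega)
      omega
    have hfk : f k < m + 1 + s := by
      by_cases hk2 : k < m + 1 + s
      · have := h3' k hk1 hk2; omega
      by_cases hk3 : k < 2 * m + s + 1
      · have := h4' k (by omega) hk3; omega
      · obtain rfl : k = 2 * m + s + 1 := by omega
        omega
    have hmi : m < i := by
      rcases lt_trichotomy i m with h | h | h
      · have := h1' i h; omega
      · subst h; omega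
      · exact h
    by_cases hk2 : k < m + 1 + s
    · have := h3' k hk1 hk2
      have := h3' i (by omega) (by omega)
      have := h3' j (by omega) (by omega)
      exact hvM (i - (m + 1)) (j - (m + 1)) (k - (m + 1)) (by omega) (by omega)
        (by omega) (by omega)
    by_cases hk3 : k < 2 * m + s + 1
    · have hk' := h4' k (by omega) hk3
      have hi' : m + 1 + s ≤ i := by
        by_contra hc
        have := h3' i hmi (by omega)
        omega
      have := h4' i (by omega) (by omega)
      have := h4' j (by omega) (by omega)
      exact hvL' (i - (m + 1 + s)) (j - (m + 1 + s)) (k - (m + 1 + s)) (by omega) (by omega)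
        (by omega) (by omega)
    · obtain rfl : k = 2 * m + s + 1 := by omega
      have hi' : m + 1 + s ≤ i := by
        by_contra hc
        have := h3' i hmi (by omega)
        omega
      have := h4' j (by omega) (by omega)
      omega
  · have hset : (range (2 * m + s + 2)).filter
        (fun j => ∀ i < 2 * m + s + 2, j < i → f i < f j) =
        insert m (insert (2 * m + s + 1) (((range s).filter
          (fun j => ∀ i < s, j < i → M i < M j)).image (fun j => m + 1 + j))) := by
      ext j
      simp only [mem_filter, mem_range, mem_insert, mem_image]
      constructor
      · rintro ⟨hj, hmax⟩
        rcases lt_trichotomy j m with hj1 | hj1 | hj1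
        · have := hmax m (by omega) hj1
          have := h1' j hj1
          omega
        · exact Or.inl hj1
        by_cases hj2 : j < m + 1 + s
        · right; right
          refine ⟨j - (m + 1), ⟨by omega, ?_⟩, by omega⟩
          intro i hi hji
          have := hmax (m + 1 + i) (by omega) (by omega)
          rw [h3 i hi, (h3' j hj1 hj2).1] at this
          omega
        by_cases hj3 : j < 2 * m + s + 1
        · have := hmax (2 * m + s + 1) (by omega) hj3
          have := h4' j (by omega) hj3
          omega
        · right; left; omega
      · rintro (rfl | rfl | ⟨j, ⟨hj, hmax⟩, rfl⟩)
        · refine ⟨by omega, fun i hi hji => ?_⟩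
          have h6 := hs.lt hi
          have : f i ≠ f j := fun h => by have := f.injective h; omega
          omega
        · exact ⟨by omega, by intros; omega⟩
        · refine ⟨by omega, fun i hi hji => ?_⟩
          rw [h3 j hj]
          by_cases hi2 : i < m + 1 + s
          · have := hmax (i - (m + 1)) (by omega) (by omega)
            have := h3' i (by omega) hi2
            omega
          by_cases hi3 : i < 2 * m + s + 1
          · have := h4' i (by omega) hi3
            omega
          · obtain rfl : i = 2 * m + s + 1 := by omega
            omega
    rw [RLn, hset, card_insert_of_notMem, card_insert_of_notMem, card_image_of_injective]
    · rfl
    · intro a b h; simpa using h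
    · simp; intros; omega
    · simp; refine ⟨by omega, fun _ _ _ => by omega⟩

theorem card_SI_add_two (n r : ℕ) : Nat.card (SI (n + 2) (r + 2)) =
    ∑ m ∈ range (n / 2 + 1), Nat.card (SA m) * Nat.card (SI (n - 2 * m) r) := by
  have key : ∀ x : (Σ m : Fin (n / 2 + 1), SA m × SI (n - 2 * m) r),
      ∃ f : SI (n + 2) (r + 2),
      (∀ i < x.1.1, f.1 i = (n + 1 - x.1.1) + x.2.1.1 i) ∧ f.1 (n + 1) = x.1.1 ∧
      (∀ i < n - 2 * x.1.1, f.1 (x.1.1 + 1 + i) = x.1.1 + 1 + x.2.2.1 i) := by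
    rintro ⟨⟨m, hm⟩, ⟨L, hL⟩, ⟨M, hM⟩⟩
    simp only at hL hM ⊢
    obtain ⟨f, hs, hi, h1, h2, h3, h4, h5⟩ :=
      exists_inv m (n - 2 * m) L M hL.1 hM.1 hM.2.1
    have := inv_mem hL.1 hM.1 hL.2 hM.2.2.1 hs h1 h2 h3 h4 h5
    have e : 2 * m + (n - 2 * m) = n := by omega
    have e' : m + 1 + (n - 2 * m) = n + 1 - m := by omega
    rw [e] at hs this h5
    rw [e'] at h1
    rw [hM.2.2.2] at this
    exact ⟨⟨f, hs, hi, this.1, this.2⟩, h1, h5, h3⟩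
  choose F hF using key
  have hbij : Function.Bijective F := by
    constructor
    · intro x y hxy
      have hx := hF x
      have hy := hF y
      rw [← hxy] at hy
      clear hF
      generalize F x = f at hx hy
      clear hxy F
      obtain ⟨⟨m, hm⟩, ⟨L, hL⟩, ⟨M, hM⟩⟩ := x
      obtain ⟨⟨m', hm'⟩, ⟨L', hL'⟩, ⟨M', hM'⟩⟩ := y
      have haa : m = m' := hx.2.1.symm.trans hy.2.1
      subst haa
      have e1 : L = L' := hL.1.ext hL'.1 (by
        intro i hi
        have := hx.1 i hi
        have := hy.1 i hi
        simp only at *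
        omega)
      have e2 : M = M' := hM.1.ext hM'.1 (by
        intro i hi
        have := hx.2.2 i hi
        have := hy.2.2 i hi
        simp only at *
        omega)
      subst e1 e2
      rfl
    · rintro ⟨f, hs, hi, hv, hr⟩
      obtain ⟨a, ha⟩ : ∃ a, f (n + 1) = a := ⟨_, rfl⟩
      have ha' : f a = n + 1 := by rw [← ha, hi]
      obtain ⟨han, hl, hrr⟩ := split_max hs hv ha'
      have hne : a ≠ n + 1 := by
        rintro rfl
        have := hr.symm.trans ((RL_eq_one_iff hs hi).2 ha)
        omega
      have hab : a < n + 1 - a := by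
        have := hrr (n + 1) (by omega) le_rfl
        omega
      have hout : ∀ i, n + 1 < i → f i = i := fun i hi => hs i (by omega)
      obtain ⟨L, hL, hL'⟩ := exists_block f 0 (n + 1 - a) a (by
        intro i
        constructor
        · intro h
          have := hl i (by omega); omega
        · intro h
          by_contra hc
          rcases eq_or_ne i a with h' | h'
          · subst h'; omega
          · by_cases i ≤ n + 1
            · have := hrr i (by omega) (by omega); omega
            · have := hout i (by omega); omega)
      have hmid : ∀ i, (a + 1 ≤ i ∧ i < a + 1 + (n - 2 * a)) →
          (a + 1 ≤ f i ∧ f i < a + 1 + (n - 2 * a)) := by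
        intro i h
        have h1 := hrr i (by omega) (by omega)
        refine ⟨?_, by omega⟩
        by_contra hc
        rcases Nat.lt_or_ge (f i) a with h' | h'
        · have := hl _ h'
          rw [hi] at this
          omega
        · have h6 : f i = a := by omega
          have := hi i
          rw [h6, ha'] at this
          omega
      obtain ⟨M, hM, hM'⟩ := exists_block f (a + 1) (a + 1) (n - 2 * a) (by
        intro i
        refine ⟨hmid i, fun h => ?_⟩
        have := hmid _ h
        rwa [hi] at this)
      have hMi : ∀ i, M (M i) = i := by
        intro i
        by_cases h : i < n - 2 * a
        · have e1 := hM' i h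
          have e2 := hM' (M i) (hM.lt h)
          rw [← e1, hi] at e2
          omega
        · rw [hM i (by omega), hM i (by omega)]
      have hvL := AvF_block hv hL hL'
      have hvM := AvF_block hv hM hM'
      have e : 2 * a + (n - 2 * a) = n := by omega
      have hRL : RLn (n - 2 * a) M = r := by
        have h := (inv_mem (f := f) hL hM hvL hvM (by rw [e]; exact hs)
          (fun i hi' => by have := hL' i hi'; rw [zero_add] at this; rw [this]; omega)
          (by rw [e]; exact ha') hM'
          (fun i hi' => by
            have h7 := hL' (L.symm i) (hL.symm.lt hi')
            rw [zero_add, Equiv.apply_symm_apply] at h7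
            rw [show a + 1 + (n - 2 * a) + i = n + 1 - a + i by omega, ← h7, hi])
          (by rw [e]; exact ha)).2
        rw [e, hr] at h
        omega
      have hlt : a < n / 2 + 1 := by omega
      refine ⟨⟨⟨a, hlt⟩, ⟨L, hL, hvL⟩, ⟨M, hM, hMi, hvM, hRL⟩⟩, ?_⟩
      have h := hF ⟨⟨a, hlt⟩, ⟨L, hL, hvL⟩, ⟨M, hM, hMi, hvM, hRL⟩⟩
      simp only at h
      have hgi := (F ⟨⟨a, hlt⟩, ⟨L, hL, hvL⟩, ⟨M, hM, hMi, hvM, hRL⟩⟩).2.2.1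
      apply Subtype.ext
      apply SupN.ext (F _).2.1 hs
      intro i hin
      simp only
      generalize (F ⟨⟨a, hlt⟩, ⟨L, hL, hvL⟩, ⟨M, hM, hMi, hvM, hRL⟩⟩).1 = g at h hgi ⊢
      have hsm : ∀ i < a, g i = f i := by
        intro i h'
        rw [h.1 i h', ← hL' i h', zero_add]
      rcases lt_trichotomy i a with h' | h' | h'
      · exact hsm i h'
      · rw [h', ← h.2.1, hgi, h.2.1, ha']
      by_cases h2 : i < n + 1 - a
      · have e1 := h.2.2 (i - (a + 1)) (by omega)
        have e2 := hM' (i - (a + 1)) (by omega)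
        rw [show a + 1 + (i - (a + 1)) = i by omega] at e1 e2
        rw [e1, e2]
      by_cases h3 : i = n + 1
      · rw [h3, h.2.1, ha]
      · have h7 := hL' (L.symm (i - (n + 1 - a))) (hL.symm.lt (by omega))
        rw [zero_add, Equiv.apply_symm_apply] at h7
        have h8 := hsm _ (hL.symm.lt (i := i - (n + 1 - a)) (by omega))
        rw [h7, show n + 1 - a + (i - (n + 1 - a)) = i by omega] at h8
        rw [show n + 1 - a + (i - (n + 1 - a)) = i by omega] at h7
        generalize L.symm (i - (n + 1 - a)) = t at *
        have h9 := hgi t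
        have h10 := hi t
        rw [h8] at h9
        rw [h7] at h10
        rw [h9, h10]
  rw [← Nat.card_eq_of_bijective F hbij, Nat.card_sigma,
    ← Fin.sum_univ_eq_sum_range (fun m => Nat.card (SA m) * Nat.card (SI (n - 2 * m) r))]
  simp only [Nat.card_prod]

theorem card_SI_zero_of (n r : ℕ) (h : n < r) : Nat.card (SI n r) = 0 := by
  have : IsEmpty (SI n r) := ⟨fun f => by
    have := RL_le n f.1
    have := f.2.2.2.2
    omega⟩
  exact Nat.card_of_isEmpty

theorem card_SI_succ_zero (n : ℕ) : Nat.card (SI (n + 1) 0) = 0 := by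
  have : IsEmpty (SI (n + 1) 0) := ⟨fun f => by
    have := RL_pos n f.1
    have := f.2.2.2.2
    omega⟩
  exact Nat.card_of_isEmpty

theorem card_STT_add_two (n : ℕ) : Nat.card (STT (n + 2)) = Nat.card (STT (n + 1)) +
    ∑ m ∈ range (n / 2 + 1), Nat.card (SA m) * Nat.card (STT (n - 2 * m)) := by
  rw [card_STT (n + 2) (n + 3) (by omega), Finset.sum_range_succ', Finset.sum_range_succ',
    card_SI_succ_zero, card_SI_one, add_zero, add_comm]
  congr 1
  simp only [card_SI_add_two]
  rw [Finset.sum_comm]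
  refine Finset.sum_congr rfl fun m hm => ?_
  rw [← Finset.mul_sum, ← card_STT _ _ (by omega)]

theorem STT_one : Nat.card (STT 1) = Nat.card (STT 0) := by
  rw [card_STT 1 2 (by omega)]
  rw [Finset.sum_range_succ, Finset.sum_range_one, card_SI_succ_zero, card_SI_one, zero_add]

open PowerSeries in
theorem odd_eq (k : ℕ) : Nat.card (STT (2 * k + 1)) =
    ∑ m ∈ range (k + 1), Nat.card (SA m) * Nat.card (STT (2 * (k - m))) := by
  let A : PowerSeries ℤ := PowerSeries.mk fun n => (Nat.card (SA n) : ℤ)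
  let E : PowerSeries ℤ := PowerSeries.mk fun n => (Nat.card (STT (2 * n)) : ℤ)
  let O : PowerSeries ℤ := PowerSeries.mk fun n => (Nat.card (STT (2 * n + 1)) : ℤ)
  have hA : A = 1 + X * (A * A) := by
    ext n
    cases n with
    | zero => simp [A, card_SA_zero, -Nat.card_coe_set_eq]
    | succ n =>
      rw [map_add, PowerSeries.coeff_succ_X_mul, PowerSeries.coeff_mul]
      simp [A, card_SA_succ, PowerSeries.coeff_one, -Nat.card_coe_set_eq]
  have hO : O = E + X * (A * O) := by
    ext n
    cases n with
    | zero => simp [O, E, STT_one, -Nat.card_coe_set_eq]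
    | succ n =>
      rw [map_add, PowerSeries.coeff_succ_X_mul, PowerSeries.coeff_mul,
        Finset.Nat.sum_antidiagonal_eq_sum_range_succ_mk]
      simp only [O, E, A, PowerSeries.coeff_mk]
      rw [show 2 * (n + 1) + 1 = (2 * n + 1) + 2 by ring, card_STT_add_two,
        show (2 * n + 1) / 2 = n by omega]
      push_cast
      congr 1
      refine Finset.sum_congr rfl fun m hm => ?_
      rw [mem_range] at hm
      rw [show 2 * n + 1 - 2 * m = 2 * (n - m) + 1 by omega]
  have hOE : O = A * E := by
    linear_combination (-O) * hA + A * hO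
  have := congrArg (PowerSeries.coeff k) hOE
  rw [PowerSeries.coeff_mul, Finset.Nat.sum_antidiagonal_eq_sum_range_succ_mk] at this
  simp only [O, E, A, PowerSeries.coeff_mk] at this
  exact_mod_cast this

theorem main_eq (l : ℕ) : ∀ k : ℕ,
    Nat.card (SI (2 * k) (2 * l + 1)) = Nat.card (SI (2 * k + 1) (2 * l + 3)) := by
  induction l with
  | zero =>
    intro k
    cases k with
    | zero => rw [card_SI_zero_of _ _ (by omega), card_SI_zero_of _ _ (by omega)]
    | succ k =>
      rw [show 2 * (k + 1) + 1 = (2 * k + 1) + 2 by ring, show 2 * (k + 1) = 2 * k + 1 + 1 by ring,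
        show 2 * 0 + 3 = 1 + 2 by rfl, show 2 * 0 + 1 = 1 by rfl, card_SI_one, card_SI_add_two,
        odd_eq, show (2 * k + 1) / 2 = k by omega]
      refine Finset.sum_congr rfl fun m hm => ?_
      rw [mem_range] at hm
      rw [show 2 * k + 1 - 2 * m = 2 * (k - m) + 1 by omega, card_SI_one]
  | succ l ih =>
    intro k
    cases k with
    | zero => rw [card_SI_zero_of _ _ (by omega), card_SI_zero_of _ _ (by omega)]
    | succ k =>
      rw [show 2 * (k + 1) + 1 = (2 * k + 1) + 2 by ring, show 2 * (k + 1) = 2 * k + 2 by ring,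
        show 2 * (l + 1) + 3 = (2 * l + 3) + 2 by ring,
        show 2 * (l + 1) + 1 = (2 * l + 1) + 2 by ring, card_SI_add_two, card_SI_add_two,
        show (2 * k + 1) / 2 = k by omega, show 2 * k / 2 = k by omega]
      refine Finset.sum_congr rfl fun m hm => ?_
      rw [mem_range] at hm
      rw [show 2 * k + 1 - 2 * m = 2 * (k - m) + 1 by omega,
        show 2 * k - 2 * m = 2 * (k - m) by omega, ih]

theorem occ_eq_zero_iff {n : ℕ} (π : Equiv.Perm (Fin n)) : occ p132 π = 0 ↔
    ∀ i j k, i < j → j < k → π i < π k → π k < π j → False := by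
  rw [occ, card_eq_zero, filter_eq_empty_iff]
  constructor
  · intro h i j k hij hjk hik hkj
    refine h (mem_univ ![i, j, k]) ⟨?_, ?_⟩
    · intro a b hab
      fin_cases a <;> fin_cases b <;> simp at hab ⊢
      · exact hij
      · exact hij.trans hjk
      · exact hjk
    · have hij' := hik.trans hkj
      intro a b
      fin_cases a <;> fin_cases b <;> simp [p132, Equiv.swap_apply_def, hik, hkj, hij',
        hik.le, hkj.le, hij'.le]
  · rintro h f - ⟨h1, h2⟩
    refine h (f 0) (f 1) (f 2) (h1 0 1 (by decide)) (h1 1 2 (by decide))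
      ((h2 0 2).1 (by decide)) ((h2 2 1).1 (by decide))

theorem card_transport (n r : ℕ) :
    (Finset.univ.filter (fun π : Equiv.Perm (Fin n) =>
      (∀ i, π (π i) = i) ∧ occ p132 π = 0 ∧ rlMaxCount π = r)).card = Nat.card (SI n r) := by
  let φ : Equiv.Perm (Fin n) → Equiv.Perm ℕ := fun π => π.extendDomain Fin.equivSubtype
  have hφ : ∀ π (i : Fin n), φ π (i : ℕ) = (π i : ℕ) := by
    intro π i
    exact Equiv.Perm.extendDomain_apply_image π Fin.equivSubtype i
  have hsup : ∀ π, SupN n (φ π) := by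
    intro π i hi
    exact Equiv.Perm.extendDomain_apply_not_subtype π Fin.equivSubtype (by omega)
  have hinj : Function.Injective φ := by
    intro π σ h
    ext i
    rw [← hφ, ← hφ, h]
  have hsurj : ∀ f, SupN n f → ∃ π, φ π = f := by
    intro f hf
    refine ⟨⟨fun i => ⟨f i, hf.lt i.2⟩, fun i => ⟨f.symm i, hf.symm.lt i.2⟩, ?_, ?_⟩, ?_⟩
    · intro i; simp
    · intro i; simp
    · apply SupN.ext (hsup _) hf
      intro i hi
      exact hφ _ ⟨i, hi⟩
  have hrl : ∀ π, RLn n (φ π) = rlMaxCount π := by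
    intro π
    rw [RLn, rlMaxCount, ← card_map Fin.valEmbedding]
    congr 1
    ext j
    simp only [mem_filter, mem_range, mem_map, mem_univ, true_and, Fin.valEmbedding_apply]
    constructor
    · rintro ⟨hj, h⟩
      refine ⟨⟨j, hj⟩, fun i hi => ?_, rfl⟩
      have := h i i.2 hi
      rw [hφ, hφ π ⟨j, hj⟩] at this
      exact this
    · rintro ⟨j, h, rfl⟩
      refine ⟨j.2, fun i hi hji => ?_⟩
      rw [hφ, hφ π ⟨i, hi⟩]
      exact h ⟨i, hi⟩ hji
  have hiff : ∀ π, φ π ∈ SI n r ↔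
      ((∀ i, π (π i) = i) ∧ occ p132 π = 0 ∧ rlMaxCount π = r) := by
    intro π
    rw [occ_eq_zero_iff, ← hrl]
    constructor
    · rintro ⟨_, h1, h2, h3⟩
      refine ⟨fun i => ?_, fun i j k hij hjk hik hkj => ?_, h3⟩
      · have := h1 i
        rw [hφ, hφ] at this
        exact Fin.ext this
      · exact h2 i j k hij hjk (by rw [hφ, hφ]; exact hik) (by rw [hφ, hφ]; exact hkj)
    · rintro ⟨h1, h2, h3⟩
      refine ⟨hsup π, fun i => ?_, ?_, h3⟩
      · by_cases hi : i < n
        · have := hφ π ⟨i, hi⟩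
          simp only at this
          rw [this, hφ, h1]
        · rw [hsup π i (by omega), hsup π i (by omega)]
      · rw [AvF_iff (hsup π)]
        intro i j k hij hjk hk hik hkj
        have e1 := hφ π ⟨i, by omega⟩
        have e2 := hφ π ⟨j, by omega⟩
        have e3 := hφ π ⟨k, by omega⟩
        simp only at e1 e2 e3
        rw [e1, e3] at hik
        rw [e2, e3] at hkj
        exact h2 ⟨i, by omega⟩ ⟨j, by omega⟩ ⟨k, by omega⟩ hij hjk hik hkj
  have himg : SI n r = Set.image φ {π | (∀ i, π (π i) = i) ∧ occ p132 π = 0 ∧ rlMaxCount π = r} := by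
    ext f
    constructor
    · intro hf
      obtain ⟨π, rfl⟩ := hsurj f hf.1
      exact ⟨π, (hiff π).1 hf, rfl⟩
    · rintro ⟨π, hπ, rfl⟩
      exact (hiff π).2 hπ
  rw [Nat.card_coe_set_eq, himg, Set.ncard_image_of_injective _ hinj,
    ← Set.ncard_coe_finset]
  congr 1
  ext π
  simp


end RLB

/-- Bijection: 132-avoiding involutions of length 2k with 2l+1 right-to-left
maxima correspond to those of length 2k+1 with 2l+3 right-to-left maxima. -/
theorem rlmax_bijection_even_to_odd (k l : ℕ) (hk : 1 ≤ k) (hl : l < k) :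
    (Finset.univ.filter (fun π : Equiv.Perm (Fin (2 * k)) =>
      (∀ i, π (π i) = i) ∧ occ p132 π = 0 ∧ rlMaxCount π = 2 * l + 1)).card
    = (Finset.univ.filter (fun π : Equiv.Perm (Fin (2 * k + 1)) =>
      (∀ i, π (π i) = i) ∧ occ p132 π = 0 ∧ rlMaxCount π = 2 * l + 3)).card := by
  rw [RLB.card_transport, RLB.card_transport]
  exact RLB.main_eq l k
end

section
/- For every k ≥ 0 and every l with 0 ≤ l ≤ k, the number of involutions of length 2k+1 avoiding the pattern 132 and having exactly 2l+1 right-to-left maxima equals the number of involutions of length 2k+2 avoiding 132 and having either exactly 2l+2 or exactly 2l+3 right-to-left maxima. -/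
open Finset

def Avoids {n : ℕ} (π : Equiv.Perm (Fin n)) : Prop :=
  ∀ x y z : Fin n, x < y → y < z → π x < π z → π z < π y → False

def Invol {n : ℕ} (π : Equiv.Perm (Fin n)) : Prop := ∀ i, π (π i) = i

theorem occ_iff {n : ℕ} (π : Equiv.Perm (Fin n)) : occ p132 π = 0 ↔ Avoids π := by
  unfold occ
  rw [Finset.card_eq_zero, Finset.filter_eq_empty_iff]
  constructor
  · intro h x y z hxy hyz h1 h2
    refine h (Finset.mem_univ ![x, y, z]) ⟨?_, ?_⟩
    · intro a b hab
      fin_cases a <;> fin_cases b <;> simp_all <;> exact hxy.trans hyz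
    · intro a b
      have h3 := h1.trans h2
      fin_cases a <;> fin_cases b <;>
        simp [p132, Equiv.swap_apply_def, h1, h2, h3, h1.le, h2.le, h3.le]
  · intro h f _ hf
    refine h (f 0) (f 1) (f 2) (hf.1 _ _ (by decide)) (hf.1 _ _ (by decide))
      ((hf.2 _ _).1 (by decide)) ((hf.2 _ _).1 (by decide))

theorem Avoids.symm {n : ℕ} {π : Equiv.Perm (Fin n)} (h : Avoids π) : Avoids π.symm := by
  intro x y z hxy hyz h1 h2
  exact h _ _ _ h1 h2 (by simpa using hxy.trans_le (le_refl y)) (by simpa using hyz)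

def IsRL {n : ℕ} (π : Equiv.Perm (Fin n)) (j : Fin n) : Prop := ∀ i : Fin n, j < i → π i < π j

theorem rl_symm {n : ℕ} (π : Equiv.Perm (Fin n)) : rlMaxCount π.symm = rlMaxCount π := by
  unfold rlMaxCount
  symm
  refine Finset.card_bij (fun j _ => π j) ?_ (fun a _ b _ h => π.injective h) ?_
  · intro a ha
    simp only [Finset.mem_filter, Finset.mem_univ, true_and] at ha ⊢
    intro i hi
    by_contra hc
    simp only [Equiv.symm_apply_apply, not_lt] at hc
    rcases hc.lt_or_eq with h | h
    · have := ha _ h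
      simp at this
      exact absurd hi (not_lt.2 this.le)
    · rw [h] at hi; simp at hi
  · intro b hb
    simp only [Finset.mem_filter, Finset.mem_univ, true_and] at hb
    refine ⟨π.symm b, ?_, by simp⟩
    simp only [Finset.mem_filter, Finset.mem_univ, true_and]
    intro i hi
    by_contra hc
    simp only [Equiv.apply_symm_apply, not_lt] at hc
    rcases hc.lt_or_eq with h | h
    · have := hb _ h
      simp at this
      exact absurd hi (not_lt.2 this.le)
    · rw [h] at hi; simp at hi

theorem rl_eq_one_iff {n : ℕ} (π : Equiv.Perm (Fin (n+1))) :
    rlMaxCount π = 1 ↔ π (Fin.last n) = Fin.last n := by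
  have hl : ∀ i : Fin (n+1), Fin.last n < i → π i < π (Fin.last n) :=
    fun i hi => absurd hi (not_lt.2 (Fin.le_last i))
  unfold rlMaxCount
  rw [Finset.card_eq_one]
  constructor
  · rintro ⟨a, ha⟩
    have h1 : Fin.last n ∈ ({a} : Finset (Fin (n+1))) := by
      rw [← ha]; simpa using hl
    have h2 : π.symm (Fin.last n) ∈ ({a} : Finset (Fin (n+1))) := by
      rw [← ha]
      simp only [Finset.mem_filter, Finset.mem_univ, true_and, Equiv.apply_symm_apply]
      intro i hi
      refine lt_of_le_of_ne (Fin.le_last _) ?_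
      rintro h
      rw [← h] at hi
      simp at hi
    rw [Finset.mem_singleton] at h1 h2
    rw [← h1, Equiv.symm_apply_eq] at h2
    exact h2.symm
  · intro h
    refine ⟨Fin.last n, ?_⟩
    ext j
    simp only [Finset.mem_filter, Finset.mem_univ, true_and, Finset.mem_singleton]
    constructor
    · intro hj
      by_contra hne
      have := hj _ (lt_of_le_of_ne (Fin.le_last j) hne)
      rw [h] at this
      exact absurd this (not_lt.2 (Fin.le_last _))
    · rintro rfl; exact hl

theorem rl_pos {n : ℕ} (π : Equiv.Perm (Fin (n+1))) : 0 < rlMaxCount π := by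
  unfold rlMaxCount
  refine Finset.card_pos.2 ⟨Fin.last n, ?_⟩
  simp only [Finset.mem_filter, Finset.mem_univ, true_and]
  exact fun i hi => absurd hi (not_lt.2 (Fin.le_last i))

theorem rl_zero (π : Equiv.Perm (Fin 0)) : rlMaxCount π = 0 := by
  unfold rlMaxCount; simp

/-- adjoin a fixed point at the end -/
def ext1 {n : ℕ} (A : Equiv.Perm (Fin n)) : Equiv.Perm (Fin (n+1)) where
  toFun x := if h : x.val < n then (A ⟨x, h⟩).castSucc else Fin.last n
  invFun x := if h : x.val < n then (A.symm ⟨x, h⟩).castSucc else Fin.last n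
  left_inv x := by
    by_cases h : x.val < n
    · simp [h]
    · simp [h]; ext; simp; omega
  right_inv x := by
    by_cases h : x.val < n
    · simp [h]
    · simp [h]; ext; simp; omega

theorem ext1_castSucc {n : ℕ} (A : Equiv.Perm (Fin n)) (x : Fin n) :
    ext1 A x.castSucc = (A x).castSucc := by
  simp [ext1]

theorem ext1_last {n : ℕ} (A : Equiv.Perm (Fin n)) : ext1 A (Fin.last n) = Fin.last n := by
  simp [ext1]

theorem ext1_inj {n : ℕ} {A B : Equiv.Perm (Fin n)} (h : ext1 A = ext1 B) : A = B := by
  ext x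
  have := congrArg (fun f => f x.castSucc) h
  simp only [ext1_castSucc, Fin.castSucc_inj] at this
  rw [this]

theorem ext1_surj {n : ℕ} (π : Equiv.Perm (Fin (n+1))) (h : π (Fin.last n) = Fin.last n) :
    ∃ A, ext1 A = π := by
  have hs : π.symm (Fin.last n) = Fin.last n := by rw [Equiv.symm_apply_eq, h]
  have key : ∀ σ : Equiv.Perm (Fin (n+1)), σ (Fin.last n) = Fin.last n →
      ∀ x : Fin n, (σ x.castSucc).val < n := by
    intro σ hσ x
    have : σ x.castSucc ≠ Fin.last n := by
      intro hc
      rw [← hσ] at hc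
      exact (Fin.castSucc_lt_last x).ne (σ.injective hc)
    have h2 := Fin.val_lt_last this
    simpa using h2
  refine ⟨⟨fun x => ⟨_, key π h x⟩, fun x => ⟨_, key _ hs x⟩, ?_, ?_⟩, ?_⟩
  · intro x
    ext
    have : (Fin.castSucc ⟨_, key π h x⟩) = π x.castSucc := by ext; simp
    simp [this]
  · intro x
    ext
    have : (Fin.castSucc ⟨_, key _ hs x⟩) = π.symm x.castSucc := by ext; simp
    simp [this]
  · ext x
    refine Fin.lastCases ?_ ?_ x
    · rw [ext1_last, h]
    · intro y; rw [ext1_castSucc]; simp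

theorem ext1_avoids {n : ℕ} (A : Equiv.Perm (Fin n)) : Avoids (ext1 A) ↔ Avoids A := by
  constructor
  · intro h x y z hxy hyz h1 h2
    exact h x.castSucc y.castSucc z.castSucc (by simpa) (by simpa)
      (by simpa [ext1_castSucc]) (by simpa [ext1_castSucc])
  · intro h x y z
    refine Fin.lastCases ?_ (fun z => ?_) z
    · intro _ _ _ h2
      rw [ext1_last] at h2
      exact absurd h2 (not_lt.2 (Fin.le_last _))
    refine Fin.lastCases ?_ (fun y => ?_) y
    · intro _ h2
      exact absurd h2 (not_lt.2 (Fin.le_last _))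
    refine Fin.lastCases ?_ (fun x => ?_) x
    · intro h2
      exact absurd h2 (not_lt.2 (Fin.le_last _))
    simp only [ext1_castSucc, Fin.castSucc_lt_castSucc_iff]
    exact h x y z

theorem ext1_invol {n : ℕ} (A : Equiv.Perm (Fin n)) : Invol (ext1 A) ↔ Invol A := by
  constructor
  · intro h x
    have := h x.castSucc
    simpa [ext1_castSucc] using this
  · intro h x
    refine Fin.lastCases ?_ (fun x => ?_) x
    · rw [ext1_last, ext1_last]
    · rw [ext1_castSucc, ext1_castSucc, h]

open Classical in
noncomputable def cAv (n : ℕ) : ℕ := (univ.filter (fun π : Equiv.Perm (Fin n) => Avoids π)).card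
open Classical in
noncomputable def wAv (n : ℕ) : ℕ :=
  (univ.filter (fun π : Equiv.Perm (Fin n) => Avoids π ∧ rlMaxCount π = 1)).card
open Classical in
noncomputable def NI (n : ℕ) (S : ℕ → Prop) : ℕ :=
  (univ.filter (fun π : Equiv.Perm (Fin n) => (Invol π ∧ Avoids π) ∧ S (rlMaxCount π))).card

theorem wAv_succ (n : ℕ) : wAv (n+1) = cAv n := by
  classical
  unfold wAv cAv
  symm
  refine Finset.card_bij (fun A _ => ext1 A) ?_ (fun _ _ _ _ h => ext1_inj h) ?_
  · intro A hA
    simp only [mem_filter, mem_univ, true_and] at hA ⊢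
    exact ⟨(ext1_avoids A).2 hA, (rl_eq_one_iff _).2 (ext1_last A)⟩
  · intro π hπ
    simp only [mem_filter, mem_univ, true_and] at hπ
    obtain ⟨A, rfl⟩ := ext1_surj π ((rl_eq_one_iff _).1 hπ.2)
    exact ⟨A, by simpa using (ext1_avoids A).1 hπ.1, rfl⟩

theorem NI_one (n : ℕ) : NI (n+1) (fun r => r = 1) = NI n (fun _ => True) := by
  classical
  unfold NI
  symm
  refine Finset.card_bij (fun A _ => ext1 A) ?_ (fun _ _ _ _ h => ext1_inj h) ?_
  · intro A hA
    simp only [mem_filter, mem_univ, true_and, and_true] at hA ⊢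
    exact ⟨⟨(ext1_invol A).2 hA.1, (ext1_avoids A).2 hA.2⟩, (rl_eq_one_iff _).2 (ext1_last A)⟩
  · intro π hπ
    simp only [mem_filter, mem_univ, true_and] at hπ
    obtain ⟨A, rfl⟩ := ext1_surj π ((rl_eq_one_iff _).1 hπ.2)
    exact ⟨A, by simpa using ⟨(ext1_invol A).1 hπ.1.1, (ext1_avoids A).1 hπ.1.2⟩, rfl⟩

section glue
variable {n i m : ℕ} (h : n = i + m + i)

def lo (a : Fin i) : Fin n := ⟨a, by omega⟩
def mid (b : Fin m) : Fin n := ⟨i + b, by omega⟩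
def hi (a : Fin i) : Fin n := ⟨i + m + a, by omega⟩

theorem zone (x : Fin n) : (∃ a : Fin i, x = lo h a) ∨ (∃ b : Fin m, x = mid h b) ∨
    (∃ a : Fin i, x = hi h a) := by
  by_cases h1 : x.val < i
  · exact Or.inl ⟨⟨x, h1⟩, rfl⟩
  by_cases h2 : x.val < i + m
  · exact Or.inr (Or.inl ⟨⟨x - i, by omega⟩, by ext; simp [mid]; omega⟩)
  · exact Or.inr (Or.inr ⟨⟨x - (i + m), by omega⟩, by ext; simp [hi]; omega⟩)

def glueFun (A : Equiv.Perm (Fin i)) (μ : Equiv.Perm (Fin m)) (x : Fin n) : Fin n :=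
  if h1 : x.val < i then hi h (A ⟨x, h1⟩)
  else if h2 : x.val < i + m then mid h (μ ⟨x - i, by omega⟩)
  else lo h (A.symm ⟨x - (i + m), by omega⟩)

theorem glueFun_lo (A : Equiv.Perm (Fin i)) (μ : Equiv.Perm (Fin m)) (a : Fin i) :
    glueFun h A μ (lo h a) = hi h (A a) := by
  simp [glueFun, lo]

theorem glueFun_mid (A : Equiv.Perm (Fin i)) (μ : Equiv.Perm (Fin m)) (a : Fin m) :
    glueFun h A μ (mid h a) = mid h (μ a) := by
  simp [glueFun, mid]

theorem glueFun_hi (A : Equiv.Perm (Fin i)) (μ : Equiv.Perm (Fin m)) (a : Fin i) :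
    glueFun h A μ (hi h a) = lo h (A.symm a) := by
  have h1 : ¬ (i + m + a.val < i) := by omega
  simp [glueFun, hi, h1]

/-- `A ⊖ μ ⊖ A⁻¹`, when `μ` is an involution. -/
def glue (A : Equiv.Perm (Fin i)) (μ : Equiv.Perm (Fin m)) : Equiv.Perm (Fin n) where
  toFun := glueFun h A μ
  invFun := glueFun h A μ.symm
  left_inv x := by
    rcases zone h x with ⟨a, rfl⟩ | ⟨a, rfl⟩ | ⟨a, rfl⟩ <;>
      simp [glueFun_lo, glueFun_mid, glueFun_hi]
  right_inv x := by
    rcases zone h x with ⟨a, rfl⟩ | ⟨a, rfl⟩ | ⟨a, rfl⟩ <;>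
      simp [glueFun_lo, glueFun_mid, glueFun_hi]

variable (A : Equiv.Perm (Fin i)) (μ : Equiv.Perm (Fin m))

theorem glue_lo (a : Fin i) : glue h A μ (lo h a) = hi h (A a) := glueFun_lo h A μ a
theorem glue_mid (a : Fin m) : glue h A μ (mid h a) = mid h (μ a) := glueFun_mid h A μ a
theorem glue_hi (a : Fin i) : glue h A μ (hi h a) = lo h (A.symm a) := glueFun_hi h A μ a

theorem lo_lt_lo (a b : Fin i) : lo h a < lo h b ↔ a < b := by simp [lo]
theorem mid_lt_mid (a b : Fin m) : mid h a < mid h b ↔ a < b := by simp [mid]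
theorem hi_lt_hi (a b : Fin i) : hi h a < hi h b ↔ a < b := by simp [hi]
theorem lo_lt_mid (a : Fin i) (b : Fin m) : lo h a < mid h b := by
  simp only [lo, mid, Fin.mk_lt_mk]; omega
theorem lo_lt_hi (a : Fin i) (b : Fin i) : lo h a < hi h b := by
  simp only [lo, hi, Fin.mk_lt_mk]; omega
theorem mid_lt_hi (a : Fin m) (b : Fin i) : mid h a < hi h b := by
  simp only [mid, hi, Fin.mk_lt_mk]; omega
theorem lo_inj {a b : Fin i} (e : lo h a = lo h b) : a = b := by simpa [lo, Fin.ext_iff] using e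
theorem mid_inj {a b : Fin m} (e : mid h a = mid h b) : a = b := by
  simpa [mid, Fin.ext_iff] using e
theorem hi_inj {a b : Fin i} (e : hi h a = hi h b) : a = b := by simpa [hi, Fin.ext_iff] using e

theorem glue_invol (hμ : Invol μ) : Invol (glue h A μ) := by
  intro x
  rcases zone h x with ⟨a, rfl⟩ | ⟨a, rfl⟩ | ⟨a, rfl⟩
  · simp [glue_lo, glue_hi]
  · rw [glue_mid, glue_mid, hμ]
  · simp [glue_lo, glue_hi]

theorem glue_avoids (hA : Avoids A) (hμ : Avoids μ) : Avoids (glue h A μ) := by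
  have L1 := fun a b => (lo_lt_mid h a b).not_gt
  have L2 := fun a b => (lo_lt_hi h a b).not_gt
  have L3 := fun a b => (mid_lt_hi h a b).not_gt
  have hA' := hA.symm
  intro x y z
  rcases zone h x with ⟨a, rfl⟩ | ⟨a, rfl⟩ | ⟨a, rfl⟩ <;>
  rcases zone h y with ⟨b, rfl⟩ | ⟨b, rfl⟩ | ⟨b, rfl⟩ <;>
  rcases zone h z with ⟨c, rfl⟩ | ⟨c, rfl⟩ | ⟨c, rfl⟩ <;>
  simp only [glue_lo, glue_mid, glue_hi, L1, L2, L3, lo_lt_lo, mid_lt_mid, hi_lt_hi, false_imp_iff,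
    imp_true_iff]
  · exact hA a b c
  · exact hμ a b c
  · exact hA' a b c

theorem avoids_of_glue (hg : Avoids (glue h A μ)) : Avoids A ∧ Avoids μ := by
  constructor
  · intro x y z
    have := hg (lo h x) (lo h y) (lo h z)
    simpa only [glue_lo, lo_lt_lo, hi_lt_hi] using this
  · intro x y z
    have := hg (mid h x) (mid h y) (mid h z)
    simpa only [glue_mid, mid_lt_mid] using this

theorem invol_of_glue (hg : Invol (glue h A μ)) : Invol μ := by
  intro x
  have := hg (mid h x)
  rw [glue_mid, glue_mid] at this
  exact mid_inj h this

theorem glue_inj {A A' : Equiv.Perm (Fin i)} {μ μ' : Equiv.Perm (Fin m)}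
    (e : glue h A μ = glue h A' μ') : A = A' ∧ μ = μ' := by
  constructor
  · ext x
    have := congrArg (fun f => f (lo h x)) e
    simp only [glue_lo] at this
    rw [hi_inj h this]
  · ext x
    have := congrArg (fun f => f (mid h x)) e
    simp only [glue_mid] at this
    rw [mid_inj h this]

/-- `π` swaps the first and the last `i` positions -/
def Dec (i : ℕ) (π : Equiv.Perm (Fin n)) : Prop :=
  2 * i ≤ n ∧ ∀ x : Fin n, x.val < i ↔ n ≤ (π x).val + i

theorem glue_dec : Dec i (glue h A μ) := by
  refine ⟨by omega, fun x => ?_⟩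
  rcases zone h x with ⟨a, rfl⟩ | ⟨a, rfl⟩ | ⟨a, rfl⟩
  · rw [glue_lo]; simp only [lo, hi]; omega
  · rw [glue_mid]; simp only [mid]; omega
  · rw [glue_hi]; simp only [lo, hi]; omega

theorem glue_surj (π : Equiv.Perm (Fin n)) (hI : Invol π) (hd : Dec i π) :
    ∃ A μ, glue h A μ = π := by
  obtain ⟨-, hd⟩ := hd
  have e1 : ∀ a : Fin i, ∃ b : Fin i, π (lo h a) = hi h b := by
    intro a
    have := (hd (lo h a)).1 (by simp [lo])
    rcases zone h (π (lo h a)) with ⟨b, hb⟩ | ⟨b, hb⟩ | ⟨b, hb⟩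
    · rw [hb] at this; simp only [lo] at this; omega
    · rw [hb] at this; simp only [mid] at this; omega
    · exact ⟨b, hb⟩
  have e2 : ∀ a : Fin i, ∃ b : Fin i, π (hi h a) = lo h b := by
    intro a
    have := (hd (π (hi h a))).2 (by rw [hI]; simp only [hi]; omega)
    exact ⟨⟨_, this⟩, rfl⟩
  have e3 : ∀ a : Fin m, ∃ b : Fin m, π (mid h a) = mid h b := by
    intro a
    rcases zone h (π (mid h a)) with ⟨b, hb⟩ | ⟨b, hb⟩ | ⟨b, hb⟩
    · have := (hd (π (mid h a))).1 (by rw [hb]; simp [lo])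
      rw [hI] at this; simp only [mid] at this; omega
    · exact ⟨b, hb⟩
    · have := (hd (mid h a)).2 (by rw [hb]; simp only [hi]; omega)
      simp only [mid] at this; omega
  choose f hf using e1
  choose g hg using e2
  choose k hk using e3
  refine ⟨⟨f, g, ?_, ?_⟩, ⟨k, k, ?_, ?_⟩, ?_⟩
  · intro a; apply lo_inj h; rw [← hg, ← hf, hI]
  · intro a; apply hi_inj h; rw [← hf, ← hg, hI]
  · intro a; apply mid_inj h; rw [← hk, ← hk, hI]
  · intro a; apply mid_inj h; rw [← hk, ← hk, hI]
  · ext x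
    rcases zone h x with ⟨a, rfl⟩ | ⟨a, rfl⟩ | ⟨a, rfl⟩
    · rw [glue_lo, hf]; rfl
    · rw [glue_mid, hk]; rfl
    · rw [glue_hi, hg]; rfl

theorem glue_rl : rlMaxCount (glue h A μ) = 2 * rlMaxCount A + rlMaxCount μ := by
  have key : rlMaxCount (glue h A μ) = rlMaxCount A + rlMaxCount μ + rlMaxCount A.symm := by
    have L1 := fun a b => (lo_lt_mid h a b).not_gt
    have L2 := fun a b => (lo_lt_hi h a b).not_gt
    have L3 := fun a b => (mid_lt_hi h a b).not_gt
    have K1 : ∀ a, (∀ x, lo h a < x → glue h A μ x < glue h A μ (lo h a)) ↔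
        ∀ x, a < x → A x < A a := by
      intro a
      constructor
      · intro hh x hx
        have := hh (lo h x) (by rwa [lo_lt_lo])
        rwa [glue_lo, glue_lo, hi_lt_hi] at this
      · intro hh x hx
        rcases zone h x with ⟨b, rfl⟩ | ⟨b, rfl⟩ | ⟨b, rfl⟩
        · rw [glue_lo, glue_lo, hi_lt_hi]; exact hh _ (by rwa [lo_lt_lo] at hx)
        · rw [glue_mid, glue_lo]; exact mid_lt_hi ..
        · rw [glue_hi, glue_lo]; exact lo_lt_hi ..
    have K2 : ∀ a, (∀ x, mid h a < x → glue h A μ x < glue h A μ (mid h a)) ↔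
        ∀ x, a < x → μ x < μ a := by
      intro a
      constructor
      · intro hh x hx
        have := hh (mid h x) (by rwa [mid_lt_mid])
        rwa [glue_mid, glue_mid, mid_lt_mid] at this
      · intro hh x hx
        rcases zone h x with ⟨b, rfl⟩ | ⟨b, rfl⟩ | ⟨b, rfl⟩
        · exact absurd hx (L1 _ _)
        · rw [glue_mid, glue_mid, mid_lt_mid]; exact hh _ (by rwa [mid_lt_mid] at hx)
        · rw [glue_hi, glue_mid]; exact lo_lt_mid ..
    have K3 : ∀ a, (∀ x, hi h a < x → glue h A μ x < glue h A μ (hi h a)) ↔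
        ∀ x, a < x → A.symm x < A.symm a := by
      intro a
      constructor
      · intro hh x hx
        have := hh (hi h x) (by rwa [hi_lt_hi])
        rwa [glue_hi, glue_hi, lo_lt_lo] at this
      · intro hh x hx
        rcases zone h x with ⟨b, rfl⟩ | ⟨b, rfl⟩ | ⟨b, rfl⟩
        · exact absurd hx (L2 _ _)
        · exact absurd hx (L3 _ _)
        · rw [glue_hi, glue_hi, lo_lt_lo]; exact hh _ (by rwa [hi_lt_hi] at hx)
    subst h
    unfold rlMaxCount
    simp only [Finset.card_filter]
    rw [Fin.sum_univ_add, Fin.sum_univ_add]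
    congr 1
    · congr 1
      · exact Finset.sum_congr rfl fun a _ => if_congr (K1 a) rfl rfl
      · exact Finset.sum_congr rfl fun a _ => if_congr (K2 a) rfl rfl
    · exact Finset.sum_congr rfl fun a _ => if_congr (K3 a) rfl rfl
  rw [key, rl_symm]; ring

open Classical in
theorem card_glue (P : Equiv.Perm (Fin i) → Prop) (Q : Equiv.Perm (Fin m) → Prop)
    (R : Equiv.Perm (Fin n) → Prop) (hR : ∀ A μ, R (glue h A μ) ↔ P A ∧ Q μ) :
    (univ.filter (fun π : Equiv.Perm (Fin n) => (Invol π ∧ Avoids π) ∧ Dec i π ∧ R π)).card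
    = (univ.filter (fun A : Equiv.Perm (Fin i) => Avoids A ∧ P A)).card *
      (univ.filter (fun μ : Equiv.Perm (Fin m) => (Invol μ ∧ Avoids μ) ∧ Q μ)).card := by
  rw [← Finset.card_product]
  symm
  refine Finset.card_bij (fun p _ => glue h p.1 p.2) ?_ ?_ ?_
  · rintro ⟨A, μ⟩ hp
    simp only [mem_product, mem_filter, mem_univ, true_and] at hp ⊢
    exact ⟨⟨glue_invol h A μ hp.2.1.1, glue_avoids h A μ hp.1.1 hp.2.1.2⟩, glue_dec h A μ,
      (hR A μ).2 ⟨hp.1.2, hp.2.2⟩⟩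
  · rintro ⟨A, μ⟩ _ ⟨A', μ'⟩ _ e
    obtain ⟨rfl, rfl⟩ := glue_inj h e
    rfl
  · intro π hπ
    simp only [mem_filter, mem_univ, true_and] at hπ
    obtain ⟨A, μ, rfl⟩ := glue_surj h π hπ.1.1 hπ.2.1
    refine ⟨(A, μ), ?_, rfl⟩
    simp only [mem_product, mem_filter, mem_univ, true_and]
    have h1 := avoids_of_glue h A μ hπ.1.2
    have h2 := (hR A μ).1 hπ.2.2
    exact ⟨⟨h1.1, h2.1⟩, ⟨invol_of_glue h A μ hπ.1.1, h1.2⟩, h2.2⟩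

end glue

theorem dec_of_last {n : ℕ} (π : Equiv.Perm (Fin (n+1))) (hI : Invol π) (hA : Avoids π)
    (hne : π (Fin.last n) ≠ Fin.last n) : Dec ((π (Fin.last n)).val + 1) π := by
  set p := π (Fin.last n) with hp
  have hπp : π p = Fin.last n := hI _
  have key : ∀ x y : Fin (n+1), x ≤ p → p < y → π y < π x := by
    intro x y hx hy
    have hyl : π y < Fin.last n := by
      refine lt_of_le_of_ne (Fin.le_last _) ?_
      rw [← hπp]
      exact fun e => hy.ne' (π.injective e)
    rcases hx.lt_or_eq with hx | hx
    · by_contra hc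
      have h1 : π x < π y := by
        refine lt_of_le_of_ne (not_lt.1 hc) ?_
        exact fun e => (hx.trans hy).ne (π.injective e)
      exact hA x p y hx hy h1 (by rw [hπp]; exact hyl)
    · rw [hx, hπp]; exact hyl
  have c1 : ∀ x, x ≤ p → n ≤ (π x).val + p.val := by
    intro x hx
    have := Finset.card_le_card_of_injOn (s := Finset.Ioi p) (t := Finset.Iio (π x)) π
      (by intro y hy; simp at hy ⊢; exact key x y hx hy) (π.injective.injOn)
    rw [Fin.card_Ioi, Fin.card_Iio] at this
    omega
  have c2 : ∀ y, p < y → (π y).val + p.val < n := by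
    intro y hy
    have := Finset.card_le_card_of_injOn (s := Finset.Iic p) (t := Finset.Ioi (π y)) π
      (by intro x hx; simp at hx ⊢; exact key x y hx hy) (π.injective.injOn)
    rw [Fin.card_Iic, Fin.card_Ioi] at this
    omega
  constructor
  · have := c2 (Fin.last n) (lt_of_le_of_ne (Fin.le_last _) hne)
    rw [← hp] at this; omega
  · intro x
    constructor
    · intro hx
      have := c1 x (Fin.le_def.2 (by omega))
      omega
    · intro hx
      by_contra hc
      have := c2 x (Fin.lt_def.2 (by omega))
      omega

theorem dec_add {n i m j : ℕ} (h : n = i + m + i) (A : Equiv.Perm (Fin i))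
    (μ : Equiv.Perm (Fin m)) (hd : Dec j μ) : Dec (i + j) (glue h A μ) := by
  obtain ⟨h1, h2⟩ := hd
  refine ⟨by omega, fun x => ?_⟩
  rcases zone h x with ⟨a, rfl⟩ | ⟨a, rfl⟩ | ⟨a, rfl⟩
  · rw [glue_lo]; simp only [lo, hi]; omega
  · rw [glue_mid]; simp only [mid]; have := h2 a; omega
  · rw [glue_hi]; simp only [lo, hi]; omega

theorem card_split {α : Type*} [Fintype α] [DecidableEq α] (N : ℕ) (p : α → Prop)
    (q : ℕ → α → Prop) {_ : DecidablePred p} [∀ i, DecidablePred (q i)]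
    (h1 : ∀ a, p a ↔ ∃ i, i < N ∧ q i a) (h2 : ∀ i j a, q i a → q j a → i = j) :
    (univ.filter p).card = ∑ i ∈ range N, (univ.filter (q i)).card := by
  rw [← Finset.card_biUnion]
  · congr 1
    ext a
    simp [h1]
  · intro i _ j _ hij
    rw [Function.onFun, Finset.disjoint_left]
    intro a ha hb
    simp only [mem_filter, mem_univ, true_and] at ha hb
    exact hij (h2 i j a ha hb)

/-- the middle block, if nonempty, ends in a fixed point -/
def MidFix {n : ℕ} (i : ℕ) (π : Equiv.Perm (Fin n)) : Prop :=
  ∀ x : Fin n, x.val + i + 1 = n → i ≤ x.val → π x = x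

theorem midFix_glue {n i m : ℕ} (h : n = i + m + i) (A : Equiv.Perm (Fin i))
    (μ : Equiv.Perm (Fin m)) : MidFix i (glue h A μ) ↔ rlMaxCount μ ≤ 1 := by
  rcases m with _ | m
  · rw [rl_zero]
    simp only [zero_le, iff_true]
    intro x hx hx'
    omega
  · have h0 := rl_pos μ
    have : rlMaxCount μ ≤ 1 ↔ rlMaxCount μ = 1 := by omega
    rw [this, rl_eq_one_iff]
    constructor
    · intro hf
      have := hf (mid h (Fin.last m)) (by simp [mid]; omega) (by simp [mid])
      rw [glue_mid] at this
      exact mid_inj h this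
    · intro hf x hx hx'
      have : x = mid h (Fin.last m) := by ext; simp [mid]; omega
      rw [this, glue_mid, hf]

theorem exists_dec {n : ℕ} (π : Equiv.Perm (Fin n)) (hI : Invol π) (hA : Avoids π) :
    ∃ i, i < n / 2 + 1 ∧ Dec i π ∧ MidFix i π := by
  classical
  have h0 : Dec 0 π := ⟨by omega, fun x => by have := (π x).2; omega⟩
  set i := Nat.findGreatest (fun i => Dec i π) n with hi
  have hd : Dec i π := Nat.findGreatest_spec (P := fun i => Dec i π) (Nat.zero_le n) h0
  refine ⟨i, by have := hd.1; omega, hd, ?_⟩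
  obtain ⟨m, h⟩ : ∃ m, n = i + m + i := ⟨n - 2 * i, by have := hd.1; omega⟩
  obtain ⟨A, μ, hg⟩ := glue_surj h π hI hd
  rw [← hg, midFix_glue]
  rcases m with _ | m
  · rw [rl_zero]; omega
  by_contra hc
  have hne : μ (Fin.last m) ≠ Fin.last m := by
    intro e
    have := (rl_eq_one_iff μ).2 e
    omega
  rw [← hg] at hI hA
  have hd2 := dec_add h A μ (dec_of_last μ (invol_of_glue h A μ hI) (avoids_of_glue h A μ hA).2 hne)
  rw [hg] at hd2
  have hle := hd2.1
  have := Nat.le_findGreatest (P := fun i => Dec i π) (n := n)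
    (m := i + ((μ (Fin.last m)).val + 1)) (by omega) hd2
  omega

theorem dec_unique_aux {n i j : ℕ} (π : Equiv.Perm (Fin n)) (hI : Invol π)
    (hi : MidFix i π) (hj : Dec j π) (hij : i < j) : False := by
  obtain ⟨h1, h2⟩ := hj
  have := hi ⟨n - i - 1, by omega⟩ (by simp only; omega) (by simp only; omega)
  have h3 := (h2 (π ⟨n - i - 1, by omega⟩)).2 (by rw [hI]; simp only; omega)
  rw [this] at h3
  simp only at h3
  omega

theorem NI_total (n : ℕ) :
    NI n (fun _ => True) = ∑ i ∈ range (n / 2 + 1), cAv i * NI (n - 2 * i) (fun r => r ≤ 1) := by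
  classical
  unfold NI
  refine (card_split (n / 2 + 1) _
    (fun i (π : Equiv.Perm (Fin n)) => (Invol π ∧ Avoids π) ∧ Dec i π ∧ MidFix i π)
    ?_ ?_).trans ?_
  rotate_left 2
  · refine Finset.sum_congr rfl fun i hi => ?_
    rw [Finset.mem_range] at hi
    have h : n = i + (n - 2 * i) + i := by omega
    have := card_glue h (fun _ => True) (fun μ => rlMaxCount μ ≤ 1) (fun π => MidFix i π)
      (fun A μ => by simpa using midFix_glue h A μ)
    rw [cAv]
    simp only [and_true] at this
    convert this
  · intro π
    constructor
    · rintro ⟨hπ, -⟩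
      obtain ⟨i, h1, h2, h3⟩ := exists_dec π hπ.1 hπ.2
      exact ⟨i, h1, hπ, h2, h3⟩
    · rintro ⟨i, -, hπ, -⟩
      exact ⟨hπ, trivial⟩
  · rintro i j π ⟨hπ, h1, h2⟩ ⟨-, h3, h4⟩
    rcases lt_trichotomy i j with hh | hh | hh
    · exact (dec_unique_aux π hπ.1 h2 h3 hh).elim
    · exact hh
    · exact (dec_unique_aux π hπ.1 h4 h1 hh).elim

theorem NI_rec (n : ℕ) (S : ℕ → Prop) :
    NI n (fun r => 2 ≤ r ∧ S (r - 2)) =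
      ∑ j ∈ range (n / 2), wAv (j + 1) * NI (n - 2 * (j + 1)) S := by
  classical
  unfold NI
  refine (card_split (n / 2) _
    (fun j (π : Equiv.Perm (Fin n)) => (Invol π ∧ Avoids π) ∧ Dec (j + 1) π ∧
      ((∀ x : Fin n, x.val + 1 = n → (π x).val = j) ∧ 2 ≤ rlMaxCount π ∧ S (rlMaxCount π - 2))) ?_ ?_).trans ?_
  rotate_left 2
  · refine Finset.sum_congr rfl fun j hj => ?_
    rw [Finset.mem_range] at hj
    have h : n = (j + 1) + (n - 2 * (j + 1)) + (j + 1) := by omega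
    have := card_glue h (fun A => rlMaxCount A = 1) (fun μ => S (rlMaxCount μ))
      (fun π => (∀ x : Fin n, x.val + 1 = n → (π x).val = j) ∧
        2 ≤ rlMaxCount π ∧ S (rlMaxCount π - 2))
      (fun A μ => by
        have e : (∀ x : Fin n, x.val + 1 = n → (glue h A μ x).val = j) ↔ rlMaxCount A = 1 := by
          rw [rl_eq_one_iff]
          constructor
          · intro hh
            have := hh (hi h (Fin.last j)) (by simp only [hi, Fin.val_last]; omega)
            rw [glue_hi] at this
            simp only [lo] at this
            have h2 : A.symm (Fin.last j) = Fin.last j := by ext; simpa using this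
            rw [Equiv.symm_apply_eq] at h2
            exact h2.symm
          · intro hh x hx
            have : x = hi h (Fin.last j) := by ext; simp only [hi, Fin.val_last]; omega
            have h2 : A.symm (Fin.last j) = Fin.last j := by rw [Equiv.symm_apply_eq, hh]
            rw [this, glue_hi, h2]
            simp [lo]
        rw [e, glue_rl]
        constructor
        · rintro ⟨h1, h2, h3⟩
          refine ⟨h1, ?_⟩
          rw [h1] at h3
          have e : 2 * 1 + rlMaxCount μ - 2 = rlMaxCount μ := by omega
          rwa [e] at h3
        · rintro ⟨h1, h2⟩
          refine ⟨h1, by omega, ?_⟩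
          have e : 2 * rlMaxCount A + rlMaxCount μ - 2 = rlMaxCount μ := by omega
          rwa [e])
    rw [wAv]
    convert this
  · intro π
    constructor
    · rintro ⟨hπ, h2, hS⟩
      rcases n with _ | n
      · rw [rl_zero] at h2; omega
      have hne : π (Fin.last n) ≠ Fin.last n := by
        intro e
        have := (rl_eq_one_iff π).2 e
        omega
      have hd := dec_of_last π hπ.1 hπ.2 hne
      refine ⟨(π (Fin.last n)).val, by have := hd.1; omega, hπ, hd, ?_, h2, hS⟩
      intro x hx
      have : x = Fin.last n := by ext; simp; omega
      rw [this]
    · rintro ⟨i, -, hπ, -, -, hS⟩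
      exact ⟨hπ, hS⟩
  · rintro i j π ⟨_, h1, h2, -⟩ ⟨-, h3, h4, -⟩
    have := h1.1
    rw [← h2 ⟨n - 1, by omega⟩ (by simp only; omega), ← h4 ⟨n - 1, by omega⟩ (by simp only; omega)]

theorem NI_congr (n : ℕ) {S S' : ℕ → Prop} (h : ∀ r, S r ↔ S' r) : NI n S = NI n S' := by
  rw [show S = S' from funext fun r => propext (h r)]

theorem card_eq_NI {n : ℕ} (S : ℕ → Prop) {p : Equiv.Perm (Fin n) → Prop}
    {_ : DecidablePred p} (h : ∀ π, p π ↔ (Invol π ∧ Avoids π) ∧ S (rlMaxCount π)) :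
    (univ.filter p).card = NI n S := by
  classical
  unfold NI
  congr 1
  ext π
  simp only [mem_filter, mem_univ, true_and, h]

theorem NI_zero {S : ℕ → Prop} (h : ¬ S 0) : NI 0 S = 0 := by
  classical
  unfold NI
  rw [Finset.card_eq_zero, Finset.filter_eq_empty_iff]
  rintro π - ⟨-, hS⟩
  rw [rl_zero] at hS
  exact h hS

theorem NI_main (l : ℕ) : ∀ k, NI (2 * k + 1) (fun r => r = 2 * l + 1) =
    NI (2 * k + 2) (fun r => r = 2 * l + 2 ∨ r = 2 * l + 3) := by
  induction l with
  | zero =>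
    intro k
    rw [NI_congr (2 * k + 2) (S' := fun r => 2 ≤ r ∧ (fun r => r ≤ 1) (r - 2))
      (fun r => by simp only; omega), NI_rec _ (fun r => r ≤ 1)]
    simp only [mul_zero, zero_add]
    rw [NI_one, NI_total, show 2 * k / 2 + 1 = k + 1 by omega,
      show (2 * k + 2) / 2 = k + 1 by omega]
    refine Finset.sum_congr rfl fun i _ => ?_
    rw [wAv_succ, show 2 * k + 2 - 2 * (i + 1) = 2 * k - 2 * i by omega]
  | succ l ih =>
    intro k
    rw [NI_congr (2 * k + 2) (S' := fun r => 2 ≤ r ∧ (fun r => r = 2 * l + 2 ∨ r = 2 * l + 3) (r - 2))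
      (fun r => by simp only; omega), NI_rec _ (fun r => r = 2 * l + 2 ∨ r = 2 * l + 3),
      NI_congr (2 * k + 1) (S' := fun r => 2 ≤ r ∧ (fun r => r = 2 * l + 1) (r - 2))
      (fun r => by simp only; omega), NI_rec _ (fun r => r = 2 * l + 1),
      show (2 * k + 1) / 2 = k by omega, show (2 * k + 2) / 2 = k + 1 by omega,
      Finset.sum_range_succ, show 2 * k + 2 - 2 * (k + 1) = 0 by omega, NI_zero (by omega),
      mul_zero, add_zero]
    refine Finset.sum_congr rfl fun j hj => ?_
    rw [Finset.mem_range] at hj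
    rw [show 2 * k + 1 - 2 * (j + 1) = 2 * (k - (j + 1)) + 1 by omega,
      show 2 * k + 2 - 2 * (j + 1) = 2 * (k - (j + 1)) + 2 by omega, ih]

/-- Bijection: 132-avoiding involutions of length 2k+1 with 2l+1 right-to-left
maxima correspond to those of length 2k+2 with 2l+2 or 2l+3 right-to-left maxima. -/
theorem rlmax_bijection_odd_to_even (k l : ℕ) (hl : l ≤ k) :
    (Finset.univ.filter (fun π : Equiv.Perm (Fin (2 * k + 1)) =>
      (∀ i, π (π i) = i) ∧ occ p132 π = 0 ∧ rlMaxCount π = 2 * l + 1)).card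
    = (Finset.univ.filter (fun π : Equiv.Perm (Fin (2 * k + 2)) =>
      (∀ i, π (π i) = i) ∧ occ p132 π = 0 ∧
        (rlMaxCount π = 2 * l + 2 ∨ rlMaxCount π = 2 * l + 3))).card := by
  rw [card_eq_NI (fun r => r = 2 * l + 1), card_eq_NI (fun r => r = 2 * l + 2 ∨ r = 2 * l + 3)]
  · exact NI_main l k
  · intro π; rw [occ_iff, ← and_assoc]; rfl
  · intro π; rw [occ_iff, ← and_assoc]; rfl
end
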